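/- arXiv:1905.00291 — 2 statements merged into one kernel-verified Lean document; each statement's English description precedes it below -/
import Mathlib

section
/- There exists an absolute constant c ≥ 1 such that for every real K ≥ 1 there is a constant C(K) ≥ 1 with the following property: for every odd prime p, every finite set A ⊆ F_p satisfying |A+A| ≤ K|A| and |A−A|^{92} ≤ p^{52}, and every λ ∈ F_p with λ ≠ 0, one has r_{AA}(λ) ≤ C(K) (log p)^c ( |A|² / p + |A|^{149/156} ). -/
open Finset Pointwise

/-- `r_{AA}(λ) = #{(a₁,a₂) ∈ A×A : a₁a₂ = λ}`. -/
def mulRep (p : ℕ) (A : Finset (ZMod p)) (lam : ZMod p) : ℕ :=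
  ((A ×ˢ A).filter fun t => t.1 * t.2 = lam).card

namespace Inc
open Polynomial

lemma coeff_swap {R : Type*} [CommSemiring R] (f : R[X][X]) (i j : ℕ) :
    ((Bivariate.swap f).coeff i).coeff j = (f.coeff j).coeff i := by
  induction f using Polynomial.induction_on' with
  | add p q hp hq => simp [map_add, hp, hq]
  | monomial n a =>
    rw [Bivariate.swap_monomial]
    simp only [coeff_mul_C, coeff_map, coeff_C_mul, coeff_X_pow, coeff_monomial]
    by_cases h : j = n <;> simp [h, eq_comm]

/-- inner degree -/
noncomputable def dz {R : Type*} [CommSemiring R] (f : R[X][X]) : ℕ := (Bivariate.swap f).natDegree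

lemma dz_le_iff {R : Type*} [CommSemiring R] (f : R[X][X]) (d : ℕ) :
    dz f ≤ d ↔ ∀ j, (f.coeff j).natDegree ≤ d := by
  unfold dz
  constructor
  · intro h j
    rw [natDegree_le_iff_coeff_eq_zero]
    intro i hi
    rw [← coeff_swap, coeff_eq_zero_of_natDegree_lt (lt_of_le_of_lt h hi), coeff_zero]
  · intro h
    rw [natDegree_le_iff_coeff_eq_zero]
    intro i hi
    ext j
    rw [coeff_swap, coeff_eq_zero_of_natDegree_lt (lt_of_le_of_lt (h j) hi), coeff_zero]

lemma coeff_le_dz {R : Type*} [CommSemiring R] (f : R[X][X]) (j : ℕ) :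
    (f.coeff j).natDegree ≤ dz f := (dz_le_iff f _).1 le_rfl j

lemma dz_mul {R : Type*} [CommRing R] [IsDomain R] {f g : R[X][X]} (hf : f ≠ 0) (hg : g ≠ 0) :
    dz (f * g) = dz f + dz g := by
  unfold dz
  rw [map_mul, natDegree_mul]
  · simpa using hf
  · simpa using hg

lemma dz_mul_le {R : Type*} [CommRing R] [IsDomain R] (f g : R[X][X]) :
    dz (f * g) ≤ dz f + dz g := by
  unfold dz
  rw [map_mul]; exact natDegree_mul_le

lemma resultant_ne_zero_of_isRelPrime {R : Type*} [CommRing R] [IsDomain R]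
    [UniqueFactorizationMonoid R]
    (x y : R[X]) (hx : x ≠ 0) (hy : y ≠ 0) (h : IsRelPrime x y) :
    resultant x y ≠ 0 := by
  intro h0
  let K := FractionRing R
  let φ := algebraMap R K
  have hinj : Function.Injective φ := IsFractionRing.injective R K
  have h1 : resultant (x.map φ) (y.map φ) = 0 := by
    rw [natDegree_map_eq_of_injective hinj, natDegree_map_eq_of_injective hinj,
      resultant_map_map, h0, map_zero]
  rw [resultant_eq_zero_iff] at h1
  have hX : x.map φ ≠ 0 := by rwa [Ne, Polynomial.map_eq_zero_iff hinj]
  have hY : y.map φ ≠ 0 := by rwa [Ne, Polynomial.map_eq_zero_iff hinj]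
  have h2 : ¬ IsRelPrime (x.map φ) (y.map φ) := by
    rw [isRelPrime_iff_isCoprime]; exact h1.2
  unfold IsRelPrime at h2
  push Not at h2
  obtain ⟨g, ⟨a, ha⟩, ⟨b, hb⟩, hg⟩ := h2
  have hg0 : g ≠ 0 := by rintro rfl; simp at ha; exact hX ha
  have ha0 : a ≠ 0 := by rintro rfl; simp at ha; exact hX ha
  have hb0 : b ≠ 0 := by rintro rfl; simp at hb; exact hY hb
  have hgd : 0 < g.natDegree := by
    rw [Nat.pos_iff_ne_zero]
    intro h
    rw [natDegree_eq_zero] at h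
    obtain ⟨c, rfl⟩ := h
    apply hg
    rw [isUnit_C]
    exact isUnit_iff_ne_zero.2 (by rintro rfl; simp at hg0)
  obtain ⟨s, hs, hs'⟩ := IsLocalization.integerNormalization_spec (nonZeroDivisors R) b
  obtain ⟨t, ht, ht'⟩ := IsLocalization.integerNormalization_spec (nonZeroDivisors R) a
  set b' := IsLocalization.integerNormalization (nonZeroDivisors R) b with hb'
  set a' := IsLocalization.integerNormalization (nonZeroDivisors R) a with ha'
  have hs0 : s ≠ 0 := nonZeroDivisors.ne_zero hs
  have ht0 : t ≠ 0 := nonZeroDivisors.ne_zero ht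
  have e1 : b'.map φ = C (φ s) * b := by
    simp only [φ]; rw [hs']; simp [Algebra.smul_def]
  have e2 : a'.map φ = C (φ t) * a := by
    simp only [φ]; rw [ht']; simp [Algebra.smul_def]
  have e3 : x * (C t * b') = y * (C s * a') := by
    apply Polynomial.map_injective φ hinj
    simp only [Polynomial.map_mul, Polynomial.map_C, e1, e2, ha, hb]
    ring
  have e4 : y ∣ x * (C t * b') := ⟨_, e3⟩
  have e5 : y ∣ C t * b' := h.symm.dvd_of_dvd_mul_left e4
  have hb0' : b' ≠ 0 := by
    intro h; rw [h] at e1; simp at e1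
    rcases e1 with h | h
    · exact hs0 (hinj (by simpa using h))
    · exact hb0 h
  have e6 := natDegree_le_of_dvd e5 (mul_ne_zero (by simpa using ht0) hb0')
  rw [natDegree_C_mul ht0] at e6
  have e7 : b'.natDegree = b.natDegree := by
    rw [← natDegree_map_eq_of_injective hinj b', e1, natDegree_C_mul]
    intro h; exact hs0 (hinj (by simpa using h))
  have e8 : y.natDegree = g.natDegree + b.natDegree := by
    rw [← natDegree_map_eq_of_injective hinj y, hb, natDegree_mul hg0 hb0]
  omega

lemma natDegree_resultant_le {B : Type*} [CommRing B] [IsDomain B] (x y : B[X][X]) :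
    (resultant x y).natDegree ≤ x.natDegree * dz y + y.natDegree * dz x := by
  unfold resultant
  rw [Matrix.det_apply]
  apply natDegree_sum_le_of_forall_le
  intro σ _
  refine (natDegree_smul_le _ _).trans ?_
  refine (natDegree_prod_le _ _).trans ?_
  rw [Fin.sum_univ_add]
  refine add_le_add ?_ ?_
  · calc _ ≤ ∑ i : Fin x.natDegree, dz y := by
          apply Finset.sum_le_sum
          intro i _
          simp only [sylvester, Matrix.of_apply, Fin.addCases_left]
          split_ifs
          · exact coeff_le_dz _ _
          · simp
      _ = _ := by simp
  · calc _ ≤ ∑ i : Fin y.natDegree, dz x := by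
          apply Finset.sum_le_sum
          intro i _
          simp only [sylvester, Matrix.of_apply, Fin.addCases_right]
          split_ifs
          · exact coeff_le_dz _ _
          · simp
      _ = _ := by simp

lemma common_lines {B : Type*} [CommRing B] [IsDomain B] [UniqueFactorizationMonoid B]
    (x y : B[X][X]) (hx : x ≠ 0) (hy : y ≠ 0) (h : IsRelPrime x y)
    {ι : Type*} (T : Finset ι) (z v : ι → B) (hz : Set.InjOn z T)
    (h1 : ∀ j ∈ T, (x.map (evalRingHom (z j))).eval (v j) = 0)
    (h2 : ∀ j ∈ T, (y.map (evalRingHom (z j))).eval (v j) = 0) :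
    T.card ≤ x.natDegree * dz y + y.natDegree * dz x := by
  classical
  by_cases hd : x.natDegree = 0 ∧ y.natDegree = 0
  · obtain ⟨hx0, hy0⟩ := hd
    rw [natDegree_eq_zero] at hx0 hy0
    obtain ⟨a, rfl⟩ := hx0
    obtain ⟨b, rfl⟩ := hy0
    have : T = ∅ := by
      rw [Finset.eq_empty_iff_forall_notMem]
      intro j hj
      have e1 := h1 j hj
      have e2 := h2 j hj
      simp only [Polynomial.map_C, eval_C, coe_evalRingHom] at e1 e2
      have d1 : (X - C (z j)) ∣ a := dvd_iff_isRoot.2 e1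
      have d2 : (X - C (z j)) ∣ b := dvd_iff_isRoot.2 e2
      have := h (map_dvd C d1) (map_dvd C d2)
      rw [isUnit_C] at this
      exact not_isUnit_X_sub_C _ this
    simp [this]
  · have hr := resultant_ne_zero_of_isRelPrime x y hx hy h
    have hroot : ∀ j ∈ T, (resultant x y).IsRoot (z j) := by
      intro j hj
      obtain ⟨a, b, -, -, hab⟩ := exists_mul_add_mul_eq_C_resultant x y le_rfl le_rfl (by tauto)
      have := congrArg (fun f => (f.map (evalRingHom (z j))).eval (v j)) hab
      simp only [Polynomial.map_add, Polynomial.map_mul, eval_add, eval_mul, h1 j hj, h2 j hj,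
        zero_mul, add_zero, Polynomial.map_C, eval_C] at this
      exact this.symm
    have := Polynomial.card_le_degree_of_subset_roots (p := resultant x y) (Z := T.image z) (by
      intro a ha
      rw [Finset.mem_val, Finset.mem_image] at ha
      obtain ⟨j, hj, rfl⟩ := ha
      rw [mem_roots hr]
      exact hroot j hj)
    rw [Finset.card_image_of_injOn hz] at this
    exact this.trans (natDegree_resultant_le x y)

end Inc

namespace Inc
open Polynomial

/-- partial derivative in the inner variable -/
noncomputable def dZ {R : Type*} [CommRing R] (f : R[X][X]) : R[X][X] :=
  Bivariate.swap (derivative (Bivariate.swap f))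

lemma coeff_dZ {R : Type*} [CommRing R] (f : R[X][X]) (j : ℕ) :
    (dZ f).coeff j = derivative (f.coeff j) := by
  ext i
  unfold dZ
  rw [coeff_swap, coeff_derivative, coeff_derivative, ← coeff_swap]
  have : ((i : R[X]) + 1) = C ((i : R) + 1) := by simp
  rw [this, coeff_mul_C]

lemma dZ_add {R : Type*} [CommRing R] (f g : R[X][X]) : dZ (f + g) = dZ f + dZ g := by
  simp [dZ]

lemma dZ_monomial {R : Type*} [CommRing R] (n : ℕ) (a : R[X]) :
    dZ (monomial n a) = monomial n (derivative a) := by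
  ext1 j
  rw [coeff_dZ, coeff_monomial, coeff_monomial]
  split_ifs <;> simp

lemma dZ_map {R S : Type*} [CommRing R] [CommRing S] (φ : R →+* S) (f : R[X][X]) :
    dZ (f.map (mapRingHom φ)) = (dZ f).map (mapRingHom φ) := by
  ext1 j
  rw [coeff_dZ, coeff_map, coeff_map, coeff_dZ]
  simp [derivative_map]

lemma dZ_derivative {R : Type*} [CommRing R] (f : R[X][X]) :
    dZ (derivative f) = derivative (dZ f) := by
  ext1 j
  rw [coeff_dZ, coeff_derivative, coeff_derivative, coeff_dZ]
  have : ((j : R[X]) + 1) = C ((j : R) + 1) := by simp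
  rw [this, derivative_mul]
  simp

lemma chain {R : Type*} [CommRing R] (f : R[X][X]) (s c : R) :
    derivative (f.eval (C s * X + C c)) =
      (dZ f).eval (C s * X + C c) + C s * (derivative f).eval (C s * X + C c) := by
  induction f using Polynomial.induction_on' with
  | add p q hp hq => simp only [eval_add, derivative_add, dZ_add, hp, hq]; ring
  | monomial n a =>
    rw [dZ_monomial]
    simp only [eval_monomial, derivative_mul, derivative_pow, derivative_monomial]
    simp
    ring

/-- second-order tangency form -/
noncomputable def P1 {R : Type*} [CommRing R] (f : R[X][X]) : R[X][X] :=
  dZ (dZ f) * derivative f * derivative f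
    - (dZ (derivative f) * dZ f * derivative f + dZ (derivative f) * dZ f * derivative f)
    + derivative (derivative f) * dZ f * dZ f

lemma P1_map {R S : Type*} [CommRing R] [CommRing S] (φ : R →+* S) (f : R[X][X]) :
    P1 (f.map (mapRingHom φ)) = (P1 f).map (mapRingHom φ) := by
  simp only [P1, Polynomial.map_add, Polynomial.map_sub, Polynomial.map_mul, ← derivative_map,
    ← dZ_map]

lemma P1_eval {R : Type*} [CommRing R] (f : R[X][X]) (s c : R) :
    (P1 f).eval (C s * X + C c) =
      (derivative f).eval (C s * X + C c) ^ 2 *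
        derivative (derivative (f.eval (C s * X + C c)))
      - 2 * (derivative f).eval (C s * X + C c) * derivative (f.eval (C s * X + C c)) *
        derivative ((derivative f).eval (C s * X + C c))
      + (derivative (derivative f)).eval (C s * X + C c) *
        derivative (f.eval (C s * X + C c)) ^ 2 := by
  have h1 := chain f s c
  have h2 := chain (derivative f) s c
  have h3 := chain (dZ f) s c
  rw [h1, h2]
  simp only [derivative_add, derivative_mul, h3, h2, derivative_C, zero_mul, zero_add, P1,
    eval_add, eval_sub, eval_mul, dZ_derivative]
  ring

lemma P1_eval_zero {R : Type*} [CommRing R] (f : R[X][X]) (s c : R)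
    (h : f.eval (C s * X + C c) = 0) : (P1 f).eval (C s * X + C c) = 0 := by
  rw [P1_eval, h]; simp

lemma L1 {κ : Type*} [Field κ] (p : ℕ) (hp : ∀ n : ℕ, 0 < n → n < p → (n : κ) ≠ 0)
    (g b r : κ[X]) (a : κ) (h0 : g.eval a = 0) (h1 : (derivative g).eval a = 0)
    (hb : b.eval a ≠ 0) (hdeg : g.natDegree < p)
    (hd : g ∣ b ^ 2 * derivative (derivative g) - 2 * b * derivative g * derivative b
      + r * derivative g ^ 2) : g = 0 := by
  by_contra hg
  obtain ⟨h, hgh, hh⟩ := exists_eq_pow_rootMultiplicity_mul_and_not_dvd g hg a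
  rw [dvd_iff_isRoot] at hh
  have hm2 : 1 < g.rootMultiplicity a := (one_lt_rootMultiplicity_iff_isRoot hg).2 ⟨h0, h1⟩
  have hmd : g.rootMultiplicity a ≤ g.natDegree := by
    have := natDegree_le_of_dvd (pow_rootMultiplicity_dvd g a) hg
    rwa [natDegree_pow, natDegree_X_sub_C, mul_one] at this
  obtain ⟨n, hn⟩ : ∃ n, g.rootMultiplicity a = n + 2 := ⟨g.rootMultiplicity a - 2, by omega⟩
  rw [hn] at hgh hmd
  obtain ⟨q, hq⟩ := hd
  have e1 : derivative g = (X - C a) ^ (n + 1) * (((n : κ[X]) + 2) * h + (X - C a) * derivative h) := by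
    rw [hgh]; simp only [derivative_mul, derivative_X_sub_C_pow]; push_cast
    simp only [map_add, map_natCast, map_ofNat]
    ring
  have e2 : derivative (derivative g) = (X - C a) ^ n * (((n : κ[X]) + 2) * ((n : κ[X]) + 1) * h +
      (X - C a) * (2 * ((n : κ[X]) + 2) * derivative h + (X - C a) * derivative (derivative h))) := by
    rw [e1]
    simp only [derivative_mul, derivative_X_sub_C_pow, derivative_add, derivative_sub, derivative_X,
      derivative_C, derivative_natCast, derivative_ofNat]
    push_cast
    simp only [map_add, map_natCast, map_ofNat, map_one]
    ring
  have hX : (X - C a) ^ n ≠ 0 := pow_ne_zero _ (X_sub_C_ne_zero a)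
  rw [e2, e1, hgh] at hq
  have e3 : (b ^ 2 * (((n : κ[X]) + 2) * ((n : κ[X]) + 1) * h +
      (X - C a) * (2 * ((n : κ[X]) + 2) * derivative h + (X - C a) * derivative (derivative h)))
      - 2 * b * ((X - C a) * (((n : κ[X]) + 2) * h + (X - C a) * derivative h)) * derivative b
      + r * (X - C a) ^ (n + 2) * (((n : κ[X]) + 2) * h + (X - C a) * derivative h) ^ 2)
      = (X - C a) ^ 2 * h * q := by
    apply mul_left_cancel₀ hX
    linear_combination hq
  have e4 := congrArg (eval a) e3
  simp at e4
  rcases e4 with e4 | (e4 | e4) | e4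
  · exact hb e4
  · exact hp (n + 2) (by omega) (by omega) (by push_cast; exact e4)
  · exact hp (n + 1) (by omega) (by omega) (by push_cast; exact e4)
  · exact hh e4

lemma natDegree_eval_line {R : Type*} [CommRing R] (f : R[X][X]) (L : R[X])
    (hL : L.natDegree ≤ 1) : (f.eval L).natDegree ≤ dz f + f.natDegree := by
  rw [eval_eq_sum_range]
  apply natDegree_sum_le_of_forall_le
  intro i hi
  refine natDegree_mul_le.trans (add_le_add (coeff_le_dz _ _) ?_)
  refine natDegree_pow_le.trans ?_
  have : i ≤ f.natDegree := by simpa [Nat.lt_succ_iff] using hi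
  nlinarith

lemma natDegree_linear' {R : Type*} [CommRing R] (s c : R) :
    (C s * X + C c : R[X]).natDegree ≤ 1 := natDegree_linear_le

lemma line_on {κ : Type*} [Field κ] (p : ℕ) (hp : ∀ n : ℕ, 0 < n → n < p → (n : κ) ≠ 0)
    (f : κ[X][X]) (a L : κ) (h0 : (f.map (evalRingHom a)).eval L = 0)
    (hb : ((derivative f).map (evalRingHom a)).eval L ≠ 0)
    (hd : f ∣ P1 f) (hdeg : dz f + f.natDegree < p) :
    ∃ s : κ, f.eval (C s * X + C (L - s * a)) = 0 := by
  set s : κ := - ((dZ f).map (evalRingHom a)).eval L / ((derivative f).map (evalRingHom a)).eval L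
    with hs
  refine ⟨s, ?_⟩
  have key : ∀ h : κ[X][X], (h.eval (C s * X + C (L - s * a))).eval a =
      (h.map (evalRingHom a)).eval L := by
    intro h
    have : eval a (C s * X + C (L - s * a)) = L := by simp
    have h2 := eval₂_at_apply (p := h) (evalRingHom a) (C s * X + C (L - s * a))
    rw [coe_evalRingHom, this] at h2
    rw [eval_map, h2]
  apply L1 p hp _ ((derivative f).eval (C s * X + C (L - s * a)))
    ((derivative (derivative f)).eval (C s * X + C (L - s * a))) a
  · rw [key, h0]
  · rw [chain, eval_add, eval_mul, key, key, eval_C, hs]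
    field_simp; ring
  · rwa [key]
  · exact lt_of_le_of_lt (natDegree_eval_line _ _ (natDegree_linear' _ _)) hdeg
  · rw [← P1_eval]
    exact eval_dvd hd

end Inc

namespace Inc
open Polynomial

section
variable {k : Type*} [Field k]

/-- degree in the innermost variable -/
noncomputable def dw (f : k[X][X][X]) : ℕ :=
  dz (f.map ((Bivariate.swap (R := k) : k[X][X] ≃ₐ[k] k[X][X]) : k[X][X] →+* k[X][X]))

lemma dw_le_iff (f : k[X][X][X]) (d : ℕ) :
    dw f ≤ d ↔ ∀ j i, ((f.coeff j).coeff i).natDegree ≤ d := by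
  unfold dw
  rw [dz_le_iff]
  refine forall_congr' fun j => ?_
  rw [coeff_map]
  exact dz_le_iff (f.coeff j) d

lemma map_swap_ne {f : k[X][X][X]} (hf : f ≠ 0) :
    (f.map ((Bivariate.swap (R := k) : k[X][X] ≃ₐ[k] k[X][X]) : k[X][X] →+* k[X][X])) ≠ 0 := by
  rw [Ne, Polynomial.map_eq_zero_iff]
  · exact hf
  · exact (Bivariate.swap (R := k)).injective

lemma dw_mul {f g : k[X][X][X]} (hf : f ≠ 0) (hg : g ≠ 0) : dw (f * g) = dw f + dw g := by
  unfold dw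
  rw [Polynomial.map_mul, dz_mul (map_swap_ne hf) (map_swap_ne hg)]

/-- combined degree -/
noncomputable def DD (f : k[X][X][X]) : ℕ := dw f + f.natDegree

lemma DD_mul {f g : k[X][X][X]} (hf : f ≠ 0) (hg : g ≠ 0) : DD (f * g) = DD f + DD g := by
  unfold DD
  rw [dw_mul hf hg, natDegree_mul hf hg]; ring

lemma natDegree_form {S : Type*} [CommRing S] (h b q u r : S[X]) (d : ℕ)
    (hh : h.natDegree ≤ d) (hb : b.natDegree ≤ d) (hq : q.natDegree ≤ d) (hu : u.natDegree ≤ d)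
    (hr : r.natDegree ≤ d) :
    (h * b * b - (q * u * b + q * u * b) + r * u * u).natDegree ≤ 3 * d := by
  have tri : ∀ a b c : S[X], a.natDegree ≤ d → b.natDegree ≤ d →
      c.natDegree ≤ d → (a * b * c).natDegree ≤ 3 * d := by
    intro a b c ha hb hc
    have := natDegree_mul_le (p := a * b) (q := c)
    have := natDegree_mul_le (p := a) (q := b)
    omega
  refine (natDegree_add_le _ _).trans (max_le ((natDegree_sub_le _ _).trans (max_le
    (tri _ _ _ hh hb hb)
    ((natDegree_add_le _ _).trans (max_le (tri _ _ _ hq hu hb) (tri _ _ _ hq hu hb)))))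
    (tri _ _ _ hr hu hu))

lemma natDegree_P1 {R : Type*} [CommRing R] (f : R[X][X]) :
    (P1 f).natDegree ≤ 3 * f.natDegree := by
  have h1 : ∀ g : R[X][X], (derivative g).natDegree ≤ g.natDegree :=
    fun f => (natDegree_derivative_le f).trans (by omega)
  have hd : ∀ g : R[X][X], (dZ g).natDegree ≤ g.natDegree := by
    intro g
    rw [natDegree_le_iff_coeff_eq_zero]
    intro i hi
    rw [coeff_dZ, coeff_eq_zero_of_natDegree_lt hi, derivative_zero]
  exact natDegree_form _ _ _ _ _ _ ((hd _).trans (hd f)) (h1 f) ((hd _).trans (h1 f)) (hd f)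
    ((h1 _).trans (h1 f))

lemma natDegree_deriv_le' {R : Type*} [CommRing R] (f : R[X]) :
    (derivative f).natDegree ≤ f.natDegree := (natDegree_derivative_le f).trans (by omega)

lemma dz_dZ {R : Type*} [CommRing R] (f : R[X][X]) : dz (dZ f) ≤ dz f := by
  rw [dz_le_iff]
  intro j
  rw [coeff_dZ]
  exact (natDegree_deriv_le' _).trans (coeff_le_dz f j)

lemma natDegree_mul_natCast_add_one {R : Type*} [CommRing R] (f : R[X]) (j : ℕ) :
    (f * ((j : R[X]) + 1)).natDegree ≤ f.natDegree := by
  have : ((j : R[X]) + 1) = C ((j : R) + 1) := by simp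
  rw [this]; exact natDegree_mul_C_le _ _

lemma dz_derivative {R : Type*} [CommRing R] (f : R[X][X]) : dz (derivative f) ≤ dz f := by
  rw [dz_le_iff]
  intro j
  rw [coeff_derivative]
  exact (natDegree_mul_natCast_add_one _ _).trans (coeff_le_dz f _)

lemma dw_derivative (f : k[X][X][X]) : dw (derivative f) ≤ dw f := by
  unfold dw
  rw [← derivative_map]; exact dz_derivative _

lemma dw_dZ (f : k[X][X][X]) : dw (dZ f) ≤ dw f := by
  rw [dw_le_iff]
  intro j i
  rw [coeff_dZ, coeff_derivative]
  have : ((i : k[X]) + 1) = C ((i : k) + 1) := by simp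
  rw [this]
  exact (natDegree_mul_C_le _ _).trans ((dw_le_iff f _).1 le_rfl _ _)

lemma natDegree_P1_hom {R S : Type*} [CommRing R] [CommRing S] (φ : R[X][X] →+* S[X])
    (f : R[X][X]) (d : ℕ) (h : (φ (dZ f)).natDegree ≤ d) (h1 : (φ (derivative f)).natDegree ≤ d)
    (h2 : (φ (dZ (dZ f))).natDegree ≤ d) (h3 : (φ (dZ (derivative f))).natDegree ≤ d)
    (h4 : (φ (derivative (derivative f))).natDegree ≤ d) :
    (φ (P1 f)).natDegree ≤ 3 * d := by
  have e : φ (P1 f) = φ (dZ (dZ f)) * φ (derivative f) * φ (derivative f)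
    - (φ (dZ (derivative f)) * φ (dZ f) * φ (derivative f)
        + φ (dZ (derivative f)) * φ (dZ f) * φ (derivative f))
    + φ (derivative (derivative f)) * φ (dZ f) * φ (dZ f) := by
    unfold P1
    simp only [map_add, map_sub, map_mul]
  rw [e]
  exact natDegree_form _ _ _ _ _ _ h2 h1 h3 h h4

lemma dz_P1 {R : Type*} [CommRing R] (f : R[X][X]) : dz (P1 f) ≤ 3 * dz f :=
  natDegree_P1_hom ((Bivariate.swap (R := R) : R[X][X] ≃ₐ[R] R[X][X]) : R[X][X] →+* R[X][X]) f _
    (dz_dZ f) (dz_derivative f) ((dz_dZ _).trans (dz_dZ f)) ((dz_dZ _).trans (dz_derivative f))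
    ((dz_derivative _).trans (dz_derivative f))

lemma dw_P1 (f : k[X][X][X]) : dw (P1 f) ≤ 3 * dw f :=
  natDegree_P1_hom (((Bivariate.swap (R := k[X]) : _ ≃ₐ[k[X]] _) : k[X][X][X] →+* k[X][X][X]).comp
      (mapRingHom ((Bivariate.swap (R := k) : k[X][X] ≃ₐ[k] k[X][X]) : k[X][X] →+* k[X][X]))) f _
    (dw_dZ f) (dw_derivative f) ((dw_dZ _).trans (dw_dZ f)) ((dw_dZ _).trans (dw_derivative f))
    ((dw_derivative _).trans (dw_derivative f))

lemma DD_P1 (f : k[X][X][X]) : DD (P1 f) ≤ 3 * DD f := by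
  unfold DD
  have := dw_P1 f
  have := natDegree_P1 f
  omega

/-- restriction to a line with fixed `w` -/
noncomputable def psi (w m b : k) : k[X][X][X] →+* k[X] :=
  (evalRingHom (C m * X + C b)).comp (mapRingHom (mapRingHom (evalRingHom w)))

/-- restriction to a line with fixed `z` -/
noncomputable def evz (z m b : k) : k[X][X][X] →+* k[X] :=
  (evalRingHom (C m * X + C b)).comp (mapRingHom (evalRingHom (C z)))

lemma psi_apply (w m b : k) (f : k[X][X][X]) :
    psi w m b f = (f.map (mapRingHom (evalRingHom w))).eval (C m * X + C b) := rfl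

lemma evz_apply (z m b : k) (f : k[X][X][X]) :
    evz z m b f = (f.map (evalRingHom (C z))).eval (C m * X + C b) := rfl

lemma psi_P1 (w m b : k) (f : k[X][X][X]) (h : psi w m b f = 0) : psi w m b (P1 f) = 0 := by
  rw [psi_apply] at h ⊢
  rw [← P1_map]
  exact P1_eval_zero _ _ _ h

lemma meet (w m b z m' b' : k) (h : m * z + b = m' * w + b') (f : k[X][X][X]) :
    (evz z m' b' f).eval w = (psi w m b f).eval z := by
  have : (evalRingHom w).comp (evz z m' b') = (evalRingHom z).comp (psi w m b) := by
    apply Polynomial.ringHom_ext'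
    · apply Polynomial.ringHom_ext'
      · apply Polynomial.ringHom_ext'
        · ext a; simp [evz, psi]
        · simp [evz, psi]
      · simp [evz, psi]
    · simp [evz, psi, h]
  exact congrArg (fun g : k[X][X][X] →+* k => g f) this

lemma natDegree_evz (z m b : k) (f : k[X][X][X]) : (evz z m b f).natDegree ≤ DD f := by
  rw [evz_apply, DD]
  refine (natDegree_eval_line _ _ (natDegree_linear' _ _)).trans (add_le_add ?_ natDegree_map_le)
  rw [dz_le_iff]
  intro j
  rw [coeff_map, coe_evalRingHom, eval_eq_sum_range]
  apply natDegree_sum_le_of_forall_le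
  intro i _
  rw [← C_pow]
  exact (natDegree_mul_C_le _ _).trans ((dw_le_iff f _).1 le_rfl _ _)

variable {ι ι' : Type*} (P : Finset ι) (w m b : ι → k) (z m' b' : ι' → k)

open Classical in
/-- the lines of the first family that meet the line `j` and lie on `f` -/
noncomputable def cnt (f : k[X][X][X]) (j : ι') : Finset ι :=
  P.filter fun i => m i * z j + b i = m' j * w i + b' j ∧ psi (w i) (m i) (b i) f = 0

lemma many (hw : Set.InjOn w P) (f : k[X][X][X]) (j : ι') (h : evz (z j) (m' j) (b' j) f ≠ 0) :
    (cnt P w m b z m' b' f j).card ≤ DD f := by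
  classical
  have := Polynomial.card_le_degree_of_subset_roots (p := evz (z j) (m' j) (b' j) f)
    (Z := (cnt P w m b z m' b' f j).image w) (by
      intro a ha
      rw [Finset.mem_val, Finset.mem_image] at ha
      obtain ⟨i, hi, rfl⟩ := ha
      rw [mem_roots h, IsRoot]
      simp only [cnt, Finset.mem_filter] at hi
      rw [meet _ _ _ _ _ _ hi.2.1, hi.2.2, eval_zero])
  rw [Finset.card_image_of_injOn (hw.mono (by simp [cnt]; intro x hx; exact hx.1))] at this
  exact this.trans (natDegree_evz _ _ _ _)

end
end Inc

namespace Inc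
open Polynomial

section
variable {k : Type*} [Field k]
variable {ι ι' : Type*} (P : Finset ι) (w m b : ι → k) (z m' b' : ι' → k)

lemma evz_frac (zj mj bj : k) (h : k[X][X][X]) :
    ((h.map (mapRingHom (algebraMap k[X] (FractionRing k[X])))).map
      (evalRingHom (algebraMap k[X] (FractionRing k[X]) (C zj)))).eval
      (algebraMap k[X] (FractionRing k[X]) (C mj * X + C bj))
    = algebraMap k[X] (FractionRing k[X]) (evz zj mj bj h) := by
  set φ := algebraMap k[X] (FractionRing k[X])
  rw [evz_apply, Polynomial.map_map, ← eval₂_at_apply, eval₂_eq_eval_map, Polynomial.map_map]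
  congr 2
  ext a <;> simp

/-- two lines of the second family in one plane force a plane -/
lemma plane_case (π : k[X][X][X]) (hπ : Prime π)
    (z1 m1 b1 z2 m2 b2 : k) (hz : z1 ≠ z2) (s1 s2 : FractionRing k[X])
    (h1 : (π.map (mapRingHom (algebraMap k[X] (FractionRing k[X])))).eval
      (C s1 * X + C (algebraMap k[X] (FractionRing k[X]) (C m1 * X + C b1) -
        s1 * algebraMap k[X] (FractionRing k[X]) (C z1))) = 0)
    (he : (C s1 * X + C (algebraMap k[X] (FractionRing k[X]) (C m1 * X + C b1) -
        s1 * algebraMap k[X] (FractionRing k[X]) (C z1)) : (FractionRing k[X])[X]) =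
      C s2 * X + C (algebraMap k[X] (FractionRing k[X]) (C m2 * X + C b2) -
        s2 * algebraMap k[X] (FractionRing k[X]) (C z2))) :
    ∃ α β γ δ : k, ∀ wi mi bi : k, psi wi mi bi π = 0 → mi = α + β * wi ∧ bi = γ + δ * wi := by
  set φ := algebraMap k[X] (FractionRing k[X]) with hφ
  have hinj : Function.Injective φ := IsFractionRing.injective _ _
  have e1 : s1 = s2 := by
    have := congrArg (fun f => f.coeff 1) he
    simpa using this
  have e0 : φ (C m1 * X + C b1) - s1 * φ (C z1) = φ (C m2 * X + C b2) - s2 * φ (C z2) := by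
    have := congrArg (fun f => f.coeff 0) he
    simpa using this
  subst e1
  have hz' : z1 - z2 ≠ 0 := sub_ne_zero.2 hz
  set sp : k[X] := C ((m1 - m2) / (z1 - z2)) * X + C ((b1 - b2) / (z1 - z2)) with hsp
  have hspe : sp * C (z1 - z2) = (C m1 * X + C b1) - (C m2 * X + C b2) := by
    have a1 : C ((m1 - m2) / (z1 - z2)) * C (z1 - z2) = C m1 - C m2 := by
      rw [← C_mul, div_mul_cancel₀ _ hz', C_sub]
    have a2 : C ((b1 - b2) / (z1 - z2)) * C (z1 - z2) = C b1 - C b2 := by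
      rw [← C_mul, div_mul_cancel₀ _ hz', C_sub]
    rw [hsp]
    linear_combination X * a1 + a2
  have hs : s1 = φ sp := by
    have h3 : φ (C (z1 - z2)) ≠ 0 := by
      rw [Ne, map_eq_zero_iff φ hinj, C_eq_zero]; exact hz'
    apply mul_right_cancel₀ h3
    rw [← map_mul, hspe, C_sub, map_sub, map_sub]
    linear_combination -e0
  set cp : k[X] := C m1 * X + C b1 - sp * C z1 with hcp
  have hq : π.eval (C sp * X + C cp) = 0 := by
    apply Polynomial.map_injective φ hinj
    rw [Polynomial.map_zero, ← h1, hs]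
    have := eval₂_at_apply (p := π) (mapRingHom φ) (C sp * X + C cp)
    rw [coe_mapRingHom] at this
    rw [← this, eval_map]
    congr 1
    simp [hcp]
  have hdvd : (X - C (C sp * X + C cp)) ∣ π := dvd_iff_isRoot.2 hq
  obtain ⟨u, hu⟩ := hdvd
  have huu : IsUnit u := by
    rcases hπ.irreducible.isUnit_or_isUnit hu with h | h
    · exact absurd h (not_isUnit_X_sub_C _)
    · exact h
  refine ⟨(b1 - b2) / (z1 - z2), (m1 - m2) / (z1 - z2),
    b1 - (b1 - b2) / (z1 - z2) * z1, m1 - (m1 - m2) / (z1 - z2) * z1, ?_⟩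
  intro wi mi bi h
  rw [hu, map_mul] at h
  have h4 : psi wi mi bi (X - C (C sp * X + C cp)) = 0 := by
    rcases mul_eq_zero.1 h with h | h
    · exact h
    · exact absurd h (huu.map (psi wi mi bi)).ne_zero
  have h5 : C mi * X + C bi = C (sp.eval wi) * X + C (cp.eval wi) := by
    rw [psi_apply] at h4
    simp at h4
    simpa using sub_eq_zero.1 h4
  have h6 := congrArg (fun f => f.coeff 1) h5
  have h7 := congrArg (fun f => f.coeff 0) h5
  simp [hsp] at h6
  simp [hcp, hsp] at h7
  constructor
  · rw [h6]; ring
  · rw [h7]; ring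

open Classical in
lemma prime_case (p E k0 : ℕ) (hp : ∀ n : ℕ, 0 < n → n < p → (n : k) ≠ 0) (hE : 2 * E < p)
    (hw : Set.InjOn w P)
    (hcol : ∀ α β γ δ : k, (P.filter fun i => m i = α + β * w i ∧ b i = γ + δ * w i).card ≤ k0)
    (π : k[X][X][X]) (hπ : Prime π) (he : π.natDegree ≤ E) (hdz : dz π ≤ E)
    (J : Finset ι') (hz : Set.InjOn z J)
    (hJ : ∀ j ∈ J, evz (z j) (m' j) (b' j) π = 0 ∧
      3 * DD π + k0 + 1 ≤ (cnt P w m b z m' b' π j).card) :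
    J.card ≤ 8 * π.natDegree * (dz π + 1) + dz π := by
  have hzC : ∀ T : Finset ι', T ⊆ J → Set.InjOn (fun j => (C (z j) : k[X])) T := by
    intro T hT x hx y hy hxy
    exact hz (hT hx) (hT hy) (C_injective hxy)
  by_cases h0 : π.natDegree = 0
  · obtain ⟨a, rfl⟩ := natDegree_eq_zero.1 h0
    have ha : a ≠ 0 := by rintro rfl; exact hπ.ne_zero (by simp)
    have := Polynomial.card_le_degree_of_subset_roots (p := a)
      (Z := J.image (fun j => (C (z j) : k[X]))) (by
        intro x hx
        rw [Finset.mem_val, Finset.mem_image] at hx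
        obtain ⟨j, hj, rfl⟩ := hx
        rw [mem_roots ha, IsRoot]
        have := (hJ j hj).1
        simpa [evz_apply] using this)
    rw [Finset.card_image_of_injOn (hzC J subset_rfl)] at this
    have h2 := coeff_le_dz (C a) 0
    rw [coeff_C_zero] at h2
    omega
  have hcast : ∀ n : ℕ, 0 < n → n < p → ((n : ℕ) : k[X][X]) ≠ 0 := by
    intro n h1 h2 h3
    apply hp n h1 h2
    have : (C (C (n : k)) : k[X][X]) = 0 := by simpa using h3
    rwa [C_eq_zero, C_eq_zero] at this
  have hder : derivative π ≠ 0 := by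
    intro h
    have := congrArg (fun f => f.coeff (π.natDegree - 1)) h
    simp only [coeff_derivative, coeff_zero] at this
    rw [Nat.sub_add_cancel (by omega), mul_eq_zero] at this
    rcases this with h | h
    · exact hπ.ne_zero (leadingCoeff_eq_zero.1 h)
    · apply hcast π.natDegree (by omega) (by omega)
      rw [← h]
      have : π.natDegree = (π.natDegree - 1) + 1 := by omega
      conv_lhs => rw [this]
      push_cast; rfl
  have hP1 : ∀ j ∈ J, evz (z j) (m' j) (b' j) (P1 π) = 0 := by
    intro j hj
    by_contra hne
    have h1 := many P w m b z m' b' hw (P1 π) j hne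
    have h2 := DD_P1 π
    have h3 : (cnt P w m b z m' b' π j).card ≤ (cnt P w m b z m' b' (P1 π) j).card := by
      apply Finset.card_le_card
      intro i hi
      simp only [cnt, Finset.mem_filter] at hi ⊢
      exact ⟨hi.1, hi.2.1, psi_P1 _ _ _ _ hi.2.2⟩
    have := (hJ j hj).2
    omega
  by_cases hd : π ∣ P1 π
  swap
  · have h1 := common_lines π (P1 π) hπ.ne_zero (by rintro h; rw [h] at hd; simp at hd)
      (hπ.irreducible.isRelPrime_iff_not_dvd.2 hd) J (fun j => C (z j))
      (fun j => C (m' j) * X + C (b' j)) (hzC J subset_rfl) (fun j hj => (hJ j hj).1) hP1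
    have h2 := dz_P1 π
    have h3 := natDegree_P1 π
    nlinarith [Nat.mul_le_mul_left π.natDegree h2, Nat.mul_le_mul_right (dz π) h3]
  set J1 := J.filter (fun j => evz (z j) (m' j) (b' j) (derivative π) = 0) with hJ1
  set J2 := J.filter (fun j => ¬ evz (z j) (m' j) (b' j) (derivative π) = 0) with hJ2
  have hsum : J1.card + J2.card = J.card := Finset.card_filter_add_card_filter_not _
  have hc1 : J1.card ≤ π.natDegree * dz π + π.natDegree * dz π := by
    have hnd : ¬ π ∣ derivative π := by
      intro h
      have h1 := natDegree_le_of_dvd h hder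
      have h2 := natDegree_derivative_le π
      omega
    have h1 := common_lines π (derivative π) hπ.ne_zero hder
      (hπ.irreducible.isRelPrime_iff_not_dvd.2 hnd) J1 (fun j => C (z j))
      (fun j => C (m' j) * X + C (b' j)) (hzC J1 (Finset.filter_subset _ _))
      (fun j hj => (hJ j (Finset.filter_subset _ _ hj)).1)
      (fun j hj => (Finset.mem_filter.1 hj).2)
    have h2 := dz_derivative π
    have h3 := natDegree_deriv_le' π
    exact h1.trans (add_le_add (Nat.mul_le_mul_left _ h2) (Nat.mul_le_mul_right _ h3))
  have hc2 : J2.card ≤ π.natDegree := by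
    by_contra hlt
    push Not at hlt
    let φ := algebraMap k[X] (FractionRing k[X])
    have hinj : Function.Injective φ := IsFractionRing.injective _ _
    have hinj2 : Function.Injective (mapRingHom φ) := Polynomial.map_injective φ hinj
    set f := π.map (mapRingHom φ) with hf
    have hf0 : f ≠ 0 := by rw [hf, Ne, Polynomial.map_eq_zero_iff hinj2]; exact hπ.ne_zero
    have hfd : f.natDegree = π.natDegree := natDegree_map_eq_of_injective hinj2 _
    have hfz : dz f ≤ dz π := by
      rw [dz_le_iff]; intro j
      rw [hf, coeff_map, coe_mapRingHom]
      exact natDegree_map_le.trans (coeff_le_dz π j)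
    have hpF : ∀ n : ℕ, 0 < n → n < p → (n : FractionRing k[X]) ≠ 0 := by
      intro n h1 h2 h3
      apply hp n h1 h2
      have h4 : φ (C (n : k)) = 0 := by simpa using h3
      rwa [map_eq_zero_iff φ hinj, C_eq_zero] at h4
    have hl : ∀ j : ι', ∃ s : FractionRing k[X], j ∈ J2 →
        f.eval (C s * X + C (φ (C (m' j) * X + C (b' j)) - s * φ (C (z j)))) = 0 := by
      intro j
      by_cases hj : j ∈ J2
      · obtain ⟨hj1, hj2⟩ := Finset.mem_filter.1 hj
        obtain ⟨s, hs⟩ := line_on p hpF f (φ (C (z j))) (φ (C (m' j) * X + C (b' j)))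
          (by rw [hf, evz_frac, (hJ j hj1).1, map_zero])
          (by
            rw [hf, derivative_map, evz_frac, Ne, map_eq_zero_iff _ hinj]; exact hj2)
          (by rw [hf, P1_map]; exact map_dvd (mapRingHom (mapRingHom φ)) hd)
          (by omega)
        exact ⟨s, fun _ => hs⟩
      · exact ⟨0, fun h => absurd h hj⟩
    choose s hs using hl
    have hcard : f.roots.toFinset.card < J2.card := by
      refine lt_of_le_of_lt ?_ hlt
      rw [← hfd]
      exact (Multiset.toFinset_card_le _).trans (card_roots' f)
    obtain ⟨j1, hj1, j2, hj2, hne, heq⟩ := Finset.exists_ne_map_eq_of_card_lt_of_maps_to hcard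
      (f := fun j => (C (s j) * X + C (φ (C (m' j) * X + C (b' j)) - s j * φ (C (z j))) :
        (FractionRing k[X])[X])) (by
        intro j hj
        rw [Finset.mem_coe, Multiset.mem_toFinset, mem_roots hf0]
        exact hs j hj)
    have hj1' := (Finset.mem_filter.1 hj1).1
    have hj2' := (Finset.mem_filter.1 hj2).1
    obtain ⟨α, β, γ, δ, hpl⟩ := plane_case π hπ (z j1) (m' j1) (b' j1) (z j2) (m' j2) (b' j2)
      (fun h => hne (hz hj1' hj2' h)) (s j1) (s j2) (hs j1 hj1) heq
    have h1 := hcol α β γ δ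
    have h2 : (cnt P w m b z m' b' π j1).card ≤
        (P.filter fun i => m i = α + β * w i ∧ b i = γ + δ * w i).card := by
      apply Finset.card_le_card
      intro i hi
      simp only [cnt, Finset.mem_filter] at hi ⊢
      exact ⟨hi.1, hpl _ _ _ hi.2.2⟩
    have := (hJ j1 hj1').2
    omega
  nlinarith

open Classical in
lemma claim (p E k0 : ℕ) (hp : ∀ n : ℕ, 0 < n → n < p → (n : k) ≠ 0) (hE : 2 * E < p)
    (hw : Set.InjOn w P)
    (hcol : ∀ α β γ δ : k, (P.filter fun i => m i = α + β * w i ∧ b i = γ + δ * w i).card ≤ k0)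
    (f : k[X][X][X]) : f ≠ 0 → f.natDegree ≤ E → dz f ≤ E →
    ∀ (J : Finset ι'), Set.InjOn z J →
    (∀ j ∈ J, evz (z j) (m' j) (b' j) f = 0 ∧
      3 * DD f + k0 + 1 ≤ (cnt P w m b z m' b' f j).card) →
    J.card ≤ 8 * f.natDegree * (dz f + 1) + dz f := by
  induction f using UniqueFactorizationMonoid.induction_on_coprime with
  | h0 => intro h; exact absurd rfl h
  | @h1 x hx =>
    intro _ _ _ J _ hJ
    have : J = ∅ := by
      rw [Finset.eq_empty_iff_forall_notMem]
      intro j hj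
      exact (hx.map (evz (z j) (m' j) (b' j))).ne_zero (hJ j hj).1
    simp [this]
  | @hpr π i hπ =>
    intro hne he hd J hz hJ
    rcases Nat.eq_zero_or_pos i with rfl | hi
    · have : J = ∅ := by
        rw [Finset.eq_empty_iff_forall_notMem]
        intro j hj
        have := (hJ j hj).1
        simp at this
      simp [this]
    obtain ⟨a, rfl⟩ : ∃ a, i = a + 1 := ⟨i - 1, by omega⟩
    have ha : π ^ a ≠ 0 := pow_ne_zero _ hπ.ne_zero
    have e1 : (π ^ (a + 1)).natDegree = (π ^ a).natDegree + π.natDegree := by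
      rw [pow_succ, natDegree_mul ha hπ.ne_zero]
    have e2 : dz (π ^ (a + 1)) = dz (π ^ a) + dz π := by
      rw [pow_succ, dz_mul ha hπ.ne_zero]
    have e3 : DD (π ^ (a + 1)) = DD (π ^ a) + DD π := by
      rw [pow_succ, DD_mul ha hπ.ne_zero]
    have := prime_case P w m b z m' b' p E k0 hp hE hw hcol π hπ (by omega) (by omega) J hz (by
      intro j hj
      obtain ⟨h1, h2⟩ := hJ j hj
      have h3 : cnt P w m b z m' b' (π ^ (a + 1)) j = cnt P w m b z m' b' π j := by
        simp only [cnt]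
        congr 1; ext i
        rw [map_pow, pow_eq_zero_iff (by omega)]
      rw [map_pow, pow_eq_zero_iff (by omega)] at h1
      rw [h3] at h2
      exact ⟨h1, by omega⟩)
    calc _ ≤ _ := this
      _ ≤ _ := by
        apply add_le_add _ (by omega)
        apply Nat.mul_le_mul <;> omega
  | @hcp x y hxy ihx ihy =>
    intro hne he hd J hz hJ
    have hx : x ≠ 0 := left_ne_zero_of_mul hne
    have hy : y ≠ 0 := right_ne_zero_of_mul hne
    rw [natDegree_mul hx hy] at he ⊢
    rw [dz_mul hx hy] at hd ⊢
    have key : ∀ (x y : k[X][X][X]) (j : ι'), evz (z j) (m' j) (b' j) y ≠ 0 →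
        (cnt P w m b z m' b' (x * y) j).card ≤ (cnt P w m b z m' b' x j).card + DD y := by
      intro x y j hyj
      refine le_trans ?_ (add_le_add_right (many P w m b z m' b' hw y j hyj) _)
      refine le_trans (Finset.card_le_card ?_) (Finset.card_union_le _ _)
      intro i hi
      simp only [cnt, Finset.mem_filter, Finset.mem_union, map_mul, mul_eq_zero] at hi ⊢
      tauto
    set Jy := J.filter (fun j => evz (z j) (m' j) (b' j) y = 0) with hJy
    set Jx := J.filter (fun j => ¬ evz (z j) (m' j) (b' j) y = 0) with hJx
    set Jb := Jy.filter (fun j => evz (z j) (m' j) (b' j) x = 0) with hJb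
    set Jc := Jy.filter (fun j => ¬ evz (z j) (m' j) (b' j) x = 0) with hJc
    have s1 : Jy.card + Jx.card = J.card := Finset.card_filter_add_card_filter_not _
    have s2 : Jb.card + Jc.card = Jy.card := Finset.card_filter_add_card_filter_not _
    have sub1 : Jx ⊆ J := Finset.filter_subset _ _
    have sub2 : Jb ⊆ J := (Finset.filter_subset _ _).trans (Finset.filter_subset _ _)
    have sub3 : Jc ⊆ J := (Finset.filter_subset _ _).trans (Finset.filter_subset _ _)
    have hDD := DD_mul hx hy
    have c1 : Jx.card ≤ 8 * x.natDegree * (dz x + 1) + dz x := by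
      apply ihx hx (by omega) (by omega) Jx (hz.mono sub1)
      intro j hj
      have hyj := (Finset.mem_filter.1 hj).2
      obtain ⟨h1, h2⟩ := hJ j (sub1 hj)
      rw [map_mul, mul_eq_zero] at h1
      have := key x y j hyj
      exact ⟨h1.resolve_right hyj, by omega⟩
    have c2 : Jc.card ≤ 8 * y.natDegree * (dz y + 1) + dz y := by
      apply ihy hy (by omega) (by omega) Jc (hz.mono sub3)
      intro j hj
      have hxj := (Finset.mem_filter.1 hj).2
      obtain ⟨h1, h2⟩ := hJ j (sub3 hj)
      rw [map_mul, mul_eq_zero] at h1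
      have := key y x j hxj
      rw [mul_comm y x] at this
      exact ⟨h1.resolve_left hxj, by omega⟩
    have c3 : Jb.card ≤ x.natDegree * dz y + y.natDegree * dz x := by
      apply common_lines x y hx hy hxy Jb (fun j => C (z j))
        (fun j => C (m' j) * X + C (b' j))
      · intro a ha c hc hac
        exact hz (sub2 ha) (sub2 hc) (C_injective hac)
      · intro j hj
        exact (Finset.mem_filter.1 hj).2
      · intro j hj
        exact (Finset.mem_filter.1 (Finset.mem_filter.1 hj).1).2
    nlinarith

end
end Inc

namespace Inc
open Polynomial

section
variable {k : Type*} [Field k]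
variable {ι ι' : Type*} (P : Finset ι) (w m b : ι → k) (z m' b' : ι' → k)

lemma exists_poly (e d : ℕ) (h : P.card * (2 * e + 1) < (e + 1) * (e + 1) * (d + 1)) :
    ∃ f : k[X][X][X], f ≠ 0 ∧ f.natDegree ≤ e ∧ dz f ≤ e ∧ dw f ≤ d ∧
      ∀ i ∈ P, psi (w i) (m i) (b i) f = 0 := by
  classical
  let T := Fin (e + 1) × Fin (e + 1) × Fin (d + 1)
  let M : Matrix (P × Fin (2 * e + 1)) T k := fun r t =>
    w r.1 ^ (t.2.2 : ℕ) *
      ((X ^ (t.2.1 : ℕ) * (C (m r.1) * X + C (b r.1)) ^ (t.1 : ℕ) : k[X]).coeff r.2)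
  have hker : LinearMap.ker M.mulVecLin ≠ ⊥ := by
    apply LinearMap.ker_ne_bot_of_finrank_lt
    simp [T]
    nlinarith
  obtain ⟨c, hc, hc0⟩ := (Submodule.ne_bot_iff _).1 hker
  rw [LinearMap.mem_ker, Matrix.mulVecLin_apply] at hc
  let F : k[X][X][X] := ∑ t : T,
    monomial (t.1 : ℕ) (monomial (t.2.1 : ℕ) (monomial (t.2.2 : ℕ) (c t)))
  have hcoeff : ∀ t : T, ((F.coeff t.1).coeff t.2.1).coeff t.2.2 = c t := by
    intro t
    simp only [F, finsetSum_coeff]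
    rw [Finset.sum_eq_single t]
    · simp
    · intro s _ hs
      simp only [coeff_monomial]
      by_cases h1 : (s.1 : ℕ) = t.1
      · rw [if_pos h1, coeff_monomial]
        by_cases h2 : (s.2.1 : ℕ) = t.2.1
        · rw [if_pos h2, coeff_monomial]
          by_cases h3 : (s.2.2 : ℕ) = t.2.2
          · exfalso; apply hs
            exact Prod.ext (Fin.ext h1) (Prod.ext (Fin.ext h2) (Fin.ext h3))
          · rw [if_neg h3]
        · rw [if_neg h2]; simp
      · rw [if_neg h1]; simp
    · simp
  have hFd : F.natDegree ≤ e := by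
    apply natDegree_sum_le_of_forall_le
    intro t _
    exact (natDegree_monomial_le _).trans (by omega)
  have hFz : dz F ≤ e := by
    rw [dz_le_iff]
    intro j
    simp only [F, finsetSum_coeff]
    apply natDegree_sum_le_of_forall_le
    intro t _
    rw [coeff_monomial]
    split_ifs
    · exact (natDegree_monomial_le _).trans (by omega)
    · simp
  refine ⟨F, ?_, hFd, hFz, ?_, ?_⟩
  · intro h0
    apply hc0
    funext t
    rw [← hcoeff t, h0]; simp
  · rw [dw_le_iff]
    intro j i
    simp only [F, finsetSum_coeff]
    apply natDegree_sum_le_of_forall_le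
    intro t _
    rw [coeff_monomial]
    split_ifs
    · rw [coeff_monomial]
      split_ifs
      · exact (natDegree_monomial_le _).trans (by omega)
      · simp
    · simp
  · intro i hi
    ext n
    rw [coeff_zero]
    by_cases hn : n < 2 * e + 1
    · have h1 := congrFun hc (⟨i, hi⟩, ⟨n, hn⟩)
      rw [Pi.zero_apply] at h1
      rw [← h1]
      simp only [F, map_sum, finsetSum_coeff, Matrix.mulVec, dotProduct, M]
      apply Finset.sum_congr rfl
      intro t _
      have : psi (w i) (m i) (b i)
          (monomial (t.1 : ℕ) (monomial (t.2.1 : ℕ) (monomial (t.2.2 : ℕ) (c t)))) =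
          C (c t * w i ^ (t.2.2 : ℕ)) *
            (X ^ (t.2.1 : ℕ) * (C (m i) * X + C (b i)) ^ (t.1 : ℕ)) := by
        rw [psi_apply, map_monomial, eval_monomial, coe_mapRingHom, map_monomial,
          coe_evalRingHom, eval_monomial, ← C_mul_X_pow_eq_monomial]
        ring
      rw [this, coeff_C_mul]
      ring
    · apply coeff_eq_zero_of_natDegree_lt
      have h1 : (psi (w i) (m i) (b i) F).natDegree ≤ e + e := by
        rw [psi_apply]
        refine (natDegree_eval_line _ _ (natDegree_linear' _ _)).trans (add_le_add ?_
          (natDegree_map_le.trans hFd))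
        rw [dz_le_iff]
        intro j
        rw [coeff_map, coe_mapRingHom]
        exact natDegree_map_le.trans ((dz_le_iff F e).1 hFz j)
      omega

open Classical in
theorem theoremB (p e d k0 : ℕ) (hp : ∀ n : ℕ, 0 < n → n < p → (n : k) ≠ 0) (hE : 2 * e < p)
    (hw : Set.InjOn w P)
    (hcol : ∀ α β γ δ : k, (P.filter fun i => m i = α + β * w i ∧ b i = γ + δ * w i).card ≤ k0)
    (hed : 2 * P.card ≤ (e + 1) * (d + 1))
    (J : Finset ι') (hz : Set.InjOn z J)
    (hJ : ∀ j ∈ J, 3 * (d + e) + k0 + 1 ≤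
      (P.filter fun i => m i * z j + b i = m' j * w i + b' j).card) :
    J.card ≤ 8 * e * (e + 1) + e := by
  obtain ⟨f, hf0, hfe, hfz, hfw, hf⟩ := exists_poly P w m b e d (by
    rcases Nat.eq_zero_or_pos P.card with h | h
    · rw [h, zero_mul]; positivity
    · nlinarith)
  have hD : DD f ≤ d + e := by unfold DD; omega
  have hcnt : ∀ j, cnt P w m b z m' b' f j =
      P.filter fun i => m i * z j + b i = m' j * w i + b' j := by
    intro j
    ext i
    simp only [cnt, Finset.mem_filter]
    constructor
    · rintro ⟨h1, h2, h3⟩; exact ⟨h1, h2⟩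
    · rintro ⟨h1, h2⟩; exact ⟨h1, h2, hf i h1⟩
  have := claim P w m b z m' b' p e k0 hp hE hw hcol f hf0 hfe hfz J hz (by
    intro j hj
    have h1 := hJ j hj
    refine ⟨?_, ?_⟩
    · by_contra hne
      have h2 := many P w m b z m' b' hw f j hne
      rw [hcnt] at h2
      omega
    · rw [hcnt]; omega)
  refine this.trans (add_le_add ?_ hfz)
  apply Nat.mul_le_mul <;> omega

end
end Inc

namespace Inc
open Polynomial

section
variable {F : Type*} [Field F]

/-- the function field -/
abbrev KK (F : Type*) [Field F] := FractionRing F[X]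

noncomputable def cc (a : F) : KK F := algebraMap F[X] (KK F) (C a)
noncomputable def tt (F : Type*) [Field F] : KK F := algebraMap F[X] (KK F) X

lemma cc_inj {a b : F} (h : cc a = cc b) : a = b :=
  C_injective (IsFractionRing.injective F[X] (KK F) h)

lemma tt_ne : tt F ≠ 0 := by
  unfold tt
  rw [Ne, map_eq_zero_iff _ (IsFractionRing.injective F[X] (KK F))]
  exact X_ne_zero

lemma den_ne (c : F) : 1 + tt F * cc c ≠ 0 := by
  have : 1 + tt F * cc c = algebraMap F[X] (KK F) (1 + X * C c) := by
    simp only [tt, cc, map_add, map_one, map_mul]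
  rw [this, Ne, map_eq_zero_iff _ (IsFractionRing.injective F[X] (KK F))]
  intro h
  have := congrArg (fun f => f.coeff 0) h
  simp at this

noncomputable def uu (q : F × F × F) : KK F :=
  cc q.2.2 + tt F ^ 3 * cc q.1 - tt F * cc q.1 * cc q.2.1
noncomputable def ww (q : F × F × F) : KK F := uu q / (1 + tt F * cc q.1)
noncomputable def mm (q : F × F × F) : KK F := cc q.1 / (1 + tt F * cc q.1)
noncomputable def bb (q : F × F × F) : KK F := - (cc q.1 * cc q.2.1) / (1 + tt F * cc q.1)

lemma coeffs {a0 a1 a2 a3 a4 b0 b1 b2 b3 b4 : F}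
    (h : C a0 + C a1 * X + C a2 * X ^ 2 + C a3 * X ^ 3 + C a4 * X ^ 4 =
      C b0 + C b1 * X + C b2 * X ^ 2 + C b3 * X ^ 3 + C b4 * X ^ 4) :
    a0 = b0 ∧ a1 = b1 ∧ a3 = b3 := by
  have e0 := congrArg (fun f => f.coeff 0) h
  have e1 := congrArg (fun f => f.coeff 1) h
  have e3 := congrArg (fun f => f.coeff 3) h
  simp [coeff_X, coeff_C] at e0 e1 e3
  exact ⟨e0, e1, e3⟩

lemma ww_inj (q q' : F × F × F) (hq : q.1 ≠ 0) (h : ww q = ww q') : q = q' := by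
  obtain ⟨c, b, x⟩ := q
  obtain ⟨c', b', x'⟩ := q'
  unfold ww at h
  rw [div_eq_div_iff (den_ne _) (den_ne _)] at h
  simp only [uu] at h
  simp only at hq
  have h2 : (C x + X ^ 3 * C c - X * C c * C b) * (1 + X * C c') =
      (C x' + X ^ 3 * C c' - X * C c' * C b') * (1 + X * C c) := by
    apply IsFractionRing.injective F[X] (KK F)
    simp only [tt, cc] at h
    simp only [map_mul, map_add, map_sub, map_pow, map_one]
    exact h
  have h3 : C x + C (x * c' - c * b) * X + C (- (c * b * c')) * X ^ 2 + C c * X ^ 3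
      + C (c * c') * X ^ 4 = C x' + C (x' * c - c' * b') * X + C (- (c' * b' * c)) * X ^ 2
      + C c' * X ^ 3 + C (c' * c) * X ^ 4 := by
    simp only [C_sub, C_mul, C_neg]
    linear_combination h2
  obtain ⟨e0, e1, e3⟩ := coeffs h3
  subst e0 e3
  have : c * b = c * b' := by linear_combination -e1
  rw [mul_left_cancel₀ hq this]

lemma rel_iff (q q' : F × F × F) :
    mm q * ww q' + bb q = mm q' * ww q + bb q' ↔
      q.1 * (q'.2.2 - q.2.1) = q'.1 * (q.2.2 - q'.2.1) := by
  obtain ⟨c, b, x⟩ := q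
  obtain ⟨c', b', x'⟩ := q'
  have d1 := den_ne c
  have d2 := den_ne c'
  have e : (mm (c, b, x) * ww (c', b', x') + bb (c, b, x) -
      (mm (c', b', x') * ww (c, b, x) + bb (c', b', x'))) *
      ((1 + tt F * cc c) * (1 + tt F * cc c')) =
      cc c * (cc x' - cc b) - cc c' * (cc x - cc b') := by
    unfold mm ww bb uu
    simp only
    have d1' : 1 + cc c * tt F ≠ 0 := by rw [mul_comm (cc c)]; exact d1
    have d2' : 1 + cc c' * tt F ≠ 0 := by rw [mul_comm (cc c')]; exact d2
    field_simp
    ring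
  have e2 : cc (c * (x' - b)) - cc (c' * (x - b')) =
      cc c * (cc x' - cc b) - cc c' * (cc x - cc b') := by
    simp [cc]
  simp only
  rw [← sub_eq_zero]
  constructor
  · intro h
    rw [h, zero_mul, ← e2] at e
    exact cc_inj (sub_eq_zero.1 e.symm)
  · intro h
    rw [← e2, h, sub_self] at e
    exact (mul_eq_zero.1 e).resolve_right (mul_ne_zero d1 d2)

variable [DecidableEq F]

/-- index set -/
def PP (S U : Finset F) : Finset (F × F × F) := (S.erase 0) ×ˢ S ×ˢ U

lemma mem_PP {S U : Finset F} {q : F × F × F} :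
    q ∈ PP S U ↔ (q.1 ≠ 0 ∧ q.1 ∈ S) ∧ q.2.1 ∈ S ∧ q.2.2 ∈ U := by
  simp [PP]

open Classical in
lemma coll (S U : Finset F) (hSU : S.card ≤ U.card) (α β γ δ : KK F) :
    ((PP S U).filter fun q => mm q = α + β * ww q ∧ bb q = γ + δ * ww q).card ≤ U.card := by
  set G := (PP S U).filter fun q => mm q = α + β * ww q ∧ bb q = γ + δ * ww q with hG
  have mem : ∀ q ∈ G, q ∈ PP S U ∧ cc q.1 = α * (1 + tt F * cc q.1) + β * uu q ∧
      - (cc q.1 * cc q.2.1) = γ * (1 + tt F * cc q.1) + δ * uu q := by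
    intro q hq
    obtain ⟨h1, h2, h3⟩ := Finset.mem_filter.1 hq
    have hd := den_ne q.1
    have hd' : 1 + cc q.1 * tt F ≠ 0 := by rw [mul_comm (cc q.1)]; exact hd
    refine ⟨h1, ?_, ?_⟩
    · unfold mm ww at h2
      field_simp at h2
      linear_combination h2
    · unfold bb ww at h3
      field_simp at h3
      linear_combination h3
  by_cases hβ : β = 0
  · have hcc : ∀ q ∈ G, ∀ q' ∈ G, q.1 = q'.1 := by
      intro q hq q' hq'
      have h1 := (mem q hq).2.1
      have h2 := (mem q' hq').2.1
      rw [hβ] at h1 h2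
      apply cc_inj
      linear_combination (1 + tt F * cc q'.1) * h1 - (1 + tt F * cc q.1) * h2
    by_cases hδ : δ * tt F = 1
    · refine le_trans (Finset.card_le_card_of_injOn (fun q => q.2.1) ?_ ?_) hSU
      · intro q hq
        exact (mem_PP.1 (mem q hq).1).2.1
      · intro q hq q' hq' h
        have h0 := hcc q hq q' hq'
        have h1 := (mem q hq).2.2
        have h2 := (mem q' hq').2.2
        simp only at h
        have hx : δ * (cc q.2.2 - cc q'.2.2) = 0 := by
          unfold uu at h1 h2
          rw [h0, h] at h1
          linear_combination h2 - h1
        have hδ0 : δ ≠ 0 := by rintro rfl; simp at hδ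
        have h3 : q.2.2 = q'.2.2 := cc_inj (sub_eq_zero.1 ((mul_eq_zero.1 hx).resolve_left hδ0))
        exact Prod.ext h0 (Prod.ext h h3)
    · refine Finset.card_le_card_of_injOn (fun q => q.2.2) ?_ ?_
      · intro q hq
        exact (mem_PP.1 (mem q hq).1).2.2
      · intro q hq q' hq' h
        have h0 := hcc q hq q' hq'
        have h1 := (mem q hq).2.2
        have h2 := (mem q' hq').2.2
        simp only at h
        have hx : (1 - δ * tt F) * (cc q'.1 * (cc q.2.1 - cc q'.2.1)) = 0 := by
          unfold uu at h1 h2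
          rw [h0, h] at h1
          linear_combination h2 - h1
        have hc0 : cc q'.1 ≠ 0 := by
          intro h
          apply (mem_PP.1 (mem q' hq').1).1.1
          apply cc_inj; rw [h]; simp [cc]
        have h3 : cc q.2.1 = cc q'.2.1 := by
          have h4 := (mul_eq_zero.1 hx).resolve_left (fun h => hδ (sub_eq_zero.1 h).symm)
          exact sub_eq_zero.1 ((mul_eq_zero.1 h4).resolve_left hc0)
        exact Prod.ext h0 (Prod.ext (cc_inj h3) h)
  · refine le_trans (Finset.card_le_card_of_injOn (fun q => q.1) ?_ ?_) hSU
    · intro q hq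
      exact (mem_PP.1 (mem q hq).1).1.2
    · intro q hq q' hq' h
      simp only at h
      have h1 := (mem q hq).2.1
      have h2 := (mem q' hq').2.1
      apply ww_inj q q' (mem_PP.1 (mem q hq).1).1.1
      unfold ww
      rw [h]
      congr 1
      apply mul_left_cancel₀ hβ
      rw [h] at h1
      linear_combination h2 - h1

/-- degree -/
def deg (S U : Finset F) (q' : F × F × F) : ℕ :=
  ((PP S U).filter fun q => q.1 * (q'.2.2 - q.2.1) = q'.1 * (q.2.2 - q'.2.1)).card

lemma rich (p : ℕ) (hp : ∀ n : ℕ, 0 < n → n < p → (n : F) ≠ 0) (S U : Finset F)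
    (hSU : S.card ≤ U.card) (D : ℕ) (hD : 288 * (PP S U).card ≤ D ^ 2) (hD0 : 0 < D)
    (hDU : 2 * (U.card + 1) ≤ D) (hnp : 8 * (PP S U).card < p ^ 2) :
    ((PP S U).filter fun q => D ≤ deg S U q).card * D ^ 2 ≤ 9792 * (PP S U).card ^ 2 := by
  classical
  set n := (PP S U).card with hn
  set J := (PP S U).filter fun q => D ≤ deg S U q with hJ
  set e := 24 * n / D with he
  set d := D / 12 with hd
  have he1 : e * D ≤ 24 * n := Nat.div_mul_le_self _ _
  have he2 : 24 * n < (e + 1) * D := by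
    have := Nat.lt_div_mul_add (a := 24 * n) hD0
    rw [add_mul, one_mul]; exact this
  have hd1 : d * 12 ≤ D := Nat.div_mul_le_self _ _
  have hd2 : D < (d + 1) * 12 := by omega
  have he12 : 12 * e ≤ D := by
    by_contra h
    push Not at h
    nlinarith
  have h2e : 2 * e < p := by
    by_contra h
    push Not at h
    have h1 : p ^ 2 ≤ (2 * e) ^ 2 := Nat.pow_le_pow_left h 2
    have h2 : (e * D) ^ 2 ≤ (24 * n) ^ 2 := Nat.pow_le_pow_left he1 2
    have h3 : e ^ 2 * (288 * n) ≤ e ^ 2 * D ^ 2 := Nat.mul_le_mul_left _ hD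
    have h4 : 0 < n := by
      rcases Nat.eq_zero_or_pos n with h | h
      · rw [h] at he1
        have : e = 0 := by
          rcases Nat.eq_zero_or_pos e with h' | h'
          · exact h'
          · nlinarith
        rw [this] at h1; nlinarith
      · exact h
    have h5 : n * (288 * e ^ 2) ≤ n * (576 * n) := by nlinarith
    have h6 := Nat.le_of_mul_le_mul_left h5 h4
    nlinarith
  have hpK : ∀ n : ℕ, 0 < n → n < p → (n : KK F) ≠ 0 := by
    intro n h1 h2 h3
    apply hp n h1 h2
    apply cc_inj
    simpa [cc] using h3
  have hinj : Set.InjOn (ww (F := F)) (PP S U) := by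
    intro q hq q' hq' h
    exact ww_inj q q' (mem_PP.1 hq).1.1 h
  have key := theoremB (PP S U) (ww (F := F)) mm bb ww mm bb p e d U.card hpK h2e hinj
    (fun α β γ δ => by convert coll S U hSU α β γ δ) (by nlinarith) J
    (hinj.mono (by intro x hx; exact (Finset.mem_filter.1 hx).1)) (by
      intro j hj
      have h1 := (Finset.mem_filter.1 hj).2
      have h2 : ((PP S U).filter fun i => mm i * ww j + bb i = mm j * ww i + bb j).card
          = deg S U j := by
        unfold deg
        congr 1
        ext i
        simp only [Finset.mem_filter, rel_iff]
      calc _ ≤ D := by omega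
        _ ≤ _ := h1
        _ = _ := by rw [← h2]; congr!)
  have h7 : J.card ≤ 17 * e ^ 2 := by
    rcases Nat.eq_zero_or_pos e with h | h
    · rw [h] at key ⊢; simpa using key
    · nlinarith
  have h2 : (e * D) ^ 2 ≤ (24 * n) ^ 2 := Nat.pow_le_pow_left he1 2
  calc J.card * D ^ 2 ≤ 17 * e ^ 2 * D ^ 2 := Nat.mul_le_mul_right _ h7
    _ ≤ _ := by nlinarith

end

lemma layer {ι : Type*} (P : Finset ι) (f : ι → ℕ) (D0 : ℕ) (hD0 : 0 < D0) (Q : ℝ)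
    (h : ∀ D, D0 ≤ D → ((P.filter fun q => D ≤ f q).card : ℝ) * (D : ℝ) ^ 2 ≤ Q) :
    ((∑ q ∈ P, f q : ℕ) : ℝ) ≤ P.card * D0 + Q / D0 := by
  classical
  have hQ : 0 ≤ Q := le_trans (by positivity) (h D0 le_rfl)
  set N := D0 + ∑ q ∈ P, f q with hN
  have h1 : ∀ q ∈ P, f q ≤ D0 + ∑ D ∈ Finset.Ioc D0 N, if D ≤ f q then 1 else 0 := by
    intro q hq
    have hle : f q ≤ ∑ q ∈ P, f q := Finset.single_le_sum (f := f) (fun _ _ => Nat.zero_le _) hq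
    rw [← Finset.card_filter]
    have : Finset.Ioc D0 (f q) ⊆ (Finset.Ioc D0 N).filter (fun D => D ≤ f q) := by
      intro D hD
      simp only [Finset.mem_Ioc, Finset.mem_filter] at hD ⊢
      omega
    have := Finset.card_le_card this
    rw [Nat.card_Ioc] at this
    omega
  have h2 : (∑ q ∈ P, f q) ≤ P.card * D0 + ∑ D ∈ Finset.Ioc D0 N, (P.filter fun q => D ≤ f q).card := by
    refine (Finset.sum_le_sum h1).trans ?_
    rw [Finset.sum_add_distrib, Finset.sum_const, smul_eq_mul, Finset.sum_comm]
    simp only [Finset.card_filter]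
    exact le_rfl
  have h3 : ((∑ q ∈ P, f q : ℕ) : ℝ) ≤
      P.card * D0 + ∑ D ∈ Finset.Ioc D0 N, ((P.filter fun q => D ≤ f q).card : ℝ) := by
    exact_mod_cast h2
  refine h3.trans (add_le_add_right ?_ _)
  calc ∑ D ∈ Finset.Ioc D0 N, ((P.filter fun q => D ≤ f q).card : ℝ)
      ≤ ∑ D ∈ Finset.Ioc D0 N, Q * ((D : ℝ) ^ 2)⁻¹ := by
        apply Finset.sum_le_sum
        intro D hD
        rw [Finset.mem_Ioc] at hD
        have hDp : (0 : ℝ) < D := by exact_mod_cast (by omega : 0 < D)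
        rw [← div_eq_mul_inv, le_div_iff₀ (by positivity)]
        exact h D hD.1.le
    _ = Q * ∑ D ∈ Finset.Ioc D0 N, ((D : ℝ) ^ 2)⁻¹ := by rw [Finset.mul_sum]
    _ ≤ Q * ((D0 : ℝ)⁻¹ - (N : ℝ)⁻¹) := by
        apply mul_le_mul_of_nonneg_left _ hQ
        exact sum_Ioc_inv_sq_le_sub (by omega) (by omega)
    _ ≤ Q / D0 := by
        rw [div_eq_mul_inv]
        apply mul_le_mul_of_nonneg_left _ hQ
        have : (0 : ℝ) ≤ (N : ℝ)⁻¹ := by positivity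
        linarith

/-- multiplicative energy with nonzero first entries -/
def Estar {F : Type*} [Field F] [DecidableEq F] (S : Finset F) : Finset ((F × F) × (F × F)) :=
  (((S.erase 0) ×ˢ S) ×ˢ ((S.erase 0) ×ˢ S)).filter fun t => t.1.1 * t.1.2 = t.2.1 * t.2.2

open scoped Pointwise in
lemma Estar_le {F : Type*} [Field F] [DecidableEq F] (S : Finset F) :
    (Estar S).card * S.card ^ 2 ≤ ∑ q ∈ PP S (S + S), deg S (S + S) q := by
  unfold deg
  rw [← Finset.card_sigma, sq, ← Finset.card_product, ← Finset.card_product]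
  apply Finset.card_le_card_of_injOn (fun t : ((F × F) × (F × F)) × (F × F) =>
    (⟨(t.1.2.1, t.2.2, t.1.1.2 + t.2.1), (t.1.1.1, t.2.1, t.1.2.2 + t.2.2)⟩ :
      Σ _ : F × F × F, F × F × F))
  · rintro ⟨⟨⟨t1, t2⟩, ⟨t1', t2'⟩⟩, ⟨b, b'⟩⟩ h
    simp only [Estar, Finset.coe_product, Set.mem_prod, Finset.mem_coe, Finset.mem_filter,
      Finset.mem_product, Finset.mem_erase] at h
    obtain ⟨⟨⟨⟨h1, h2⟩, ⟨h3, h4⟩⟩, h5⟩, h6, h7⟩ := h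
    simp only [Finset.mem_coe, Finset.mem_sigma, Finset.mem_filter, mem_PP]
    refine ⟨⟨h3, h7, Finset.add_mem_add h2 h6⟩, ⟨h1, h6, Finset.add_mem_add h4 h7⟩, ?_⟩
    linear_combination h5
  · rintro ⟨⟨⟨t1, t2⟩, ⟨t1', t2'⟩⟩, ⟨b, b'⟩⟩ _ ⟨⟨⟨s1, s2⟩, ⟨s1', s2'⟩⟩, ⟨a, a'⟩⟩ _ h
    simp only [Sigma.mk.injEq, Prod.mk.injEq, heq_eq_eq] at h
    obtain ⟨⟨rfl, rfl, h2⟩, rfl, rfl, h1⟩ := h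
    have := add_right_cancel h1
    have := add_right_cancel h2
    simp_all

open scoped Pointwise in
theorem Estar_bound {F : Type*} [Field F] [DecidableEq F] (p : ℕ)
    (hp : ∀ n : ℕ, 0 < n → n < p → (n : F) ≠ 0) (S : Finset F)
    (hnp : 8 * (S + S).card ^ 3 < p ^ 2) :
    ((Estar S).card : ℝ) * (S.card : ℝ) ^ 2 ≤
      563 * ((S + S).card : ℝ) ^ 4 * √((S + S).card : ℝ) := by
  rcases S.eq_empty_or_nonempty with rfl | hne
  · simp
  have hSU : S.card ≤ (S + S).card := Finset.card_le_card_add_right hne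
  have hM0 : 0 < (S + S).card := lt_of_lt_of_le hne.card_pos hSU
  set U := S + S with hU
  have hn : (PP S U).card ≤ U.card ^ 3 := by
    unfold PP
    rw [Finset.card_product, Finset.card_product]
    have := (Finset.card_erase_le (s := S) (a := 0)).trans hSU
    calc _ ≤ U.card * (U.card * U.card) :=
          Nat.mul_le_mul this (Nat.mul_le_mul_right _ hSU)
      _ = _ := by ring
  set M : ℝ := (U.card : ℝ) with hM
  have hM1 : (1 : ℝ) ≤ M := by rw [hM]; exact_mod_cast hM0
  have hs1 : 1 ≤ √M := Real.one_le_sqrt.2 hM1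
  have hss : √M * √M = M := Real.mul_self_sqrt (by linarith)
  set D0 := ⌈18 * M * √M⌉₊ with hD0
  have hD1 : 18 * M * √M ≤ D0 := Nat.le_ceil _
  have hD2 : (D0 : ℝ) ≤ 18 * M * √M + 1 := (Nat.ceil_lt_add_one (by positivity)).le
  have hMs : M ≤ M * √M := by nlinarith
  have hnR : ((PP S U).card : ℝ) ≤ M ^ 3 := by rw [hM]; exact_mod_cast hn
  have hDp : 0 < D0 := by
    rw [hD0, Nat.ceil_pos]; positivity
  have hDpR : (0 : ℝ) < D0 := by exact_mod_cast hDp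
  have h1 := layer (PP S U) (deg S U) D0 hDp (9792 * ((PP S U).card : ℝ) ^ 2) (by
    intro D hD
    have hDR : (D0 : ℝ) ≤ D := by exact_mod_cast hD
    have := rich p hp S U hSU D (by
        have : (288 : ℝ) * (PP S U).card ≤ (D : ℝ) ^ 2 := by
          have h3 : (18 * M * √M) ^ 2 ≤ (D : ℝ) ^ 2 :=
            pow_le_pow_left₀ (by positivity) (hD1.trans hDR) 2
          have h4 : (18 * M * √M) ^ 2 = 324 * M ^ 3 := by
            linear_combination 324 * M ^ 2 * hss
          nlinarith [pow_pos (lt_of_lt_of_le one_pos hM1) 3]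
        exact_mod_cast this) (by omega) (by
        have : (2 : ℝ) * (M + 1) ≤ D := by nlinarith
        rw [hM] at this
        exact_mod_cast this) (by omega)
    exact_mod_cast this)
  have h2 : ((Estar S).card : ℝ) * (S.card : ℝ) ^ 2 ≤ ((∑ q ∈ PP S U, deg S U q : ℕ) : ℝ) := by
    exact_mod_cast Estar_le S
  refine h2.trans (h1.trans ?_)
  have hn0 : (0 : ℝ) ≤ (PP S U).card := by positivity
  have a1 : ((PP S U).card : ℝ) * D0 ≤ M ^ 3 * (19 * M * √M) := by
    apply mul_le_mul hnR _ hDpR.le (by positivity)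
    nlinarith
  have a2 : 9792 * ((PP S U).card : ℝ) ^ 2 / D0 ≤ 544 * (M ^ 4 * √M) := by
    rw [div_le_iff₀ hDpR]
    have b1 : ((PP S U).card : ℝ) ^ 2 ≤ (M ^ 3) ^ 2 := pow_le_pow_left₀ hn0 hnR 2
    have b2 : 544 * (M ^ 4 * √M) * (18 * M * √M) ≤ 544 * (M ^ 4 * √M) * D0 :=
      mul_le_mul_of_nonneg_left hD1 (by positivity)
    have b3 : 544 * (M ^ 4 * √M) * (18 * M * √M) = 9792 * M ^ 6 := by
      linear_combination 9792 * M ^ 5 * hss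
    nlinarith
  calc _ ≤ M ^ 3 * (19 * M * √M) + 544 * (M ^ 4 * √M) := add_le_add a1 a2
    _ = _ := by ring

end Inc

namespace Inc
section
variable {F : Type*} [Field F] [DecidableEq F]

/-- matrix of a word, as (α, β, γ, δ) -/
def mat (l : F) (w : F × F × F × F) : F × F × F × F :=
  (l * w.2.1 + w.2.2.2 * (l + w.2.1 * w.2.2.1),
   l ^ 2 + w.2.2.2 * l * w.2.2.1 + w.1 * (l * w.2.1 + w.2.2.2 * (l + w.2.1 * w.2.2.1)),
   l + w.2.1 * w.2.2.1,
   l * w.2.2.1 + (l + w.2.1 * w.2.2.1) * w.1)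

lemma mat_det (l : F) (w : F × F × F × F) :
    (mat l w).1 * (mat l w).2.2.2 - (mat l w).2.1 * (mat l w).2.2.1 = - l ^ 3 := by
  simp only [mat]; ring

def act (M : F × F × F × F) (z : F) : F := (M.1 * z + M.2.1) / (M.2.2.1 * z + M.2.2.2)

def Phi (A : Finset F) (M : F × F × F × F) : Finset F :=
  A.filter fun z => M.2.2.1 * z + M.2.2.2 ≠ 0 ∧ act M z ∈ A

def BB (A : Finset F) (l : F) : Finset F := A.filter fun x => x ≠ 0 ∧ l / x ∈ A

def W4 (S : Finset F) : Finset (F × F × F × F) := S ×ˢ S ×ˢ S ×ˢ S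

open scoped Pointwise in
lemma paths (A : Finset F) (l : F) :
    A.card ^ 2 * (BB A l).card ^ 3 ≤ ∑ w ∈ W4 (A - A), (Phi A (mat l w)).card := by
  rw [← Finset.card_sigma]
  have : A.card ^ 2 * (BB A l).card ^ 3 = (A ×ˢ BB A l ×ˢ BB A l ×ˢ BB A l ×ˢ A).card := by
    simp only [Finset.card_product]; ring
  rw [this]
  apply Finset.card_le_card_of_injOn (fun t : F × F × F × F × F =>
    (⟨(t.2.1 - t.1, t.2.2.1 - l / t.2.1, t.2.2.2.1 - l / t.2.2.1, t.2.2.2.2 - l / t.2.2.2.1), t.1⟩ :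
      Σ _ : F × F × F × F, F))
  · rintro ⟨z, z0, z1, z2, y⟩ h
    simp only [Finset.mem_coe, Finset.mem_product, BB, Finset.mem_filter] at h
    obtain ⟨hz, ⟨h0, h0', h0''⟩, ⟨h1, h1', h1''⟩, ⟨h2, h2', h2''⟩, hy⟩ := h
    simp only [Finset.mem_coe, Finset.mem_sigma, W4, Finset.mem_product, Phi, Finset.mem_filter]
    have e1 : (mat l (z0 - z, z1 - l / z0, z2 - l / z1, y - l / z2)).2.2.1 * z +
        (mat l (z0 - z, z1 - l / z0, z2 - l / z1, y - l / z2)).2.2.2 = z0 * z1 * z2 := by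
      simp only [mat]; field_simp; ring
    have e2 : (mat l (z0 - z, z1 - l / z0, z2 - l / z1, y - l / z2)).1 * z +
        (mat l (z0 - z, z1 - l / z0, z2 - l / z1, y - l / z2)).2.1 = y * (z0 * z1 * z2) := by
      simp only [mat]; field_simp; ring
    have ne : z0 * z1 * z2 ≠ 0 := mul_ne_zero (mul_ne_zero h0' h1') h2'
    refine ⟨⟨Finset.sub_mem_sub h0 hz, Finset.sub_mem_sub h1 h0'', Finset.sub_mem_sub h2 h1'',
      Finset.sub_mem_sub hy h2''⟩, hz, ?_, ?_⟩
    · rw [e1]; exact ne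
    · unfold act
      rw [e1, e2, mul_div_cancel_right₀ _ ne]; exact hy
  · rintro ⟨z, z0, z1, z2, y⟩ _ ⟨z', z0', z1', z2', y'⟩ _ h
    simp only [Sigma.mk.injEq, Prod.mk.injEq, heq_eq_eq] at h
    obtain ⟨⟨h0, h1, h2, h3⟩, rfl⟩ := h
    obtain rfl := sub_left_injective h0
    obtain rfl := sub_left_injective h1
    obtain rfl := sub_left_injective h2
    obtain rfl := sub_left_injective h3
    rfl

lemma quad_zero {a b c x y z : F} (hxy : x ≠ y) (hxz : x ≠ z) (hyz : y ≠ z)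
    (h1 : a * x ^ 2 + b * x + c = 0) (h2 : a * y ^ 2 + b * y + c = 0)
    (h3 : a * z ^ 2 + b * z + c = 0) : a = 0 ∧ b = 0 ∧ c = 0 := by
  have e1 : a * (x + y) + b = 0 := by
    apply mul_left_cancel₀ (sub_ne_zero.2 hxy)
    linear_combination h1 - h2
  have e2 : a * (x + z) + b = 0 := by
    apply mul_left_cancel₀ (sub_ne_zero.2 hxz)
    linear_combination h1 - h3
  have ha : a = 0 := by
    apply mul_left_cancel₀ (sub_ne_zero.2 hyz)
    linear_combination e1 - e2
  subst ha
  have hb : b = 0 := by linear_combination e1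
  subst hb
  exact ⟨rfl, rfl, by linear_combination h1⟩

lemma pm_eq {M M' : F × F × F × F} {D : F} (hD : D ≠ 0)
    (hM : M.1 * M.2.2.2 - M.2.1 * M.2.2.1 = D) (hM' : M'.1 * M'.2.2.2 - M'.2.1 * M'.2.2.1 = D)
    {x y z : F} (hxy : x ≠ y) (hxz : x ≠ z) (hyz : y ≠ z)
    (hx : M.2.2.1 * x + M.2.2.2 ≠ 0) (hy : M.2.2.1 * y + M.2.2.2 ≠ 0)
    (hz : M.2.2.1 * z + M.2.2.2 ≠ 0)
    (hx' : M'.2.2.1 * x + M'.2.2.2 ≠ 0) (hy' : M'.2.2.1 * y + M'.2.2.2 ≠ 0)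
    (hz' : M'.2.2.1 * z + M'.2.2.2 ≠ 0)
    (h1 : act M x = act M' x) (h2 : act M y = act M' y) (h3 : act M z = act M' z) :
    M' = M ∨ M' = - M := by
  obtain ⟨a, b, c, d⟩ := M
  obtain ⟨a', b', c', d'⟩ := M'
  simp only [act] at *
  rw [div_eq_div_iff (by assumption) (by assumption)] at h1 h2 h3
  obtain ⟨q1, q2, q3⟩ := quad_zero (a := a * c' - a' * c) (b := a * d' + b * c' - a' * d - b' * c)
    (c := b * d' - b' * d) hxy hxz hyz (by linear_combination h1) (by linear_combination h2)
    (by linear_combination h3)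
  set k := d * a' - b * c' with hk
  have k2 : k = a * d' - c * b' := by rw [hk]; linear_combination -q2
  have ea : D * a' = k * a := by rw [← hM, hk]; linear_combination b * q1
  have eb : D * b' = k * b := by rw [← hM, k2]; linear_combination (-a) * q3
  have ec : D * c' = k * c := by rw [← hM, hk]; linear_combination d * q1
  have ed : D * d' = k * d := by rw [← hM, k2]; linear_combination (-c) * q3
  have kk : k = D ∨ k = - D := by
    apply sq_eq_sq_iff_eq_or_eq_neg.1
    apply mul_left_cancel₀ hD
    have : D ^ 2 * (a' * d' - b' * c') = k ^ 2 * (a * d - b * c) := by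
      linear_combination D * d' * ea + k * a * ed - D * c' * eb - k * b * ec
    rw [hM, hM'] at this
    linear_combination -this
  rcases kk with h | h
  · left
    rw [h] at ea eb ec ed
    rw [mul_left_cancel₀ hD ea, mul_left_cancel₀ hD eb, mul_left_cancel₀ hD ec,
      mul_left_cancel₀ hD ed]
  · right
    rw [h] at ea eb ec ed
    have ha : a' = -a := mul_left_cancel₀ hD (by linear_combination ea)
    have hb : b' = -b := mul_left_cancel₀ hD (by linear_combination eb)
    have hc : c' = -c := mul_left_cancel₀ hD (by linear_combination ec)
    have hd : d' = -d := mul_left_cancel₀ hD (by linear_combination ed)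
    rw [ha, hb, hc, hd]; rfl

/-- ordered distinct triples -/
def Tri (X : Finset F) : Finset (F × F × F) :=
  (X ×ˢ X ×ˢ X).filter fun t => t.1 ≠ t.2.1 ∧ t.1 ≠ t.2.2 ∧ t.2.1 ≠ t.2.2

lemma Tri_card (X : Finset F) (hX : 3 ≤ X.card) : 2 * X.card ^ 3 ≤ 9 * (Tri X).card := by
  have h1 : ∑ t ∈ X.offDiag, (X \ {t.1, t.2}).card ≤ (Tri X).card := by
    rw [← Finset.card_sigma]
    apply Finset.card_le_card_of_injOn (fun t => (t.1.1, t.1.2, t.2))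
    · rintro ⟨⟨a, b⟩, c⟩ h
      simp only [Finset.mem_coe, Finset.mem_sigma, Finset.mem_offDiag, Finset.mem_sdiff,
        Finset.mem_insert, Finset.mem_singleton, not_or] at h
      simp only [Finset.mem_coe, Tri, Finset.mem_filter, Finset.mem_product]
      obtain ⟨⟨h1, h2, h3⟩, h4, h5, h6⟩ := h
      exact ⟨⟨h1, h2, h4⟩, h3, Ne.symm h5, Ne.symm h6⟩
    · rintro ⟨⟨a, b⟩, c⟩ _ ⟨⟨a', b'⟩, c'⟩ _ h
      simp only [Prod.mk.injEq] at h
      obtain ⟨rfl, rfl, rfl⟩ := h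
      rfl
  have h2 : X.offDiag.card * (X.card - 2) ≤ ∑ t ∈ X.offDiag, (X \ {t.1, t.2}).card := by
    rw [← smul_eq_mul]
    apply Finset.card_nsmul_le_sum
    intro t _
    have := Finset.le_card_sdiff {t.1, t.2} X
    have := Finset.card_le_two (a := t.1) (b := t.2)
    omega
  rw [Finset.offDiag_card] at h2
  obtain ⟨n, hn⟩ : ∃ n, X.card = n + 3 := ⟨X.card - 3, by omega⟩
  rw [hn] at h2 ⊢
  have e1 : (n + 3) * (n + 3) - (n + 3) = (n + 3) * (n + 2) := by
    rw [← Nat.mul_sub_one]; rfl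
  have e2 : n + 3 - 2 = n + 1 := by omega
  rw [e1, e2] at h2
  nlinarith [h2.trans h1]

lemma triples (A : Finset F) (D : F) (hD : D ≠ 0) (MM : Finset (F × F × F × F))
    (hMM : ∀ M ∈ MM, M.1 * M.2.2.2 - M.2.1 * M.2.2.1 = D) :
    ∑ M ∈ MM, (Tri (Phi A M)).card ≤ 2 * A.card ^ 6 := by
  rw [← Finset.card_sigma]
  have : A.card ^ 6 = ((A ×ˢ A ×ˢ A) ×ˢ (A ×ˢ A ×ˢ A)).card := by
    simp only [Finset.card_product]; ring
  rw [this]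
  apply Finset.card_le_mul_card_image_of_maps_to
    (f := fun t : (Σ _ : F × F × F × F, F × F × F) =>
      (t.2, (act t.1 t.2.1, act t.1 t.2.2.1, act t.1 t.2.2.2)))
  · rintro ⟨M, x, y, z⟩ h
    simp only [Finset.mem_sigma, Tri, Finset.mem_filter, Finset.mem_product, Phi] at h
    simp only [Finset.mem_product]
    tauto
  · rintro ⟨⟨x, y, z⟩, u⟩ _
    rcases Finset.eq_empty_or_nonempty ((MM.sigma fun M => Tri (Phi A M)).filter
      fun t => (t.2, (act t.1 t.2.1, act t.1 t.2.2.1, act t.1 t.2.2.2)) = ((x, y, z), u)) with h | h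
    · rw [h]; simp
    · obtain ⟨⟨M, x', y', z'⟩, h⟩ := h
      refine (Finset.card_le_card (t := {⟨M, (x, y, z)⟩, ⟨-M, (x, y, z)⟩}) ?_).trans
        Finset.card_le_two
      rintro ⟨M', x'', y'', z''⟩ h'
      simp only [Finset.mem_filter, Finset.mem_sigma, Prod.mk.injEq] at h h'
      obtain ⟨⟨hM, hT⟩, ⟨rfl, rfl, rfl⟩, hu⟩ := h
      obtain ⟨⟨hM', hT'⟩, ⟨rfl, rfl, rfl⟩, hu'⟩ := h'
      rw [← hu'] at hu
      simp only [Prod.mk.injEq] at hu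
      simp only [Tri, Finset.mem_filter, Finset.mem_product, Phi] at hT hT'
      have := pm_eq hD (hMM M hM) (hMM M' hM') hT.2.1 hT.2.2.1 hT.2.2.2 hT.1.1.2.1 hT.1.2.1.2.1
        hT.1.2.2.2.1 hT'.1.1.2.1 hT'.1.2.1.2.1 hT'.1.2.2.2.1 hu.1 hu.2.1 hu.2.2
      rcases this with rfl | rfl <;> simp

/-- full energy set -/
def EE (S : Finset F) : Finset ((F × F) × (F × F)) :=
  ((S ×ˢ S) ×ˢ (S ×ˢ S)).filter fun t => t.1.1 * t.1.2 = t.2.1 * t.2.2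

lemma EE_le (S : Finset F) : (EE S).card ≤ (Estar S).card + 3 * S.card ^ 2 := by
  have hsub : EE S ⊆ Estar S ∪ ((S ×ˢ S).image (fun t => ((0, t.1), (0, t.2))) ∪
      ((S ×ˢ S).image (fun t => ((0, t.1), (t.2, 0))) ∪
        (S ×ˢ S).image (fun t => ((t.1, 0), (0, t.2))))) := by
    rintro ⟨⟨a, b⟩, ⟨c, d⟩⟩ h
    simp only [EE, Finset.mem_filter, Finset.mem_product] at h
    simp only [Estar, Finset.mem_union, Finset.mem_filter, Finset.mem_product, Finset.mem_erase,
      Finset.mem_image, Prod.exists, Prod.mk.injEq]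
    obtain ⟨⟨⟨ha, hb⟩, hc, hd⟩, he⟩ := h
    by_cases h0 : a = 0
    · subst h0
      rw [zero_mul] at he
      rcases mul_eq_zero.1 he.symm with rfl | rfl
      · exact Or.inr (Or.inl ⟨b, d, ⟨hb, hd⟩, ⟨rfl, rfl⟩, rfl, rfl⟩)
      · exact Or.inr (Or.inr (Or.inl ⟨b, c, ⟨hb, hc⟩, ⟨rfl, rfl⟩, rfl, rfl⟩))
    · by_cases h1 : c = 0
      · subst h1
        rw [zero_mul] at he
        obtain rfl := (mul_eq_zero.1 he).resolve_left h0
        exact Or.inr (Or.inr (Or.inr ⟨a, d, ⟨ha, hd⟩, ⟨rfl, rfl⟩, rfl, rfl⟩))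
      · exact Or.inl ⟨⟨⟨⟨h0, ha⟩, hb⟩, ⟨h1, hc⟩, hd⟩, he⟩
  refine (Finset.card_le_card hsub).trans ?_
  refine (Finset.card_union_le _ _).trans ?_
  have hs : (S ×ˢ S).card = S.card ^ 2 := by rw [Finset.card_product]; ring
  have i1 := Finset.card_image_le (s := S ×ˢ S) (f := fun t : F × F => (((0 : F), t.1), ((0 : F), t.2)))
  have i2 := Finset.card_image_le (s := S ×ˢ S) (f := fun t : F × F => (((0 : F), t.1), (t.2, (0 : F))))
  have i3 := Finset.card_image_le (s := S ×ˢ S) (f := fun t : F × F => ((t.1, (0 : F)), ((0 : F), t.2)))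
  rw [hs] at i1 i2 i3
  have u1 := Finset.card_union_le ((S ×ˢ S).image (fun t : F × F => (((0 : F), t.1), ((0 : F), t.2))))
    ((S ×ˢ S).image (fun t => ((0, t.1), (t.2, 0))) ∪
        (S ×ˢ S).image (fun t => ((t.1, 0), (0, t.2))))
  have u2 := Finset.card_union_le ((S ×ˢ S).image (fun t : F × F => (((0 : F), t.1), (t.2, (0 : F)))))
        ((S ×ˢ S).image (fun t => ((t.1, 0), (0, t.2))))
  omega

lemma rho_sq (S : Finset F) (l : F) (hl : l ≠ 0) :
    ((W4 S ×ˢ W4 S).filter fun t => mat l t.1 = mat l t.2).card ≤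
      S.card ^ 2 * (EE S).card + S.card ^ 4 := by
  set P := (W4 S ×ˢ W4 S).filter fun t => mat l t.1 = mat l t.2 with hP
  rw [← Finset.card_filter_add_card_filter_not (s := P) (fun t => l + t.1.2.1 * t.1.2.2.1 ≠ 0)]
  apply add_le_add
  · have : S.card ^ 2 * (EE S).card = (EE S ×ˢ (S ×ˢ S)).card := by
      simp only [Finset.card_product]; ring
    rw [this]
    apply Finset.card_le_card_of_injOn
      (fun t => (((t.1.2.1, t.1.2.2.1), (t.2.2.1, t.2.2.2.1)), (t.1.1, t.1.2.2.2)))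
    · rintro ⟨⟨t0, t1, t2, t3⟩, ⟨s0, s1, s2, s3⟩⟩ h
      simp only [hP, Finset.mem_coe, Finset.mem_filter, W4, Finset.mem_product, mat,
        Prod.mk.injEq] at h
      simp only [EE, Finset.mem_coe, Finset.mem_filter, Finset.mem_product]
      have : t1 * t2 = s1 * s2 := add_left_cancel h.1.2.2.2.1
      tauto
    · rintro ⟨⟨t0, t1, t2, t3⟩, ⟨s0, s1, s2, s3⟩⟩ h ⟨⟨t0', t1', t2', t3'⟩, ⟨s0', s1', s2', s3'⟩⟩ h' he
      simp only [hP, Finset.mem_coe, Finset.mem_filter, mat, Prod.mk.injEq] at h h' he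
      obtain ⟨⟨⟨rfl, rfl⟩, rfl, rfl⟩, rfl, rfl⟩ := he
      obtain ⟨⟨_, ha, hb, hc, hd⟩, hn⟩ := h
      obtain ⟨⟨_, ha', hb', hc', hd'⟩, _⟩ := h'
      rw [hc] at hn
      have e3 : s3 = s3' := mul_right_cancel₀ hn (by linear_combination ha' - ha)
      have e0 : s0 = s0' := mul_right_cancel₀ hn (by linear_combination hd' - hd)
      rw [e3, e0]
  · have : S.card ^ 4 = (S ×ˢ S ×ˢ S ×ˢ S).card := by
      simp only [Finset.card_product]; ring
    rw [this]
    apply Finset.card_le_card_of_injOn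
      (fun t => (t.1.2.1, t.1.2.2.2, t.1.1, t.2.2.2.2))
    · rintro ⟨⟨t0, t1, t2, t3⟩, ⟨s0, s1, s2, s3⟩⟩ h
      simp only [hP, Finset.mem_coe, Finset.mem_filter, W4, Finset.mem_product] at h
      simp only [Finset.mem_coe, Finset.mem_product]
      tauto
    · have key : ∀ t ∈ P, ¬ (l + t.1.2.1 * t.1.2.2.1 ≠ 0) → t.1.2.1 ≠ 0 ∧
          t.1.2.1 * t.1.2.2.1 = - l ∧ t.2.2.1 = t.1.2.1 ∧ t.2.2.2.1 = t.1.2.2.1 ∧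
          t.1.2.2.2 * t.1.2.2.1 + t.1.1 * t.1.2.1 = t.2.2.2.2 * t.1.2.2.1 + t.2.1 * t.1.2.1 := by
        rintro ⟨⟨t0, t1, t2, t3⟩, ⟨s0, s1, s2, s3⟩⟩ h hn
        simp only [hP, Finset.mem_filter, mat, Prod.mk.injEq, not_not] at h hn ⊢
        obtain ⟨_, ha, hb, hc, hd⟩ := h
        rw [hn] at hc
        have e1 : s1 = t1 := mul_left_cancel₀ hl (by
          linear_combination -ha + t3 * hn + s3 * hc)
        have e2 : s2 = t2 := mul_left_cancel₀ hl (by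
          linear_combination -hd + t0 * hn + s0 * hc)
        subst e1 e2
        refine ⟨?_, by linear_combination hn, rfl, rfl, ?_⟩
        · rintro rfl
          apply hl; linear_combination hn
        · apply mul_left_cancel₀ hl
          linear_combination hb + (s0 * s3 - t0 * t3) * hn
      intro t h t' h' he
      obtain ⟨h1, h2⟩ := Finset.mem_filter.1 (Finset.mem_coe.1 h)
      obtain ⟨h1', h2'⟩ := Finset.mem_filter.1 (Finset.mem_coe.1 h')
      have k := key t h1 h2
      have k' := key t' h1' h2'
      obtain ⟨⟨t0, t1, t2, t3⟩, ⟨s0, s1, s2, s3⟩⟩ := t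
      obtain ⟨⟨t0', t1', t2', t3'⟩, ⟨s0', s1', s2', s3'⟩⟩ := t'
      simp only [Prod.mk.injEq] at k k' he
      obtain ⟨rfl, rfl, rfl, rfl⟩ := he
      obtain ⟨n0, k1, k2, k3, k4⟩ := k
      obtain ⟨_, k1', k2', k3', k4'⟩ := k'
      have e : t2 = t2' := mul_left_cancel₀ n0 (k1.trans k1'.symm)
      subst e
      have e0 : s0 = s0' := mul_right_cancel₀ n0 (by linear_combination k4' - k4)
      rw [k2, k2', k3, k3', e0]

end

lemma pop {ι : Type*} (MM : Finset ι) (ρ φ tri : ι → ℝ) (Q s4' R a6 : ℝ)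
    (hρ0 : ∀ M, 0 ≤ ρ M) (hφ0 : ∀ M, 0 ≤ φ M) (htri0 : ∀ M, 0 ≤ tri M)
    (htri : ∀ M, 3 ≤ φ M → 2 * φ M ^ 3 ≤ 9 * tri M) (hs0 : 0 ≤ s4') (hsmall : 6 * s4' < Q)
    (s1 : Q ≤ ∑ M ∈ MM, ρ M * φ M) (s2 : ∑ M ∈ MM, ρ M = s4') (s3 : ∑ M ∈ MM, ρ M ^ 2 ≤ R)
    (s4 : ∑ M ∈ MM, tri M ≤ 2 * a6) : Q ^ 3 ≤ 72 * s4' * R * a6 := by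
  classical
  have hQ0 : 0 < Q := by nlinarith
  have hT0 : 0 < s4' := by
    rcases hs0.eq_or_lt with h | h
    · exfalso
      rw [← h] at s2
      have hz := (Finset.sum_eq_zero_iff_of_nonneg (fun M _ => hρ0 M)).1 s2
      have : ∑ M ∈ MM, ρ M * φ M = 0 := Finset.sum_eq_zero (fun M hM => by rw [hz M hM, zero_mul])
      linarith
    · exact h
  set τ := Q / (2 * s4') with hτ
  have hτ3 : 3 ≤ τ := by rw [hτ, le_div_iff₀ (by positivity)]; linarith
  have hτe : τ * s4' = Q / 2 := by rw [hτ]; field_simp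
  set G := MM.filter fun M => τ ≤ φ M with hG
  have s5 : Q / 2 ≤ ∑ M ∈ G, ρ M * φ M := by
    have h1 := Finset.sum_filter_add_sum_filter_not MM (fun M => τ ≤ φ M) (fun M => ρ M * φ M)
    have h2 : ∑ M ∈ MM.filter (fun M => ¬ τ ≤ φ M), ρ M * φ M ≤ τ * s4' := by
      calc _ ≤ ∑ M ∈ MM.filter (fun M => ¬ τ ≤ φ M), ρ M * τ := by
            apply Finset.sum_le_sum
            intro M hM
            have := (Finset.mem_filter.1 hM).2
            push Not at this
            exact mul_le_mul_of_nonneg_left this.le (hρ0 M)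
        _ ≤ ∑ M ∈ MM, ρ M * τ := Finset.sum_le_sum_of_subset_of_nonneg (Finset.filter_subset _ _)
            (fun M _ _ => mul_nonneg (hρ0 M) (by linarith))
        _ = τ * s4' := by rw [← Finset.sum_mul, s2]; ring
    linarith
  have s6 : τ * ∑ M ∈ G, φ M ^ 2 ≤ 9 * a6 := by
    rw [Finset.mul_sum]
    calc _ ≤ ∑ M ∈ G, 9 / 2 * tri M := by
          apply Finset.sum_le_sum
          intro M hM
          have hM2 := (Finset.mem_filter.1 hM).2
          have h4 := htri M (hτ3.trans hM2)
          have h5 : τ * φ M ^ 2 ≤ φ M * φ M ^ 2 := mul_le_mul_of_nonneg_right hM2 (sq_nonneg _)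
          nlinarith
      _ ≤ ∑ M ∈ MM, 9 / 2 * tri M :=
          Finset.sum_le_sum_of_subset_of_nonneg (Finset.filter_subset _ _)
            (fun M _ _ => by have := htri0 M; positivity)
      _ ≤ _ := by rw [← Finset.mul_sum]; linarith
  have s7 : (Q / 2) ^ 2 ≤ (∑ M ∈ MM, ρ M ^ 2) * ∑ M ∈ G, φ M ^ 2 := by
    calc _ ≤ (∑ M ∈ G, ρ M * φ M) ^ 2 := pow_le_pow_left₀ (by positivity) s5 2
      _ ≤ (∑ M ∈ G, ρ M ^ 2) * ∑ M ∈ G, φ M ^ 2 := Finset.sum_mul_sq_le_sq_mul_sq _ _ _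
      _ ≤ _ := mul_le_mul_of_nonneg_right (Finset.sum_le_sum_of_subset_of_nonneg
            (Finset.filter_subset _ _) (fun M _ _ => sq_nonneg _))
            (Finset.sum_nonneg fun M _ => sq_nonneg _)
  have hR0 : 0 ≤ ∑ M ∈ MM, ρ M ^ 2 := Finset.sum_nonneg fun M _ => sq_nonneg _
  have hR1 : 0 ≤ R := hR0.trans s3
  calc Q ^ 3 = 8 * s4' * (τ * (Q / 2) ^ 2) := by
        linear_combination (-2) * Q ^ 2 * hτe
    _ ≤ 8 * s4' * (τ * ((∑ M ∈ MM, ρ M ^ 2) * ∑ M ∈ G, φ M ^ 2)) := by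
        have : 0 ≤ τ := by linarith
        gcongr
    _ = 8 * s4' * ((∑ M ∈ MM, ρ M ^ 2) * (τ * ∑ M ∈ G, φ M ^ 2)) := by ring
    _ ≤ 8 * s4' * (R * (9 * a6)) := by
        have : 0 ≤ τ * ∑ M ∈ G, φ M ^ 2 :=
          mul_nonneg (by linarith) (Finset.sum_nonneg fun M _ => sq_nonneg _)
        gcongr
    _ = _ := by ring

section
variable {F : Type*} [Field F] [DecidableEq F]

open scoped Pointwise in
theorem partA (A : Finset F) (l : F) (hl : l ≠ 0) :
    (A.card : ℝ) ^ 2 * ((BB A l).card : ℝ) ^ 3 ≤ 6 * ((A - A).card : ℝ) ^ 4 ∨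
    ((A.card : ℝ) ^ 2 * ((BB A l).card : ℝ) ^ 3) ^ 3 ≤
      72 * ((A - A).card : ℝ) ^ 4 * (((A - A).card : ℝ) ^ 2 * (EE (A - A)).card +
        ((A - A).card : ℝ) ^ 4) * (A.card : ℝ) ^ 6 := by
  set S := A - A with hS
  set Q : ℝ := (A.card : ℝ) ^ 2 * ((BB A l).card : ℝ) ^ 3 with hQ
  by_cases hsmall : Q ≤ 6 * (S.card : ℝ) ^ 4
  · exact Or.inl hsmall
  right
  push Not at hsmall
  set MM := (W4 S).image (mat l) with hMM
  set ρ : F × F × F × F → ℝ := fun M => (((W4 S).filter fun w => mat l w = M).card : ℝ) with hρ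
  set φ : F × F × F × F → ℝ := fun M => ((Phi A M).card : ℝ) with hφ
  have hmaps : ∀ w ∈ W4 S, mat l w ∈ MM := fun w hw => Finset.mem_image_of_mem _ hw
  have hcard4 : (W4 S).card = S.card ^ 4 := by
    unfold W4; simp only [Finset.card_product]; ring
  have s1 : Q ≤ ∑ M ∈ MM, ρ M * φ M := by
    have h := paths A l
    have h2 : ∑ M ∈ MM, ρ M * φ M = ((∑ w ∈ W4 S, (Phi A (mat l w)).card : ℕ) : ℝ) := by
      rw [← Finset.sum_fiberwise_of_maps_to hmaps]
      push_cast
      apply Finset.sum_congr rfl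
      intro M _
      rw [Finset.sum_congr rfl (g := fun _ => φ M)]
      · rw [Finset.sum_const, nsmul_eq_mul]
      · intro w hw
        rw [(Finset.mem_filter.1 hw).2]
    rw [h2, hQ]
    exact_mod_cast h
  have s2 : ∑ M ∈ MM, ρ M = (S.card : ℝ) ^ 4 := by
    have := Finset.card_eq_sum_card_fiberwise hmaps
    rw [hcard4] at this
    simp only [hρ]
    exact_mod_cast this.symm
  have s3 : ∑ M ∈ MM, ρ M ^ 2 ≤ (S.card : ℝ) ^ 2 * (EE S).card + (S.card : ℝ) ^ 4 := by
    have h := rho_sq S l hl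
    have h2 : ∑ M ∈ MM, ((W4 S).filter fun w => mat l w = M).card ^ 2 =
        ((W4 S ×ˢ W4 S).filter fun t => mat l t.1 = mat l t.2).card := by
      rw [Finset.card_eq_sum_card_fiberwise (f := fun t => mat l t.1) (t := MM)]
      · apply Finset.sum_congr rfl
        intro M _
        rw [sq, ← Finset.card_product]
        congr 1
        ext ⟨w, w'⟩
        simp only [Finset.mem_product, Finset.mem_filter]
        constructor
        · rintro ⟨⟨a, rfl⟩, b, c⟩; exact ⟨⟨⟨a, b⟩, c.symm⟩, rfl⟩
        · rintro ⟨⟨⟨a, b⟩, c⟩, rfl⟩; exact ⟨⟨a, rfl⟩, b, c.symm⟩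
      · intro t ht
        exact hmaps _ (Finset.mem_product.1 (Finset.mem_filter.1 ht).1).1
    rw [← h2] at h
    simp only [hρ]
    exact_mod_cast h
  have s4 : ∑ M ∈ MM, ((Tri (Phi A M)).card : ℝ) ≤ 2 * (A.card : ℝ) ^ 6 := by
    have := triples A (- l ^ 3) (neg_ne_zero.2 (pow_ne_zero 3 hl)) MM (by
      intro M hM
      obtain ⟨w, _, rfl⟩ := Finset.mem_image.1 hM
      exact mat_det l w)
    exact_mod_cast this
  refine pop MM ρ φ (fun M => ((Tri (Phi A M)).card : ℝ)) Q _ _ _ (fun M => Nat.cast_nonneg _)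
    (fun M => Nat.cast_nonneg _) (fun M => Nat.cast_nonneg _) ?_ (by positivity) hsmall s1 s2 s3 s4
  intro M hM
  simp only [hφ] at hM ⊢
  have h3 : 3 ≤ (Phi A M).card := by exact_mod_cast hM
  exact_mod_cast Tri_card _ h3

end
end Inc

namespace Inc

open scoped Pointwise in
lemma sums_bound {G : Type*} [AddCommGroup G] [DecidableEq G] (A : Finset G) (hA : A.Nonempty) (K : ℝ)
    (h : ((A + A).card : ℝ) ≤ K * A.card) :
    ((A - A).card : ℝ) ≤ K ^ 2 * A.card ∧
    (((A - A) + (A - A)).card : ℝ) ≤ K ^ 4 * A.card := by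
  have hN : (0 : ℝ) < A.card := by exact_mod_cast hA.card_pos
  have hq : ((A + A).card : ℝ) / A.card ≤ K := by rwa [div_le_iff₀ hN]
  have hq0 : 0 ≤ ((A + A).card : ℝ) / A.card := by positivity
  have h1 := Finset.pluennecke_ruzsa_inequality_nsmul_sub_nsmul_add hA A 1 1
  have h2 := Finset.pluennecke_ruzsa_inequality_nsmul_sub_nsmul_add hA A 2 2
  have e : (A - A) + (A - A) = 2 • A - 2 • A := by
    rw [two_nsmul]; exact sub_add_sub_comm A A A A
  rw [one_nsmul] at h1
  rw [e]
  have h1' : ((A - A).card : ℝ) ≤ (((A + A).card : ℝ) / A.card) ^ 2 * A.card := by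
    have := (NNRat.cast_le (K := ℝ)).2 h1
    push_cast at this
    exact this
  have h2' : ((2 • A - 2 • A).card : ℝ) ≤ (((A + A).card : ℝ) / A.card) ^ 4 * A.card := by
    have := (NNRat.cast_le (K := ℝ)).2 h2
    push_cast at this
    exact this
  exact ⟨h1'.trans (by gcongr), h2'.trans (by gcongr)⟩

open scoped Pointwise in
lemma main_bound {F : Type*} [Field F] [DecidableEq F] (p : ℕ)
    (hp : ∀ n : ℕ, 0 < n → n < p → (n : F) ≠ 0) (A : Finset F) (hA : A.Nonempty) (K : ℝ) (hK : 1 ≤ K)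
    (h : ((A + A).card : ℝ) ≤ K * A.card)
    (hnp : 8 * ((A - A) + (A - A)).card ^ 3 < p ^ 2) (l : F) (hl : l ≠ 0) :
    ((BB A l).card : ℝ) ^ 9 ≤ 40824 * K ^ 26 * ((A.card : ℝ) ^ 8 * √(A.card : ℝ)) := by
  obtain ⟨hs, hu⟩ := sums_bound A hA K h
  have hE := Estar_bound p hp (A - A) hnp
  have hEE : ((EE (A - A)).card : ℝ) ≤ (Estar (A - A)).card + 3 * ((A - A).card : ℝ) ^ 2 := by
    exact_mod_cast EE_le (A - A)
  have hpa := partA A l hl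
  have hN1 : (1 : ℝ) ≤ A.card := by exact_mod_cast hA.card_pos
  generalize ((A - A) + (A - A)).card = u' at hu hE
  generalize ((Estar (A - A)).card : ℝ) = es at hE hEE
  generalize ((EE (A - A)).card : ℝ) = ee at hEE hpa
  have hs0 : (0 : ℝ) ≤ ((A - A).card : ℝ) := Nat.cast_nonneg _
  generalize ((A - A).card : ℝ) = s at *
  have hr0 : (0 : ℝ) ≤ ((BB A l).card : ℝ) := Nat.cast_nonneg _
  generalize ((BB A l).card : ℝ) = r at *
  have hu0 : (0 : ℝ) ≤ (u' : ℝ) := Nat.cast_nonneg _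
  generalize (u' : ℝ) = u at *
  clear h hnp
  generalize (A.card : ℝ) = N at *
  have hsq1 : 1 ≤ √N := Real.one_le_sqrt.2 hN1
  have hK0 : 0 ≤ K := by linarith
  have hN0 : 0 ≤ N := by linarith
  have hsu : √u ≤ K ^ 2 * √N := by
    calc √u ≤ √(K ^ 4 * N) := Real.sqrt_le_sqrt hu
      _ = K ^ 2 * √N := by
        rw [Real.sqrt_mul (by positivity), show K ^ 4 = (K ^ 2) ^ 2 by ring,
          Real.sqrt_sq (by positivity)]
  have a1 : u ^ 4 * √u ≤ (K ^ 4 * N) ^ 4 * (K ^ 2 * √N) := by gcongr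
  have a2 : s ^ 4 ≤ (K ^ 2 * N) ^ 4 := by gcongr
  have a3 : (K ^ 2 * N) ^ 4 ≤ K ^ 18 * N ^ 4 * √N := by
    have : K ^ 8 ≤ K ^ 18 := pow_le_pow_right₀ hK (by norm_num)
    calc (K ^ 2 * N) ^ 4 = K ^ 8 * N ^ 4 * 1 := by ring
      _ ≤ _ := by gcongr
  have a4 : s ^ 2 * ee + s ^ 4 ≤ 567 * (K ^ 18 * N ^ 4 * √N) := by
    have : s ^ 2 * ee ≤ s ^ 2 * (es + 3 * s ^ 2) := by gcongr
    nlinarith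
  rcases hpa with h | h
  · have hN2 : 0 < N ^ 2 := by positivity
    have b1 : r ^ 3 ≤ 6 * K ^ 8 * N ^ 2 := by
      have : N ^ 2 * r ^ 3 ≤ N ^ 2 * (6 * K ^ 8 * N ^ 2) := by nlinarith
      exact le_of_mul_le_mul_left this hN2
    have c1 : K ^ 24 ≤ K ^ 26 := pow_le_pow_right₀ hK (by norm_num)
    have c2 : N ^ 6 ≤ N ^ 8 := pow_le_pow_right₀ hN1 (by norm_num)
    calc r ^ 9 = (r ^ 3) ^ 3 := by ring
      _ ≤ (6 * K ^ 8 * N ^ 2) ^ 3 := by gcongr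
      _ = 216 * K ^ 24 * (N ^ 6 * 1) := by ring
      _ ≤ 40824 * K ^ 26 * (N ^ 8 * √N) := by gcongr; norm_num
  · have hN6 : 0 < N ^ 6 * 1 := by positivity
    have : N ^ 6 * 1 * r ^ 9 ≤ N ^ 6 * 1 * (40824 * K ^ 26 * (N ^ 8 * √N)) := by
      calc N ^ 6 * 1 * r ^ 9 = (N ^ 2 * r ^ 3) ^ 3 := by ring
        _ ≤ 72 * s ^ 4 * (s ^ 2 * ee + s ^ 4) * N ^ 6 := h
        _ ≤ 72 * s ^ 4 * (567 * (K ^ 18 * N ^ 4 * √N)) * N ^ 6 := by gcongr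
        _ ≤ 72 * (K ^ 2 * N) ^ 4 * (567 * (K ^ 18 * N ^ 4 * √N)) * N ^ 6 := by gcongr
        _ = _ := by ring
    exact le_of_mul_le_mul_left this hN6

lemma root_bound (r N C : ℝ) (hN : 1 ≤ N) (hC : 1 ≤ C)
    (h : r ^ 9 ≤ C * (N ^ 8 * √N)) : r ≤ C * N ^ ((149 : ℝ) / 156) := by
  have hN0 : 0 ≤ N := by linarith
  have h1 : N ^ ((17 : ℝ) / 18) ≤ N ^ ((149 : ℝ) / 156) :=
    Real.rpow_le_rpow_of_exponent_le hN (by norm_num)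
  have h2 : (N ^ ((17 : ℝ) / 18)) ^ 9 = N ^ 8 * √N := by
    rw [← Real.rpow_natCast, ← Real.rpow_mul hN0, Real.sqrt_eq_rpow, ← Real.rpow_natCast N 8,
      ← Real.rpow_add (by linarith)]
    norm_num
  have hx0 : 0 ≤ N ^ ((17 : ℝ) / 18) := by positivity
  have h3 : r ≤ C * N ^ ((17 : ℝ) / 18) := by
    apply le_of_pow_le_pow_left₀ (n := 9) (by norm_num) (by positivity)
    rw [mul_pow, h2]
    refine h.trans ?_
    have : C ≤ C ^ 9 := le_self_pow₀ hC (by norm_num)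
    gcongr
  exact h3.trans (by gcongr)

lemma small_p (p N u : ℕ) (K : ℝ) (hK : 1 ≤ K) (hp : 1 ≤ p) (h1 : N ^ 92 ≤ p ^ 52)
    (hu : (u : ℝ) ≤ K ^ 4 * N) (h2 : p ^ 2 ≤ 8 * u ^ 3) : (p : ℝ) ≤ 8 ^ 23 * K ^ 276 := by
  have h3 : N ^ 23 ≤ p ^ 13 := by
    apply le_of_pow_le_pow_left₀ (n := 4) (by norm_num) (by positivity)
    rw [← pow_mul, ← pow_mul]; exact h1
  have h3R : (N : ℝ) ^ 23 ≤ (p : ℝ) ^ 13 := by exact_mod_cast h3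
  have h2R : (p : ℝ) ^ 2 ≤ 8 * (u : ℝ) ^ 3 := by exact_mod_cast h2
  have hp1 : (1 : ℝ) ≤ p := by exact_mod_cast hp
  have hK0 : 0 ≤ K := by linarith
  have h4 : (p : ℝ) ^ 39 * (p : ℝ) ^ 7 ≤ (p : ℝ) ^ 39 * (8 ^ 23 * K ^ 276) := by
    calc (p : ℝ) ^ 39 * (p : ℝ) ^ 7 = ((p : ℝ) ^ 2) ^ 23 := by ring
      _ ≤ (8 * (K ^ 4 * N) ^ 3) ^ 23 := by
        refine pow_le_pow_left₀ (by positivity) (h2R.trans ?_) 23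
        gcongr
      _ = 8 ^ 23 * K ^ 276 * ((N : ℝ) ^ 23) ^ 3 := by
        rw [mul_pow, mul_pow, mul_pow, ← pow_mul, ← pow_mul, ← pow_mul, ← pow_mul]
        ring
      _ ≤ 8 ^ 23 * K ^ 276 * ((p : ℝ) ^ 13) ^ 3 := by gcongr
      _ = _ := by rw [← pow_mul]; ring
  have h5 := le_of_mul_le_mul_left h4 (by positivity)
  exact (le_self_pow₀ hp1 (by norm_num)).trans h5

end Inc

theorem stmt4 :
    ∃ c : ℝ, 1 ≤ c ∧
      ∀ K : ℝ, 1 ≤ K →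
        ∃ CK : ℝ, 1 ≤ CK ∧
          ∀ (p : ℕ), p.Prime → Odd p →
            ∀ A : Finset (ZMod p), ((A + A).card : ℝ) ≤ K * A.card →
              (A - A).card ^ 92 ≤ p ^ 52 →
              ∀ lam : ZMod p, lam ≠ 0 →
                (mulRep p A lam : ℝ) ≤
                  CK * Real.log p ^ c *
                    ((A.card : ℝ) ^ 2 / p + (A.card : ℝ) ^ ((149 : ℝ) / 156)) := by
  refine ⟨1, le_rfl, fun K hK => ⟨8 ^ 23 * K ^ 276 + 40824 * K ^ 26, ?_, ?_⟩⟩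
  · have h1 : (1 : ℝ) ≤ K ^ 276 := one_le_pow₀ hK
    have h2 : (1 : ℝ) ≤ K ^ 26 := one_le_pow₀ hK
    nlinarith
  intro p hpp hodd A hAA hAs lam hlam
  have : Fact p.Prime := ⟨hpp⟩
  have hK0 : 0 ≤ K := by linarith
  have hp3 : 3 ≤ p := by
    have := hpp.two_le
    rcases hodd with ⟨k, rfl⟩
    omega
  have hlog : 1 ≤ Real.log p := by
    rw [Real.le_log_iff_exp_le (by exact_mod_cast (by omega : 0 < p))]
    have h1 : (3 : ℝ) ≤ p := by exact_mod_cast hp3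
    have := Real.exp_one_lt_d9
    linarith
  have hrB : mulRep p A lam ≤ (Inc.BB A lam).card := by
    unfold mulRep
    apply Finset.card_le_card_of_injOn (fun t => t.1)
    · rintro ⟨a, b⟩ h
      simp only [Finset.mem_coe, Finset.mem_filter, Finset.mem_product] at h
      obtain ⟨⟨ha, hb⟩, rfl⟩ := h
      simp only [Finset.mem_coe, Inc.BB, Finset.mem_filter]
      have ha0 : a ≠ 0 := left_ne_zero_of_mul hlam
      refine ⟨ha, ha0, ?_⟩
      rw [mul_div_cancel_left₀ _ ha0]; exact hb
    · rintro ⟨a, b⟩ h ⟨a', b'⟩ h' he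
      simp only [Finset.mem_coe, Finset.mem_filter, Finset.mem_product] at h h' he
      subst he
      have hab : a * b ≠ 0 := by rw [h.2]; exact hlam
      have ha0 : a ≠ 0 := left_ne_zero_of_mul hab
      rw [mul_left_cancel₀ ha0 (h.2.trans h'.2.symm)]
  have hrR : (mulRep p A lam : ℝ) ≤ (Inc.BB A lam).card := by exact_mod_cast hrB
  rw [Real.rpow_one]
  rcases A.eq_empty_or_nonempty with rfl | hA
  · have : mulRep p ∅ lam = 0 := by simp [mulRep]
    rw [this, Nat.cast_zero]
    positivity
  have hN1 : (1 : ℝ) ≤ A.card := by exact_mod_cast hA.card_pos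
  have hx1 : (1 : ℝ) ≤ (A.card : ℝ) ^ ((149 : ℝ) / 156) := Real.one_le_rpow hN1 (by norm_num)
  have goal2 : (mulRep p A lam : ℝ) ≤
      (8 ^ 23 * K ^ 276 + 40824 * K ^ 26) * (A.card : ℝ) ^ ((149 : ℝ) / 156) := by
    obtain ⟨hs, hu⟩ := Inc.sums_bound A hA K hAA
    have hNs : A.card ≤ (A - A).card := Finset.card_le_card_sub_right hA
    by_cases hnp : 8 * ((A - A) + (A - A)).card ^ 3 < p ^ 2
    · have h9 := Inc.main_bound p (by
        intro n h1 h2 h3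
        rw [ZMod.natCast_eq_zero_iff] at h3
        exact absurd (Nat.le_of_dvd h1 h3) (by omega)) A hA K hK hAA hnp lam hlam
      have h2 : (1 : ℝ) ≤ K ^ 26 := one_le_pow₀ hK
      have := Inc.root_bound _ _ (40824 * K ^ 26) hN1 (by linarith) h9
      refine hrR.trans (this.trans ?_)
      gcongr
      have : (0 : ℝ) ≤ 8 ^ 23 * K ^ 276 := by positivity
      linarith
    · push Not at hnp
      have hpb := Inc.small_p p A.card _ K hK (by omega)
        ((Nat.pow_le_pow_left hNs 92).trans hAs) hu hnp
      have hBp : ((Inc.BB A lam).card : ℝ) ≤ p := by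
        have h1 : (Inc.BB A lam).card ≤ A.card := Finset.card_filter_le _ _
        have h2 : A.card ≤ p := by
          have := Finset.card_le_univ A
          rwa [ZMod.card] at this
        exact_mod_cast h1.trans h2
      have h3 : (0 : ℝ) ≤ 40824 * K ^ 26 := by positivity
      have h4 : (mulRep p A lam : ℝ) ≤ (8 ^ 23 * K ^ 276 + 40824 * K ^ 26) * 1 := by linarith
      exact h4.trans (by gcongr)
  refine goal2.trans ?_
  have hC0 : (0 : ℝ) ≤ 8 ^ 23 * K ^ 276 + 40824 * K ^ 26 := by positivity
  have hsq : (0 : ℝ) ≤ (A.card : ℝ) ^ 2 / p := by positivity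
  calc _ = (8 ^ 23 * K ^ 276 + 40824 * K ^ 26) * 1 * (0 + (A.card : ℝ) ^ ((149 : ℝ) / 156)) := by ring
    _ ≤ _ := by gcongr
end

section
/- There exist absolute constants C ≥ 1 and c ≥ 1 such that for every odd prime p, every λ ∈ F_p with λ ≠ 0, all finite sets A, D ⊆ F_p, and all sets B = {u+1, …, u+N₁} ⊆ F_p and C = {v+1, …, v+N₂} ⊆ F_p (arithmetic progressions with common difference 1, where u, v ∈ F_p and 1 ≤ N₁, N₂ ≤ p), one has I_λ(A,B,C,D) − |A||B||C||D|/p ≤ C (log p)^c ( |A|^{1/4} |B||C| |D|^{1/2} + |A|^{3/4} |D|^{1/2} (|B||C|)^{5/6} ( 1 + (|B||C|/p)^{1/12} ) ). -/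
open Finset

/-- The number of quadruples `(a,b,c,d) ∈ A×B×C×D` with `(a+b)(c+d) = λ` in `F_p`. -/
def hypCount (p : ℕ) (lam : ZMod p) (A B C D : Finset (ZMod p)) : ℕ :=
  (((A ×ˢ B) ×ˢ (C ×ˢ D)).filter fun x => (x.1.1 + x.1.2) * (x.2.1 + x.2.2) = lam).card

/-- The arithmetic progression `{t+1, …, t+N} ⊆ F_p` with common difference `1`. -/
def apF (p : ℕ) (t : ZMod p) (N : ℕ) : Finset (ZMod p) :=
  (Finset.Icc 1 N).image fun i : ℕ => t + (i : ZMod p)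


lemma cong_count (N m : ℕ) (hm : 1 ≤ m) (hmN : m ≤ N) (S : Finset ℤ)
    (hS : S ⊆ Finset.Ioo (-(N:ℤ)) N) (hc : ∀ a ∈ S, ∀ b ∈ S, (m:ℤ) ∣ a - b) :
    S.card * m ≤ 3 * N := by
  have h1 : S.card ≤ (Finset.range ((2*N-1)/m + 1)).card := by
    apply Finset.card_le_card_of_injOn (fun a => ((a + N) / (m:ℤ)).toNat)
    · intro a ha
      have h := Finset.mem_Ioo.1 (hS ha)
      have h0 : 0 ≤ (a + N) / (m:ℤ) := Int.ediv_nonneg (by omega) (by omega)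
      simp only [Finset.coe_range, Set.mem_Iio]
      zify
      rw [Int.toNat_of_nonneg h0]
      have : (a + N) / (m:ℤ) ≤ (((2*N-1 : ℕ)):ℤ) / (m:ℤ) :=
        Int.ediv_le_ediv (by omega) (by omega)
      omega
    · intro a ha b hb hab
      have h := Finset.mem_Ioo.1 (hS ha)
      have h' := Finset.mem_Ioo.1 (hS hb)
      have h0 : 0 ≤ (a + N) / (m:ℤ) := Int.ediv_nonneg (by omega) (by omega)
      have h0' : 0 ≤ (b + N) / (m:ℤ) := Int.ediv_nonneg (by omega) (by omega)
      have e : (a + N) / (m:ℤ) = (b + N) / (m:ℤ) := by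
        have := congrArg (Nat.cast : ℕ → ℤ) hab
        simpa [Int.toNat_of_nonneg h0, Int.toNat_of_nonneg h0'] using this
      obtain ⟨k, hk⟩ := hc a ha b hb
      have e2 : (a + N) = (b + N) + m * k := by linarith
      rw [e2, Int.add_mul_ediv_left _ _ (by omega)] at e
      have : k = 0 := by omega
      subst this
      linarith
  rw [Finset.card_range] at h1
  calc S.card * m ≤ ((2*N-1)/m + 1) * m := Nat.mul_le_mul_right _ h1
    _ = (2*N-1)/m * m + m := by ring
    _ ≤ (2*N-1) + m := by gcongr; exact Nat.div_mul_le_self _ _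
    _ ≤ 3 * N := by omega

lemma pair_count (p N : ℕ) (hp : 1 ≤ p) (x y : ℤ) (hxy : IsCoprime x y) (hy : y ≠ 0)
    (hle : |x| ≤ |y|) (hyN : |y| ≤ N) :
    ((((Finset.Ioo (-(N:ℤ)) N) ×ˢ (Finset.Ioo (-(N:ℤ)) N)).filter
      fun q => (p:ℤ) ∣ x * q.1 - y * q.2).card : ℝ) ≤ 12 * N^2 / p + 3 * N / |(y:ℝ)| := by
  obtain ⟨m, hm⟩ : ∃ m : ℕ, |y| = m := ⟨y.natAbs, by simp⟩
  have hm1 : 1 ≤ m := by have := abs_pos.2 hy; omega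
  have hmN : m ≤ N := by omega
  set S := ((Finset.Ioo (-(N:ℤ)) N) ×ˢ (Finset.Ioo (-(N:ℤ)) N)).filter
      fun q => (p:ℤ) ∣ x * q.1 - y * q.2 with hSdef
  set K := 2 * N * m / p with hK
  have h1 : S.card ≤ (3 * N / m) * (Finset.Icc (-(K:ℤ)) K).card := by
    apply Finset.card_le_mul_card_image_of_maps_to (f := fun q => (x * q.1 - y * q.2) / (p:ℤ))
    · intro q hq
      simp only [hSdef, Finset.mem_filter, Finset.mem_product, Finset.mem_Ioo] at hq
      obtain ⟨⟨⟨h1, h2⟩, h3, h4⟩, k, hk⟩ := hq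
      simp only [hk]
      rw [Int.mul_ediv_cancel_left _ (by omega), Finset.mem_Icc, ← abs_le]
      rw [hK]; push_cast
      rw [Int.le_ediv_iff_mul_le (by omega)]
      have e1 : |k| * p = |x * q.1 - y * q.2| := by
        rw [hk, abs_mul, mul_comm]; simp
      rw [e1]
      have a1 : |q.1| ≤ N := abs_le.2 ⟨h1.le, h2.le⟩
      have a2 : |q.2| ≤ N := abs_le.2 ⟨h3.le, h4.le⟩
      calc |x * q.1 - y * q.2| ≤ |x * q.1| + |y * q.2| := abs_sub _ _
        _ = |x| * |q.1| + |y| * |q.2| := by rw [abs_mul, abs_mul]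
        _ ≤ m * N + m * N := by
            have hx' : |x| ≤ m := hm ▸ hle
            have hy' : |y| ≤ m := hm.le
            gcongr
        _ = 2 * N * m := by ring
    · intro k _
      rw [Nat.le_div_iff_mul_le hm1]
      set G := S.filter (fun q => (x * q.1 - y * q.2) / (p:ℤ) = k) with hG
      have hmem : ∀ q ∈ G, q.1 ∈ Finset.Ioo (-(N:ℤ)) N ∧ x * q.1 - y * q.2 = p * k := by
        intro q hq
        simp only [hG, hSdef, Finset.mem_filter, Finset.mem_product] at hq
        obtain ⟨⟨⟨h1, h2⟩, h3⟩, h4⟩ := hq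
        refine ⟨h1, ?_⟩
        rw [← h4, Int.mul_ediv_cancel' h3]
      have hinj : Set.InjOn Prod.fst (G : Set (ℤ × ℤ)) := by
        intro q hq r hr e
        have e1 := (hmem q hq).2
        have e2 := (hmem r hr).2
        rw [e] at e1
        have : y * q.2 = y * r.2 := by linarith
        exact Prod.ext e (mul_left_cancel₀ hy this)
      rw [← Finset.card_image_of_injOn hinj]
      apply cong_count N m hm1 hmN
      · intro a ha
        obtain ⟨q, hq, rfl⟩ := Finset.mem_image.1 ha
        exact (hmem q hq).1
      · intro a ha b hb
        obtain ⟨q, hq, rfl⟩ := Finset.mem_image.1 ha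
        obtain ⟨r, hr, rfl⟩ := Finset.mem_image.1 hb
        have e1 := (hmem q hq).2
        have e2 := (hmem r hr).2
        rw [← hm, abs_dvd]
        apply hxy.symm.dvd_of_dvd_mul_left
        exact ⟨q.2 - r.2, by linarith⟩
  have h2 : (Finset.Icc (-(K:ℤ)) K).card = 2 * K + 1 := by
    rw [Int.card_Icc]; omega
  rw [h2] at h1
  have hmr : (0:ℝ) < m := by exact_mod_cast hm1
  have hpr : (0:ℝ) < p := by exact_mod_cast hp
  have hyr : |(y:ℝ)| = m := by exact_mod_cast hm
  rw [hyr]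
  have hKr : (K:ℝ) ≤ 2 * N * m / p := by
    rw [hK]; refine le_trans Nat.cast_div_le ?_; push_cast; exact le_rfl
  have h3 : ((3 * N / m : ℕ):ℝ) ≤ 3 * N / m := by
    refine le_trans Nat.cast_div_le ?_; push_cast; exact le_rfl
  calc (S.card : ℝ) ≤ ((3 * N / m : ℕ):ℝ) * (2 * K + 1) := by exact_mod_cast h1
    _ ≤ (3 * N / m) * (2 * (2 * N * m / p) + 1) := by gcongr
    _ = 12 * N^2 / p + 3 * N / m := by field_simp; ring

lemma harm_bound (M : ℕ) (p : ℕ) (hp : 3 ≤ p) (hM : M ≤ p) :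
    ∑ g ∈ Finset.Icc 1 M, (1:ℝ) / g ≤ 2 * Real.log p := by
  have hl : 1 ≤ Real.log p := by
    rw [Real.le_log_iff_exp_le (by positivity)]
    have := Real.exp_one_lt_d9
    have : (3:ℝ) ≤ p := by exact_mod_cast hp
    linarith
  rcases Nat.eq_zero_or_pos M with rfl | h0
  · simp; linarith
  have h := harmonic_le_one_add_log M
  rw [harmonic_eq_sum_Icc] at h
  push_cast at h
  have h2 : Real.log M ≤ Real.log p := Real.log_le_log (by positivity) (by exact_mod_cast hM)
  simp only [one_div]
  linarith

/-- half energy set -/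
noncomputable def eset (p M N : ℕ) : Finset ((ℤ × ℤ) × (ℤ × ℤ)) :=
  (((Finset.Ioo (-(M:ℤ)) M) ×ˢ (Finset.Ioo (-(M:ℤ)) M)) ×ˢ
    ((Finset.Ioo (-(N:ℤ)) N) ×ˢ (Finset.Ioo (-(N:ℤ)) N))).filter
      fun q => q.1.1 ≠ 0 ∧ q.1.2 ≠ 0 ∧ (p:ℤ) ∣ q.1.1 * q.2.1 - q.1.2 * q.2.2

lemma half_count (p M N : ℕ) (hp : p.Prime) (hp3 : 3 ≤ p) (hMN : M ≤ N) (hMp : M ≤ p) :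
    (((eset p M N).filter fun q => |q.1.1| ≤ |q.1.2|).card : ℝ) ≤
      (2 * Real.log p) * (2 * M * (36 * N^2 * M / p + 9 * N)) := by
  classical
  set E := (eset p M N).filter fun q => |q.1.1| ≤ |q.1.2| with hE
  let V : ℕ → Finset ℤ := fun g => (Finset.Icc (-((M / g : ℕ):ℤ)) ((M / g : ℕ):ℤ)).erase 0
  let W : ℤ → Finset ℤ := fun y => (Finset.Icc (-|y|) (|y|)).filter fun x => IsCoprime x y
  let P : ℤ → ℤ → Finset (ℤ × ℤ) := fun y x =>
    ((Finset.Ioo (-(N:ℤ)) N) ×ˢ (Finset.Ioo (-(N:ℤ)) N)).filter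
      fun q => (p:ℤ) ∣ x * q.1 - y * q.2
  let Tg : Finset (Σ _ : ℕ, Σ _ : ℤ, Σ _ : ℤ, ℤ × ℤ) :=
    (Finset.Icc 1 M).sigma fun g => (V g).sigma fun y => (W y).sigma fun x => P y x
  have h1 : E.card ≤ Tg.card := by
    apply Finset.card_le_card_of_injOn
      (fun q => ⟨Int.gcd q.1.1 q.1.2, q.1.2 / (Int.gcd q.1.1 q.1.2 : ℤ),
        q.1.1 / (Int.gcd q.1.1 q.1.2 : ℤ), q.2⟩)
    · rintro ⟨⟨w, w'⟩, t, t'⟩ hq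
      simp only [hE, eset, Finset.coe_filter, Finset.mem_filter, Finset.mem_product, Finset.mem_Ioo,
        Set.mem_ofPred_eq] at hq
      obtain ⟨⟨⟨⟨hw, hw'⟩, ht⟩, hw0, hw0', hd⟩, hle⟩ := hq
      have hg0 : 0 < Int.gcd w w' := Int.gcd_pos_of_ne_zero_left _ hw0
      obtain ⟨x, hx⟩ := Int.gcd_dvd_left w w'
      obtain ⟨y, hy⟩ := Int.gcd_dvd_right w w'
      have hcop := Int.isCoprime_iff_gcd_eq_one.2 (Int.gcd_div_gcd_div_gcd hg0)
      set g := Int.gcd w w' with hgdef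
      have ey : w' / (g:ℤ) = y := by rw [hy, Int.mul_ediv_cancel_left _ (by omega)]
      have ex : w / (g:ℤ) = x := by rw [hx, Int.mul_ediv_cancel_left _ (by omega)]
      rw [ex, ey] at hcop
      have hgle : g ≤ M := by
        have := Int.le_of_dvd (abs_pos.2 hw0) ((dvd_abs _ _).2 (Int.gcd_dvd_left w w'))
        have h3 : |w| < M := abs_lt.2 hw
        omega
      have hy0 : y ≠ 0 := by rintro rfl; simp at hy; exact hw0' hy
      have hyM : |y| * g ≤ M := by
        have h3 : |w'| < M := abs_lt.2 hw'
        rw [hy, abs_mul] at h3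
        simp at h3; linarith
      simp only [Tg, V, W, P, Finset.coe_sigma, Set.mem_sigma_iff, Finset.mem_coe, Finset.mem_Icc,
        Finset.mem_erase, Finset.mem_filter, Finset.mem_product, Finset.mem_Ioo, ← hgdef, ex, ey]
      refine ⟨⟨hg0, hgle⟩, ⟨hy0, ?_⟩, ⟨?_, hcop⟩, ht, ?_⟩
      · rw [← abs_le]; push_cast; rw [Int.le_ediv_iff_mul_le (by omega)]; exact hyM
      · rw [← abs_le]
        rw [hx, hy, abs_mul, abs_mul] at hle
        exact le_of_mul_le_mul_left hle (by simp; omega)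
      · have hpp : Prime (p:ℤ) := Nat.prime_iff_prime_int.1 hp
        have e : w * t - w' * t' = g * (x * t - y * t') := by rw [hx, hy]; ring
        rw [e] at hd
        rcases hpp.dvd_or_dvd hd with h | h
        · exfalso
          have h4 : |w| < M := abs_lt.2 hw
          have h5 : (p:ℤ) ∣ |w| := (dvd_abs _ _).2 (h.trans (Int.gcd_dvd_left w w'))
          have := Int.le_of_dvd (abs_pos.2 hw0) h5
          omega
        · exact h
    · rintro ⟨⟨w, w'⟩, t⟩ hq ⟨⟨v, v'⟩, u⟩ hr h
      simp only [Sigma.mk.injEq] at h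
      obtain ⟨h1, h2⟩ := h
      rw [← h1] at h2
      simp only [heq_eq_eq, Sigma.mk.injEq] at h2
      obtain ⟨h2, h3, h4⟩ := h2
      have e1 := Int.mul_ediv_cancel' (Int.gcd_dvd_left w w')
      have e2 := Int.mul_ediv_cancel' (Int.gcd_dvd_right w w')
      have d1 := Int.gcd_dvd_left v v'
      have d2 := Int.gcd_dvd_right v v'
      rw [← h1] at d1 d2
      have e3 := Int.mul_ediv_cancel' d1
      have e4 := Int.mul_ediv_cancel' d2
      rw [h3] at e1; rw [h2] at e2
      simp only [Prod.mk.injEq]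
      exact ⟨⟨e1.symm.trans e3, e2.symm.trans e4⟩, h4⟩
  have hpr : (0:ℝ) < p := by positivity
  have h2 : (Tg.card : ℝ) ≤ ∑ g ∈ Finset.Icc 1 M, (1:ℝ) / g * (2 * M * (36 * N^2 * M / p + 9 * N)) := by
    simp only [Tg, Finset.card_sigma, Nat.cast_sum]
    apply Finset.sum_le_sum
    intro g hg
    rw [Finset.mem_Icc] at hg
    have hgr : (0:ℝ) < g := by exact_mod_cast hg.1
    have h3 : ∀ y ∈ V g, ∑ x ∈ W y, ((P y x).card : ℝ) ≤ 36 * N^2 * M / p + 9 * N := by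
      intro y hy
      simp only [V, Finset.mem_erase, Finset.mem_Icc, ← abs_le] at hy
      obtain ⟨hy0, hyM⟩ := hy
      have hyM2 : |y| ≤ M := by
        have := Nat.div_le_self M g
        omega
      have hyr : 1 ≤ |(y:ℝ)| := by exact_mod_cast Int.one_le_abs hy0
      have hyMr : |(y:ℝ)| ≤ M := by exact_mod_cast hyM2
      have h4 : ∀ x ∈ W y, ((P y x).card : ℝ) ≤ 12 * N^2 / p + 3 * N / |(y:ℝ)| := by
        intro x hx
        simp only [W, Finset.mem_filter, Finset.mem_Icc, ← abs_le] at hx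
        exact pair_count p N (by omega) x y hx.2 hy0 hx.1 (by omega)
      have h5 : ((W y).card : ℝ) ≤ 3 * |(y:ℝ)| := by
        have : (W y).card ≤ (Finset.Icc (-|y|) (|y|)).card := Finset.card_filter_le _ _
        rw [Int.card_Icc] at this
        have h6 : ((W y).card : ℤ) ≤ 3 * |y| := by
          have := Int.one_le_abs hy0
          omega
        exact_mod_cast h6
      calc ∑ x ∈ W y, ((P y x).card : ℝ) ≤ (W y).card • (12 * N^2 / p + 3 * N / |(y:ℝ)|) :=
            Finset.sum_le_card_nsmul _ _ _ h4
        _ = (W y).card * (12 * N^2 / p + 3 * N / |(y:ℝ)|) := nsmul_eq_mul _ _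
        _ ≤ (3 * |(y:ℝ)|) * (12 * N^2 / p + 3 * N / |(y:ℝ)|) := by gcongr
        _ = 36 * N^2 * |(y:ℝ)| / p + 9 * N := by field_simp; ring
        _ ≤ _ := by gcongr
    have h6 : ((V g).card : ℝ) ≤ 2 * M / g := by
      have : (V g).card = 2 * (M / g) := by
        simp only [V]
        rw [Finset.card_erase_of_mem (by simp; positivity), Int.card_Icc]; omega
      rw [this]; push_cast
      rw [mul_div_assoc]
      gcongr
      exact Nat.cast_div_le
    calc ∑ y ∈ V g, ∑ x ∈ W y, ((P y x).card : ℝ) ≤ (V g).card • (36 * N^2 * M / p + 9 * N : ℝ) :=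
            Finset.sum_le_card_nsmul _ _ _ h3
      _ = (V g).card * (36 * N^2 * M / p + 9 * N) := nsmul_eq_mul _ _
      _ ≤ (2 * M / g) * (36 * N^2 * M / p + 9 * N) := by gcongr
      _ = _ := by ring
  rw [← Finset.sum_mul] at h2
  calc (E.card : ℝ) ≤ Tg.card := by exact_mod_cast h1
    _ ≤ _ := h2
    _ ≤ _ := by
      gcongr
      exact harm_bound M p hp3 hMp

lemma eset_count (p M N : ℕ) (hp : p.Prime) (hp3 : 3 ≤ p) (hMN : M ≤ N) (hMp : M ≤ p) :
    ((eset p M N).card : ℝ) ≤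
      288 * Real.log p * (M * N + (M * N : ℝ)^2 / p) := by
  have h := half_count p M N hp hp3 hMN hMp
  have hl : 0 ≤ Real.log p := Real.log_natCast_nonneg p
  have h1 : ((eset p M N).filter fun q => ¬ |q.1.1| ≤ |q.1.2|).card ≤
      ((eset p M N).filter fun q => |q.1.1| ≤ |q.1.2|).card := by
    apply Finset.card_le_card_of_injOn (fun q => (q.1.swap, q.2.swap))
    · rintro ⟨⟨w, w'⟩, t, t'⟩ hq
      simp only [eset, Finset.coe_filter, Finset.mem_filter, Finset.mem_product, Finset.mem_Ioo,
        Set.mem_ofPred_eq, Prod.swap] at hq ⊢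
      obtain ⟨⟨⟨⟨hw, hw'⟩, ht, ht'⟩, hw0, hw0', hd⟩, hle⟩ := hq
      refine ⟨⟨⟨⟨hw', hw⟩, ht', ht⟩, hw0', hw0, ?_⟩, by omega⟩
      rw [dvd_sub_comm]; exact hd
    · intro q _ r _ h
      simp only [Prod.mk.injEq] at h
      exact Prod.ext (Prod.swap_injective h.1) (Prod.swap_injective h.2)
  have h2 := Finset.card_filter_add_card_filter_not (s := eset p M N) (fun q => |q.1.1| ≤ |q.1.2|)
  have h3 : ((eset p M N).card : ℝ) ≤ 2 * ((eset p M N).filter fun q => |q.1.1| ≤ |q.1.2|).card := by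
    norm_cast; omega
  have hpr : (0:ℝ) < p := by have := hp.pos; positivity
  calc _ ≤ _ := h3
    _ ≤ 2 * ((2 * Real.log p) * (2 * M * (36 * N^2 * M / p + 9 * N))) := by gcongr
    _ = 288 * Real.log p * ((M * N : ℝ)^2 / p) + 72 * Real.log p * (M * N) := by ring
    _ ≤ _ := by
      have : 0 ≤ Real.log p * (M * N) := by positivity
      nlinarith

lemma holder3 {ι : Type*} (s : Finset ι) (f T : ι → ℝ) (hf : ∀ i ∈ s, 0 ≤ f i)
    (hT : ∀ i ∈ s, 0 ≤ T i) (P Q R : ℝ) (hP : 0 < P) (hQ : 0 < Q) (hR : 0 < R)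
    (h1 : ∑ i ∈ s, f i ≤ P) (h2 : ∑ i ∈ s, f i ^ 2 ≤ Q) (h3 : ∑ i ∈ s, T i ^ 3 ≤ R) :
    ∑ i ∈ s, f i * T i ≤ (P * Q * R) ^ ((1:ℝ)/3) := by
  set c := (P * Q * R) ^ ((1:ℝ)/3) with hc
  have hc0 : 0 ≤ c := by positivity
  have key : ∀ i ∈ s, f i * T i ≤ c * ((1/3) * (f i / P) + (1/3) * (f i ^ 2 / Q) + (1/3) * (T i ^ 3 / R)) := by
    intro i hi
    have a := hf i hi
    have b := hT i hi
    have h := Real.geom_mean_le_arith_mean3_weighted (w₁ := 1/3) (w₂ := 1/3) (w₃ := 1/3)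
      (p₁ := f i / P) (p₂ := f i ^ 2 / Q) (p₃ := T i ^ 3 / R) (by norm_num) (by norm_num)
      (by norm_num) (by positivity) (by positivity) (by positivity) (by norm_num)
    refine le_trans (le_of_eq ?_) (mul_le_mul_of_nonneg_left h hc0)
    rw [← Real.mul_rpow (by positivity) (by positivity),
      ← Real.mul_rpow (by positivity) (by positivity), hc,
      ← Real.mul_rpow (by positivity) (by positivity)]
    have : P * Q * R * (f i / P * (f i ^ 2 / Q) * (T i ^ 3 / R)) = (f i * T i) ^ (3:ℕ) := by
      field_simp
    rw [this, ← Real.rpow_natCast, ← Real.rpow_mul (by positivity)]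
    norm_num
  calc ∑ i ∈ s, f i * T i ≤ ∑ i ∈ s, c * ((1/3) * (f i / P) + (1/3) * (f i ^ 2 / Q) + (1/3) * (T i ^ 3 / R)) :=
        Finset.sum_le_sum key
    _ = c * ((1/3) * ((∑ i ∈ s, f i) / P) + (1/3) * ((∑ i ∈ s, f i ^ 2) / Q)
          + (1/3) * ((∑ i ∈ s, T i ^ 3) / R)) := by
        rw [← Finset.mul_sum, Finset.sum_add_distrib, Finset.sum_add_distrib, ← Finset.mul_sum,
          ← Finset.mul_sum, ← Finset.mul_sum, Finset.sum_div, Finset.sum_div, Finset.sum_div]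
    _ ≤ c * ((1/3) * 1 + (1/3) * 1 + (1/3) * 1) := by
        gcongr <;> (rw [div_le_one (by assumption)]; assumption)
    _ = c := by ring

lemma cube_choose (n : ℕ) (h : 3 ≤ n) : n ^ 3 ≤ 162 * n.choose 3 := by
  have h1 := Nat.pow_sub_le_descFactorial n 3
  rw [Nat.descFactorial_eq_factorial_mul_choose] at h1
  have h2 : n ≤ 3 * (n + 1 - 3) := by omega
  calc n ^ 3 ≤ (3 * (n + 1 - 3)) ^ 3 := Nat.pow_le_pow_left h2 3
    _ = 27 * (n + 1 - 3) ^ 3 := by ring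
    _ ≤ 27 * (Nat.factorial 3 * n.choose 3) := Nat.mul_le_mul_left _ h1
    _ = 162 * n.choose 3 := by simp [Nat.factorial]; ring

lemma main_sum {τ κ : Type*} [DecidableEq κ] (Om : Finset τ) (g : τ → κ) (T : κ → ℕ)
    (P Q R : ℝ) (hP : 0 < P) (hQ : 0 < Q) (hR : 0 < R)
    (h1 : (Om.card : ℝ) ≤ P)
    (h2 : (((Om ×ˢ Om).filter fun q => g q.1 = g q.2).card : ℝ) ≤ Q)
    (h3 : ((∑ k ∈ Om.image g, (T k).choose 3 : ℕ) : ℝ) ≤ R) :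
    ((∑ x ∈ Om, T (g x) : ℕ) : ℝ) ≤ 2 * P + (P * Q * (162 * R)) ^ ((1:ℝ)/3) := by
  classical
  let T' : κ → ℕ := fun k => if 3 ≤ T k then T k else 0
  have hT : ∀ k, T k ≤ 2 + T' k := by
    intro k; simp only [T']; split_ifs <;> omega
  have e1 : ∑ x ∈ Om, T (g x) ≤ 2 * Om.card + ∑ k ∈ Om.image g, (Om.filter fun x => g x = k).card * T' k := by
    calc ∑ x ∈ Om, T (g x) ≤ ∑ x ∈ Om, (2 + T' (g x)) := Finset.sum_le_sum fun x _ => hT _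
      _ = 2 * Om.card + ∑ x ∈ Om, T' (g x) := by
        rw [Finset.sum_add_distrib]; simp [mul_comm]
      _ = _ := by rw [Finset.sum_comp T' g]; simp
  have e2 := holder3 (Om.image g) (fun k => ((Om.filter fun x => g x = k).card : ℝ)) (fun k => (T' k : ℝ))
    (fun _ _ => by positivity) (fun _ _ => by positivity) P Q (162 * R) hP hQ (by positivity)
    (by
      refine le_trans (le_of_eq ?_) h1
      rw [Finset.card_eq_sum_card_image g Om]; push_cast; rfl)
    (by
      refine le_trans (le_of_eq ?_) h2
      rw [Finset.card_eq_sum_card_fiberwise (f := fun q => g q.1) (t := Om.image g)]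
      · push_cast
        apply Finset.sum_congr rfl
        intro k _
        rw [sq, ← Nat.cast_mul, ← Finset.card_product]
        congr 2
        ext ⟨a, b⟩
        simp only [Finset.mem_product, Finset.mem_filter]
        constructor
        · rintro ⟨⟨h1, h2⟩, h3, h4⟩
          exact ⟨⟨⟨h1, h3⟩, h2.trans h4.symm⟩, h2⟩
        · rintro ⟨⟨⟨h1, h3⟩, h4⟩, h5⟩
          exact ⟨⟨h1, h5⟩, h3, h4.symm.trans h5⟩
      · rintro ⟨a, b⟩ h
        simp only [Finset.coe_filter, Finset.mem_product, Set.mem_ofPred_eq] at h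
        exact Finset.mem_coe.2 (Finset.mem_image_of_mem _ h.1.1))
    (by
      have : ∑ k ∈ Om.image g, T' k ^ 3 ≤ 162 * ∑ k ∈ Om.image g, (T k).choose 3 := by
        rw [Finset.mul_sum]
        apply Finset.sum_le_sum
        intro k _
        simp only [T']
        split_ifs with h
        · exact cube_choose _ h
        · simp
      calc ∑ k ∈ Om.image g, (T' k : ℝ) ^ 3 = ((∑ k ∈ Om.image g, T' k ^ 3 : ℕ) : ℝ) := by push_cast; rfl
        _ ≤ ((162 * ∑ k ∈ Om.image g, (T k).choose 3 : ℕ) : ℝ) := by exact_mod_cast this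
        _ = 162 * ((∑ k ∈ Om.image g, (T k).choose 3 : ℕ) : ℝ) := by push_cast; ring
        _ ≤ _ := by gcongr)
  calc ((∑ x ∈ Om, T (g x) : ℕ) : ℝ)
      ≤ ((2 * Om.card + ∑ k ∈ Om.image g, (Om.filter fun x => g x = k).card * T' k : ℕ) : ℝ) := by
        exact_mod_cast e1
    _ = 2 * Om.card + ∑ k ∈ Om.image g, ((Om.filter fun x => g x = k).card : ℝ) * T' k := by push_cast; rfl
    _ ≤ _ := by gcongr

/-- Moebius relation -/
def mrel {F : Type*} [Field F] (k : F × F × F × F) (q : F × F) : Prop :=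
  q.2 * (k.2.2.1 * q.1 + k.2.2.2) = k.1 * q.1 + k.2.1

lemma mrel_unique {F : Type*} [Field F] (α β γ δ α' β' γ' δ' : F) (h : α * δ - β * γ = 1)
    (h' : α' * δ' - β' * γ' = 1) (y1 y2 y3 z1 z2 z3 : F) (n12 : y1 ≠ y2) (n13 : y1 ≠ y3) (n23 : y2 ≠ y3)
    (a1 : z1 * (γ * y1 + δ) = α * y1 + β) (a2 : z2 * (γ * y2 + δ) = α * y2 + β)
    (a3 : z3 * (γ * y3 + δ) = α * y3 + β)
    (b1 : z1 * (γ' * y1 + δ') = α' * y1 + β') (b2 : z2 * (γ' * y2 + δ') = α' * y2 + β')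
    (b3 : z3 * (γ' * y3 + δ') = α' * y3 + β') :
    (α', β', γ', δ') = (α, β, γ, δ) ∨ (α', β', γ', δ') = (-α, -β, -γ, -δ) := by
  have c1 : (α * γ' - α' * γ) * y1 ^ 2 + (α * δ' + β * γ' - α' * δ - β' * γ) * y1 + (β * δ' - β' * δ) = 0 := by
    linear_combination (γ * y1 + δ) * b1 - (γ' * y1 + δ') * a1
  have c2 : (α * γ' - α' * γ) * y2 ^ 2 + (α * δ' + β * γ' - α' * δ - β' * γ) * y2 + (β * δ' - β' * δ) = 0 := by
    linear_combination (γ * y2 + δ) * b2 - (γ' * y2 + δ') * a2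
  have c3 : (α * γ' - α' * γ) * y3 ^ 2 + (α * δ' + β * γ' - α' * δ - β' * γ) * y3 + (β * δ' - β' * δ) = 0 := by
    linear_combination (γ * y3 + δ) * b3 - (γ' * y3 + δ') * a3
  have quad : ∀ q2 q1 q0 : F, q2 * y1 ^ 2 + q1 * y1 + q0 = 0 → q2 * y2 ^ 2 + q1 * y2 + q0 = 0 →
      q2 * y3 ^ 2 + q1 * y3 + q0 = 0 → q2 = 0 ∧ q1 = 0 ∧ q0 = 0 := by
    intro q2 q1 q0 u1 u2 u3
    have v1 : q2 * (y1 + y2) + q1 = 0 := by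
      apply mul_left_cancel₀ (sub_ne_zero.2 n12); linear_combination u1 - u2
    have v2 : q2 * (y1 + y3) + q1 = 0 := by
      apply mul_left_cancel₀ (sub_ne_zero.2 n13); linear_combination u1 - u3
    have w : q2 = 0 := by
      apply mul_left_cancel₀ (sub_ne_zero.2 n23); linear_combination v1 - v2
    subst w
    have w1 : q1 = 0 := by linear_combination v1
    subst w1
    exact ⟨rfl, rfl, by linear_combination u1⟩
  obtain ⟨d2, d1, d0⟩ := quad _ _ _ c1 c2 c3
  obtain ⟨ν, hν⟩ : ∃ ν, ν = α * δ' - γ * β' := ⟨_, rfl⟩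
  have hα : α' = ν * α := by rw [hν]; linear_combination (-α') * h + β * d2 - α * d1
  have hβ : β' = ν * β := by rw [hν]; linear_combination (-β') * h - α * d0
  have hγ : γ' = ν * γ := by rw [hν]; linear_combination (-γ') * h + δ * d2 - γ * d1
  have hδ : δ' = ν * δ := by rw [hν]; linear_combination (-δ') * h - γ * d0
  have hν2 : ν * ν = 1 := by
    rw [hα, hβ, hγ, hδ] at h'
    linear_combination h' - ν * ν * h
  rcases mul_self_eq_one_iff.1 hν2 with e | e
  · left; rw [hα, hβ, hγ, hδ, e]; simp
  · right; rw [hα, hβ, hγ, hδ, e]; simp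

open Classical in
lemma cubic_bound {F : Type*} [Field F] (Ks : Finset (F × F × F × F))
    (hK : ∀ k ∈ Ks, k.1 * k.2.2.2 - k.2.1 * k.2.2.1 = 1) (P : Finset (F × F)) :
    ∑ k ∈ Ks, ((P.filter fun q => mrel k q).card).choose 3 ≤ 2 * P.card ^ 3 := by
  have e1 : ∀ k ∈ Ks, ((P.filter fun q => mrel k q).card).choose 3 =
      (Finset.bipartiteAbove (fun k (U : Finset (F × F)) => ∀ q ∈ U, mrel k q) (P.powersetCard 3) k).card := by
    intro k _
    rw [← Finset.card_powersetCard]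
    congr 1
    ext U
    simp only [Finset.mem_powersetCard, Finset.bipartiteAbove, Finset.mem_filter]
    constructor
    · rintro ⟨h1, h2⟩
      exact ⟨⟨fun x hx => (Finset.mem_filter.1 (h1 hx)).1, h2⟩, fun x hx => (Finset.mem_filter.1 (h1 hx)).2⟩
    · rintro ⟨⟨h1, h2⟩, h3⟩
      exact ⟨fun x hx => Finset.mem_filter.2 ⟨h1 hx, h3 x hx⟩, h2⟩
  rw [Finset.sum_congr rfl e1, Finset.sum_card_bipartiteAbove_eq_sum_card_bipartiteBelow]
  have e2 : ∀ U ∈ P.powersetCard 3,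
      (Finset.bipartiteBelow (fun k (U : Finset (F × F)) => ∀ q ∈ U, mrel k q) Ks U).card ≤ 2 := by
    intro U hU
    obtain ⟨⟨y1, z1⟩, ⟨y2, z2⟩, ⟨y3, z3⟩, n12, n13, n23, rfl⟩ := Finset.card_eq_three.1 (Finset.mem_powersetCard.1 hU).2
    rcases Finset.eq_empty_or_nonempty (Finset.bipartiteBelow (fun k (U : Finset (F × F)) => ∀ q ∈ U, mrel k q) Ks
      {(y1, z1), (y2, z2), (y3, z3)}) with h | ⟨⟨α, β, γ, δ⟩, hk⟩
    · rw [h]; simp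
    · have sub : Finset.bipartiteBelow (fun k (U : Finset (F × F)) => ∀ q ∈ U, mrel k q) Ks
          {(y1, z1), (y2, z2), (y3, z3)} ⊆ {(α, β, γ, δ), (-α, -β, -γ, -δ)} := by
        rintro ⟨α', β', γ', δ'⟩ hk'
        simp only [Finset.bipartiteBelow, Finset.mem_filter, Finset.mem_insert, Finset.mem_singleton,
          forall_eq_or_imp, forall_eq, mrel] at hk hk'
        obtain ⟨m, a1, a2, a3⟩ := hk
        obtain ⟨m', b1, b2, b3⟩ := hk'
        have d := hK _ m
        have d' := hK _ m'
        simp only at d d'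
        have hne : ∀ y z z' : F, z * (γ * y + δ) = α * y + β → z' * (γ * y + δ) = α * y + β → z = z' := by
          intro y z z' u u'
          have h0 : γ * y + δ ≠ 0 := by
            intro h0
            rw [h0, mul_zero] at u
            have : (1:F) = 0 := by
              rw [← d]; linear_combination α * h0 + γ * u
            exact one_ne_zero this
          exact mul_right_cancel₀ h0 (u.trans u'.symm)
        have m12 : y1 ≠ y2 := by rintro rfl; exact n12 (by rw [hne _ _ _ a1 a2])
        have m13 : y1 ≠ y3 := by rintro rfl; exact n13 (by rw [hne _ _ _ a1 a3])
        have m23 : y2 ≠ y3 := by rintro rfl; exact n23 (by rw [hne _ _ _ a2 a3])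
        simp only [Finset.mem_insert, Finset.mem_singleton]
        exact mrel_unique α β γ δ α' β' γ' δ' d d' y1 y2 y3 z1 z2 z3 m12 m13 m23 a1 a2 a3 b1 b2 b3
      exact (Finset.card_le_card sub).trans Finset.card_le_two
  calc _ ≤ (P.powersetCard 3).card • 2 := Finset.sum_le_card_nsmul _ _ _ e2
    _ = 2 * P.card.choose 3 := by rw [Finset.card_powersetCard, smul_eq_mul, mul_comm]
    _ ≤ 2 * P.card ^ 3 := by gcongr; exact Nat.choose_le_pow _ _

/-- differences of an interval -/
noncomputable def sd (p N : ℕ) : Finset (ZMod p) :=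
  (Finset.Ioo (-(N:ℤ)) N).image (fun z : ℤ => (z : ZMod p))

lemma sd_card (p N : ℕ) : (sd p N).card ≤ 2 * N := by
  refine Finset.card_image_le.trans ?_
  rw [Int.card_Ioo]; omega

lemma sub_mem_sd (p N : ℕ) (u b b' : ZMod p) (hb : b ∈ apF p u N) (hb' : b' ∈ apF p u N) :
    b - b' ∈ sd p N := by
  simp only [apF, sd, Finset.mem_image, Finset.mem_Icc, Finset.mem_Ioo] at *
  obtain ⟨i, hi, rfl⟩ := hb
  obtain ⟨j, hj, rfl⟩ := hb'
  exact ⟨(i:ℤ) - j, by omega, by push_cast; ring⟩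

lemma apF_card (p N : ℕ) (u : ZMod p) (hN : N ≤ p) : (apF p u N).card = N := by
  rw [apF, Finset.card_image_of_injOn]
  · simp
  · intro i hi j hj h
    simp only [Finset.coe_Icc, Set.mem_Icc] at hi hj
    have h1 : ((i:ℤ) : ZMod p) = ((j:ℤ) : ZMod p) := by
      have := add_left_cancel h
      exact_mod_cast this
    rw [ZMod.intCast_eq_intCast_iff_dvd_sub] at h1
    have := Int.eq_zero_of_abs_lt_dvd h1 (by rw [abs_lt]; omega)
    omega

noncomputable def Eset (p M N : ℕ) : Finset ((ZMod p × ZMod p) × (ZMod p × ZMod p)) :=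
  ((sd p M ×ˢ sd p M) ×ˢ (sd p N ×ˢ sd p N)).filter
    fun q => (q.1.1 ≠ 0 ∧ q.1.2 ≠ 0) ∧ (q.2.1 ≠ 0 ∧ q.2.2 ≠ 0) ∧ q.1.1 * q.2.1 = q.1.2 * q.2.2

lemma Eset_card_le (p M N : ℕ) : (Eset p M N).card ≤ (eset p M N).card := by
  have : Eset p M N ⊆ (eset p M N).image
      (fun q => (((q.1.1 : ZMod p), (q.1.2 : ZMod p)), ((q.2.1 : ZMod p), (q.2.2 : ZMod p)))) := by
    rintro ⟨⟨w, w'⟩, t, t'⟩ h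
    simp only [Eset, sd, Finset.mem_filter, Finset.mem_product, Finset.mem_image] at h
    obtain ⟨⟨⟨⟨w, hw, rfl⟩, ⟨w', hw', rfl⟩⟩, ⟨t, ht, rfl⟩, ⟨t', ht', rfl⟩⟩, ⟨h1, h2⟩, -, h3⟩ := h
    rw [Finset.mem_image]
    refine ⟨((w, w'), (t, t')), ?_, rfl⟩
    simp only [eset, Finset.mem_filter, Finset.mem_product]
    refine ⟨⟨⟨hw, hw'⟩, ht, ht'⟩, ?_, ?_, ?_⟩
    · rintro rfl; simp at h1
    · rintro rfl; simp at h2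
    · rw [← ZMod.intCast_zmod_eq_zero_iff_dvd]
      push_cast
      rw [h3, sub_self]
  exact (Finset.card_le_card this).trans Finset.card_image_le

lemma Eset_swap (p M N : ℕ) : (Eset p M N).card ≤ (Eset p N M).card := by
  apply Finset.card_le_card_of_injOn Prod.swap
  · rintro ⟨⟨w, w'⟩, t, t'⟩ h
    simp only [Eset, Finset.coe_filter, Finset.mem_product, Set.mem_ofPred_eq, Prod.swap] at h ⊢
    obtain ⟨⟨h1, h2⟩, h3, h4, h5⟩ := h
    exact ⟨⟨h2, h1⟩, h4, h3, by rw [mul_comm, h5, mul_comm]⟩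
  · exact Prod.swap_injective.injOn

lemma Eset_bound (p M N : ℕ) (hp : p.Prime) (hp3 : 3 ≤ p) (hMp : M ≤ p) (hNp : N ≤ p) :
    ((Eset p M N).card : ℝ) ≤ 288 * Real.log p * (M * N + (M * N : ℝ)^2 / p) := by
  rcases le_total M N with h | h
  · exact le_trans (by exact_mod_cast Eset_card_le p M N) (eset_count p M N hp hp3 h hMp)
  · refine le_trans (b := ((eset p N M).card : ℝ)) ?_ ?_
    · exact_mod_cast (Eset_swap p M N).trans (Eset_card_le p N M)
    · rw [mul_comm (M:ℝ) N]
      exact eset_count p N M hp hp3 h hNp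

/-- matrix of the word -/
def gkey {F : Type*} [Field F] (mu : F) (x : F × F × F × F) : F × F × F × F :=
  (1 + mu * x.2.1 * x.1 - x.2.2.2 * (mu * (x.2.2.1 + x.1 * (1 + mu * x.2.2.1 * x.2.1))),
   x.2.1 - x.2.2.2 * (1 + mu * x.2.2.1 * x.2.1),
   mu * (x.2.2.1 + x.1 * (1 + mu * x.2.2.1 * x.2.1)),
   1 + mu * x.2.2.1 * x.2.1)

noncomputable def Omg (p M N : ℕ) (B : Finset (ZMod p)) : Finset (ZMod p × ZMod p × ZMod p × ZMod p) :=
  sd p M ×ˢ ((sd p N).erase 0 ×ˢ ((sd p M).erase 0 ×ˢ B))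

lemma Omg_card (p M N : ℕ) (B : Finset (ZMod p)) (hB : B.card = N) :
    (Omg p M N B).card ≤ 8 * (M * N) ^ 2 := by
  simp only [Omg, Finset.card_product, hB]
  have h1 := sd_card p M
  have h2 : ((sd p M).erase 0).card ≤ 2 * M := (Finset.card_erase_le).trans (sd_card p M)
  have h3 : ((sd p N).erase 0).card ≤ 2 * N := (Finset.card_erase_le).trans (sd_card p N)
  calc _ ≤ (2 * M) * ((2 * N) * ((2 * M) * N)) := by gcongr
    _ = _ := by ring

lemma energy_bound (p M N : ℕ) [Fact p.Prime] (B : Finset (ZMod p)) (hB : B.card = N) (mu : ZMod p)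
    (hmu : mu ≠ 0) :
    (((Omg p M N B) ×ˢ (Omg p M N B)).filter fun q => gkey mu q.1 = gkey mu q.2).card ≤
      (Eset p M N).card * (2 * M * N) + 4 * (M * N) ^ 2 := by
  set S := ((Omg p M N B) ×ˢ (Omg p M N B)).filter fun q => gkey mu q.1 = gkey mu q.2 with hS
  rw [← Finset.card_filter_add_card_filter_not (s := S)
    (fun q => 1 + mu * q.1.2.2.1 * q.1.2.1 ≠ 0)]
  apply add_le_add
  · have : (S.filter (fun q => 1 + mu * q.1.2.2.1 * q.1.2.1 ≠ 0)).card ≤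
      (Eset p M N ×ˢ (sd p M ×ˢ B)).card := by
      apply Finset.card_le_card_of_injOn
        (fun q => (((q.1.2.2.1, q.2.2.2.1), (q.1.2.1, q.2.2.1)), (q.1.1, q.1.2.2.2)))
      · rintro ⟨⟨s, t, w, b⟩, ⟨s', t', w', b'⟩⟩ h
        simp only [hS, Omg, gkey, Finset.coe_filter, Finset.mem_filter, Finset.mem_product, Set.mem_ofPred_eq,
          Finset.mem_erase, Prod.mk.injEq] at h
        obtain ⟨⟨⟨⟨hs, ⟨ht0, ht⟩, ⟨hw0, hw⟩, hb⟩, ⟨hs', ⟨ht0', ht'⟩, ⟨hw0', hw'⟩, hb'⟩⟩, -, -, -, hd⟩, hne⟩ := h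
        simp only [Eset, Finset.coe_product, Set.mem_prod, Finset.mem_coe, Finset.mem_filter, Finset.mem_product]
        refine ⟨⟨⟨⟨hw, hw'⟩, ht, ht'⟩, ⟨hw0, hw0'⟩, ⟨ht0, ht0'⟩, ?_⟩, hs, hb⟩
        apply mul_left_cancel₀ hmu
        linear_combination hd
      · rintro ⟨⟨s, t, w, b⟩, ⟨s', t', w', b'⟩⟩ h ⟨⟨s1, t1, w1, b1⟩, ⟨s1', t1', w1', b1'⟩⟩ h1 e
        simp only [hS, Omg, gkey, Finset.coe_filter, Finset.mem_filter, Finset.mem_product, Set.mem_ofPred_eq,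
          Finset.mem_erase, Prod.mk.injEq] at h h1 e
        obtain ⟨⟨⟨rfl, rfl⟩, ⟨rfl, rfl⟩⟩, rfl, rfl⟩ := e
        obtain ⟨⟨-, ha, hb, hg, hd⟩, hne⟩ := h
        obtain ⟨⟨-, ha1, hb1, hg1, hd1⟩, -⟩ := h1
        rw [hd] at hne
        have e1 : b' = b1' := by
          apply mul_right_cancel₀ hne
          linear_combination hb - hb1
        have e2 : s' = s1' := by
          apply mul_right_cancel₀ hne
          apply mul_left_cancel₀ hmu
          linear_combination hg1 - hg
        rw [e1, e2]
    refine this.trans ?_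
    rw [Finset.card_product, Finset.card_product, hB]
    have := sd_card p M
    gcongr
  · have : (S.filter (fun q => ¬ (1 + mu * q.1.2.2.1 * q.1.2.1 ≠ 0))).card ≤
      (sd p M ×ˢ (sd p M ×ˢ (B ×ˢ B))).card := by
      apply Finset.card_le_card_of_injOn
        (fun q => (q.1.2.2.1, q.1.1, q.1.2.2.2, q.2.2.2.2))
      · rintro ⟨⟨s, t, w, b⟩, ⟨s', t', w', b'⟩⟩ h
        simp only [hS, Omg, gkey, Finset.coe_filter, Finset.mem_filter, Finset.mem_product, Set.mem_ofPred_eq,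
          Finset.mem_erase, Prod.mk.injEq] at h
        obtain ⟨⟨⟨⟨hs, ⟨ht0, ht⟩, ⟨hw0, hw⟩, hb⟩, ⟨hs', ⟨ht0', ht'⟩, ⟨hw0', hw'⟩, hb'⟩⟩, -, -, -, hd⟩, hne⟩ := h
        simp only [Finset.coe_product, Set.mem_prod, Finset.mem_coe]
        exact ⟨hw, hs, hb, hb'⟩
      · rintro ⟨⟨s, t, w, b⟩, ⟨s', t', w', b'⟩⟩ h ⟨⟨s1, t1, w1, b1⟩, ⟨s1', t1', w1', b1'⟩⟩ h1 e
        simp only [hS, Omg, gkey, Finset.coe_filter, Finset.mem_filter, Finset.mem_product, Set.mem_ofPred_eq,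
          Finset.mem_erase, Prod.mk.injEq, not_not] at h h1 e
        obtain ⟨rfl, rfl, rfl, rfl⟩ := e
        obtain ⟨⟨⟨⟨-, ⟨ht0, -⟩, ⟨hw0, -⟩, -⟩, ⟨-, ⟨ht0', -⟩, ⟨hw0', -⟩, -⟩⟩, ha, hb, hg, hd⟩, h0⟩ := h
        obtain ⟨⟨⟨⟨-, ⟨u0, -⟩, ⟨v0, -⟩, -⟩, ⟨-, ⟨u0', -⟩, ⟨v0', -⟩, -⟩⟩, ha1, hb1, hg1, hd1⟩, h01⟩ := h1
        have h0' := hd.symm.trans h0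
        have h01' := hd1.symm.trans h01
        have et : t = t1 := by
          apply mul_left_cancel₀ (mul_ne_zero hmu hw0)
          linear_combination h0 - h01
        subst et
        rw [h0, h0'] at hb hg ha
        rw [h01, h01'] at hb1 hg1 ha1
        have e1 : t' = t := by linear_combination -hb
        have e2 : t1' = t := by linear_combination -hb1
        have e3 : w' = w := by apply mul_left_cancel₀ hmu; linear_combination -hg
        have e4 : w1' = w := by apply mul_left_cancel₀ hmu; linear_combination -hg1
        subst e1 e3
        subst e2 e4
        have e5 : s' = s1' := by
          apply mul_left_cancel₀ (mul_ne_zero hmu ht0)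
          linear_combination ha1 - ha
        rw [e5]
    refine this.trans ?_
    rw [Finset.card_product, Finset.card_product, Finset.card_product, hB]
    have := sd_card p M
    calc _ ≤ (2 * M) * ((2 * M) * (N * N)) := by gcongr
      _ = _ := by ring

open Classical in
lemma cs_count {X Y : Type*} (S : Finset X) (U : Finset Y) (r : X → Y → Prop) :
    ((S ×ˢ U).filter fun q => r q.1 q.2).card ^ 2 ≤
      S.card * ((S ×ˢ (U ×ˢ U)).filter fun q => r q.1 q.2.1 ∧ r q.1 q.2.2).card := by
  have e1 : ((S ×ˢ U).filter fun q => r q.1 q.2).card = ∑ x ∈ S, (U.filter (r x)).card := by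
    simp only [Finset.card_filter, Finset.sum_product]
  have e2 : ((S ×ˢ (U ×ˢ U)).filter fun q => r q.1 q.2.1 ∧ r q.1 q.2.2).card =
      ∑ x ∈ S, (U.filter (r x)).card ^ 2 := by
    rw [Finset.card_filter, Finset.sum_product]
    apply Finset.sum_congr rfl
    intro x _
    rw [← Finset.card_filter, sq, ← Finset.card_product]
    congr 1
    ext ⟨a, b⟩
    simp only [Finset.mem_filter, Finset.mem_product]
    tauto
  rw [e1, e2]
  exact sq_sum_le_card_mul_sum_sq

section
variable {p : ℕ} [Fact p.Prime]

abbrev Y2 (p : ℕ) := ZMod p × (ZMod p × ZMod p) × (ZMod p × ZMod p) × ZMod p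

def r1 (lam d : ZMod p) (y : (ZMod p × ZMod p) × ZMod p) : Prop :=
  (y.1.1 + y.1.2) * (y.2 + d) = lam

def r2 (lam : ZMod p) (x : ZMod p) (y : Y2 p) : Prop :=
  (x + y.2.1.1) * (y.2.1.2 + y.1) = lam ∧ (y.2.2.1.1 + y.2.2.1.2) * (y.2.2.2 + y.1) = lam

open Classical in
noncomputable def Kset (lam : ZMod p) (A B C D : Finset (ZMod p)) : Finset (ZMod p × Y2 p × Y2 p) :=
  (A ×ˢ ((D ×ˢ ((B ×ˢ C) ×ˢ ((A ×ˢ B) ×ˢ C))) ×ˢ (D ×ˢ ((B ×ˢ C) ×ˢ ((A ×ˢ B) ×ˢ C))))).filter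
    fun q => r2 lam q.1 q.2.1 ∧ r2 lam q.1 q.2.2

lemma hyp_fourth (lam : ZMod p) (A B C D : Finset (ZMod p)) :
    hypCount p lam A B C D ^ 4 ≤ D.card ^ 2 * A.card * (Kset lam A B C D).card := by
  classical
  have h1 : hypCount p lam A B C D ≤ ((D ×ˢ ((A ×ˢ B) ×ˢ C)).filter fun q => r1 lam q.1 q.2).card := by
    rw [hypCount]
    apply Finset.card_le_card_of_injOn (fun q => (q.2.2, (q.1, q.2.1)))
    · rintro ⟨⟨a, b⟩, c, d⟩ h
      simp only [Finset.coe_filter, Finset.mem_product, Set.mem_ofPred_eq] at h ⊢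
      simp only [r1] at h ⊢
      tauto
    · rintro ⟨⟨a, b⟩, c, d⟩ _ ⟨⟨a, b⟩, c, d⟩ _ h
      simp only [Prod.mk.injEq] at h ⊢
      tauto
  have h2 := cs_count D ((A ×ˢ B) ×ˢ C) (r1 lam)
  have h3 : ((D ×ˢ (((A ×ˢ B) ×ˢ C) ×ˢ ((A ×ˢ B) ×ˢ C))).filter fun q => r1 lam q.1 q.2.1 ∧ r1 lam q.1 q.2.2).card ≤
      ((A ×ˢ (D ×ˢ ((B ×ˢ C) ×ˢ ((A ×ˢ B) ×ˢ C)))).filter fun q => r2 lam q.1 q.2).card := by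
    apply Finset.card_le_card_of_injOn
      (fun q => (q.2.1.1.1, (q.1, (q.2.1.1.2, q.2.1.2), q.2.2)))
    · rintro ⟨d, ⟨⟨a, b⟩, c⟩, ⟨⟨a', b'⟩, c'⟩⟩ h
      simp only [Finset.coe_filter, Finset.mem_product, Set.mem_ofPred_eq] at h ⊢
      simp only [r1, r2] at h ⊢
      tauto
    · rintro ⟨d, ⟨⟨a, b⟩, c⟩, ⟨⟨a', b'⟩, c'⟩⟩ _ ⟨d, ⟨⟨a, b⟩, c⟩, ⟨⟨a', b'⟩, c'⟩⟩ _ h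
      simp only [Prod.mk.injEq] at h ⊢
      tauto
  have h4 := cs_count A (D ×ˢ ((B ×ˢ C) ×ˢ ((A ×ˢ B) ×ˢ C))) (r2 lam)
  calc hypCount p lam A B C D ^ 4 = (hypCount p lam A B C D ^ 2) ^ 2 := by ring
    _ ≤ (((D ×ˢ ((A ×ˢ B) ×ˢ C)).filter fun q => r1 lam q.1 q.2).card ^ 2) ^ 2 := by gcongr
    _ ≤ (D.card * ((A ×ˢ (D ×ˢ ((B ×ˢ C) ×ˢ ((A ×ˢ B) ×ˢ C)))).filter fun q => r2 lam q.1 q.2).card) ^ 2 := by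
      gcongr
      exact h2.trans (Nat.mul_le_mul_left _ h3)
    _ = D.card ^ 2 * ((A ×ˢ (D ×ˢ ((B ×ˢ C) ×ˢ ((A ×ˢ B) ×ˢ C)))).filter fun q => r2 lam q.1 q.2).card ^ 2 := by
      ring
    _ ≤ D.card ^ 2 * (A.card * (Kset lam A B C D).card) := Nat.mul_le_mul_left _ h4
    _ = _ := by ring

lemma ccl {lam a x y : ZMod p} (hl : lam ≠ 0) (h1 : a * x = lam) (h2 : a * y = lam) : x = y := by
  have : a ≠ 0 := by rintro rfl; simp at h1; exact hl h1.symm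
  exact mul_left_cancel₀ this (h1.trans h2.symm)

lemma ccr {lam a x y : ZMod p} (hl : lam ≠ 0) (h1 : x * a = lam) (h2 : y * a = lam) : x = y := by
  have : a ≠ 0 := by rintro rfl; simp at h1; exact hl h1.symm
  exact mul_right_cancel₀ this (h1.trans h2.symm)

lemma Kset_t0 (lam : ZMod p) (hl : lam ≠ 0) (A B C D : Finset (ZMod p)) :
    ((Kset lam A B C D).filter fun q => q.2.1.2.1.1 = q.2.2.2.1.1).card ≤
      (B.card * C.card) ^ 3 * A.card ^ 2 := by
  have : ((Kset lam A B C D).filter fun q => q.2.1.2.1.1 = q.2.2.2.1.1).card ≤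
      ((B ×ˢ B ×ˢ B) ×ˢ (C ×ˢ C ×ˢ C) ×ˢ (A ×ˢ A)).card := by
    apply Finset.card_le_card_of_injOn (fun q =>
      ((q.2.1.2.1.1, q.2.1.2.2.1.2, q.2.2.2.2.1.2), (q.2.1.2.1.2, q.2.1.2.2.2, q.2.2.2.1.2),
        (q.2.1.2.2.1.1, q.2.2.2.2.1.1)))
    · rintro ⟨x, ⟨d1, ⟨b1, c1⟩, ⟨a1, e1⟩, f1⟩, ⟨d2, ⟨b2, c2⟩, ⟨a2, e2⟩, f2⟩⟩ h
      simp only [Kset, Finset.coe_filter, Finset.coe_product, Set.mem_prod, Finset.mem_coe, Finset.mem_filter, Finset.mem_product, Set.mem_ofPred_eq] at h ⊢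
      tauto
    · rintro ⟨x, ⟨d1, ⟨b1, c1⟩, ⟨a1, e1⟩, f1⟩, ⟨d2, ⟨b2, c2⟩, ⟨a2, e2⟩, f2⟩⟩ h
        ⟨x', ⟨d1', ⟨b1', c1'⟩, ⟨a1', e1'⟩, f1'⟩, ⟨d2', ⟨b2', c2'⟩, ⟨a2', e2'⟩, f2'⟩⟩ h' e
      simp only [Kset, Finset.coe_filter, Finset.mem_filter, Set.mem_ofPred_eq, Prod.mk.injEq] at h h' e
      simp only [r2] at h h'
      obtain ⟨⟨rfl, rfl, rfl⟩, ⟨rfl, rfl, rfl⟩, ⟨rfl, rfl⟩⟩ := e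
      obtain ⟨⟨-, ⟨h1, h2⟩, h3, h4⟩, rfl⟩ := h
      obtain ⟨⟨-, ⟨h1', h2'⟩, h3', h4'⟩, rfl⟩ := h'
      obtain rfl := add_left_cancel (ccl hl h2 h2')
      obtain rfl := add_right_cancel (ccr hl h1 h1')
      obtain rfl := add_left_cancel (ccl hl h3 h3')
      obtain rfl := add_right_cancel (ccl hl h4 h4')
      rfl
  refine this.trans (le_of_eq ?_)
  simp only [Finset.card_product]; ring

lemma Kset_w0 (lam : ZMod p) (hl : lam ≠ 0) (A B C D : Finset (ZMod p)) :
    ((Kset lam A B C D).filter fun q => q.2.2.2.2.2 = q.2.2.2.1.2).card ≤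
      (B.card * C.card) ^ 3 * A.card ^ 2 := by
  have : ((Kset lam A B C D).filter fun q => q.2.2.2.2.2 = q.2.2.2.1.2).card ≤
      ((B ×ˢ B ×ˢ B) ×ˢ (C ×ˢ C ×ˢ C) ×ˢ (A ×ˢ A)).card := by
    apply Finset.card_le_card_of_injOn (fun q =>
      ((q.2.1.2.1.1, q.2.1.2.2.1.2, q.2.2.2.1.1), (q.2.1.2.1.2, q.2.1.2.2.2, q.2.2.2.1.2),
        (q.2.1.2.2.1.1, q.2.2.2.2.1.1)))
    · rintro ⟨x, ⟨d1, ⟨b1, c1⟩, ⟨a1, e1⟩, f1⟩, ⟨d2, ⟨b2, c2⟩, ⟨a2, e2⟩, f2⟩⟩ h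
      simp only [Kset, Finset.coe_filter, Finset.coe_product, Set.mem_prod, Finset.mem_coe, Finset.mem_filter, Finset.mem_product, Set.mem_ofPred_eq] at h ⊢
      tauto
    · rintro ⟨x, ⟨d1, ⟨b1, c1⟩, ⟨a1, e1⟩, f1⟩, ⟨d2, ⟨b2, c2⟩, ⟨a2, e2⟩, f2⟩⟩ h
        ⟨x', ⟨d1', ⟨b1', c1'⟩, ⟨a1', e1'⟩, f1'⟩, ⟨d2', ⟨b2', c2'⟩, ⟨a2', e2'⟩, f2'⟩⟩ h' e
      simp only [Kset, Finset.coe_filter, Finset.mem_filter, Set.mem_ofPred_eq, Prod.mk.injEq] at h h' e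
      simp only [r2] at h h'
      obtain ⟨⟨rfl, rfl, rfl⟩, ⟨rfl, rfl, rfl⟩, ⟨rfl, rfl⟩⟩ := e
      obtain ⟨⟨-, ⟨h1, h2⟩, h3, h4⟩, rfl⟩ := h
      obtain ⟨⟨-, ⟨h1', h2'⟩, h3', h4'⟩, rfl⟩ := h'
      obtain rfl := add_left_cancel (ccl hl h2 h2')
      obtain rfl := add_right_cancel (ccr hl h1 h1')
      obtain rfl := add_left_cancel (ccl hl h3 h3')
      obtain rfl := add_left_cancel (ccr hl h4 h4')
      rfl
  refine this.trans (le_of_eq ?_)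
  simp only [Finset.card_product]; ring

lemma word_rel (lam mu y E X s t w Z z : ZMod p) (hmu : mu * lam = 1)
    (h1 : y * E = lam) (h2 : X * (E + s) = lam) (h3 : (X + t) * Z = lam) (h4 : z * (Z + w) = lam) :
    z * (mu * (w + s * (1 + mu * w * t)) * y + (1 + mu * w * t)) = (1 + mu * t * s) * y + t := by
  have i : X * (1 + mu * s * y) = y := by
    linear_combination (mu * y) * h2 - (mu * X) * h1 + (y - X) * hmu
  have j : mu * (X + t) * Z = 1 := by linear_combination mu * h3 + hmu
  have n : (1 + mu * t * s) * y + t = (X + t) * (1 + mu * s * y) := by linear_combination -i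
  have dd : mu * (w + s * (1 + mu * w * t)) * y + (1 + mu * w * t) =
      (1 + mu * s * y) * (mu * (X + t) * (Z + w)) := by
    linear_combination (-mu * w) * i - (1 + mu * s * y) * j
  rw [n, dd]
  linear_combination ((1 + mu * s * y) * mu * (X + t)) * h4 + ((1 + mu * s * y) * (X + t)) * hmu

open Classical in
noncomputable def Tcnt (A : Finset (ZMod p)) (e : ZMod p) (k : ZMod p × ZMod p × ZMod p × ZMod p) :
    Finset (ZMod p × ZMod p) :=
  ((A.image fun a => a + e) ×ˢ A).filter fun q => mrel k q

lemma Kset_main (lam : ZMod p) (hl : lam ≠ 0) (A D : Finset (ZMod p)) (u v : ZMod p) (N M : ℕ) :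
    ((Kset lam A (apF p u N) (apF p v M) D).filter fun q =>
      ¬ q.2.1.2.1.1 = q.2.2.2.1.1 ∧ ¬ q.2.2.2.2.2 = q.2.2.2.1.2).card ≤
      ((apF p u N).card * (apF p v M).card ^ 2) *
        ∑ e ∈ apF p u N, ∑ x ∈ Omg p M N (apF p u N), (Tcnt A e (gkey lam⁻¹ x)).card := by
  set B := apF p u N with hB
  set C := apF p v M with hC
  let Tg : Finset (Σ _ : ZMod p, Σ _ : ZMod p × ZMod p × ZMod p × ZMod p, ZMod p × ZMod p) :=
    B.sigma fun e => (Omg p M N B).sigma fun x => Tcnt A e (gkey lam⁻¹ x)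
  have : ((Kset lam A B C D).filter fun q =>
      ¬ q.2.1.2.1.1 = q.2.2.2.1.1 ∧ ¬ q.2.2.2.2.2 = q.2.2.2.1.2).card ≤
      ((B ×ˢ C ×ˢ C) ×ˢ Tg).card := by
    apply Finset.card_le_card_of_injOn (fun q =>
      ((q.2.1.2.1.1, q.2.1.2.1.2, q.2.2.2.1.2),
        ⟨q.2.1.2.2.1.2, (q.2.1.2.1.2 - q.2.1.2.2.2, q.2.2.2.1.1 - q.2.1.2.1.1,
          q.2.2.2.2.2 - q.2.2.2.1.2, q.2.2.2.2.1.2),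
          (q.2.1.2.2.1.1 + q.2.1.2.2.1.2, q.2.2.2.2.1.1)⟩))
    · rintro ⟨x, ⟨d1, ⟨b1, c1⟩, ⟨a1, e1⟩, f1⟩, ⟨d2, ⟨b2, c2⟩, ⟨a2, e2⟩, f2⟩⟩ h
      simp only [Kset, Finset.coe_filter, Finset.mem_filter, Finset.mem_product, Set.mem_ofPred_eq] at h
      simp only [r2] at h
      obtain ⟨⟨⟨hx, ⟨hd1, ⟨hb1, hc1⟩, ⟨ha1, he1⟩, hf1⟩, ⟨hd2, ⟨hb2, hc2⟩, ⟨ha2, he2⟩, hf2⟩⟩,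
        ⟨h1, h2⟩, h3, h4⟩, ht, hw⟩ := h
      simp only [Tg, Omg, Tcnt, Finset.coe_product, Set.mem_prod, Finset.mem_coe, Finset.mem_sigma,
        Finset.mem_product, Finset.mem_erase, Finset.mem_filter]
      refine ⟨⟨hb1, hc1, hc2⟩, he1, ⟨sub_mem_sd p M v _ _ hc1 hf1,
        ⟨sub_ne_zero.2 (Ne.symm ht), sub_mem_sd p N u _ _ hb2 hb1⟩,
        ⟨sub_ne_zero.2 hw, sub_mem_sd p M v _ _ hf2 hc2⟩, he2⟩,
        ⟨Finset.mem_image_of_mem _ ha1, ha2⟩, ?_⟩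
      have h := word_rel lam lam⁻¹ (a1 + e1) (f1 + d1) (x + b1) (c1 - f1) (b2 - b1) (f2 - c2) (c2 + d2)
        (a2 + e2) (inv_mul_cancel₀ hl) h2 (by linear_combination h1) (by linear_combination h3)
        (by linear_combination h4)
      simp only [mrel, gkey]
      linear_combination h
    · rintro ⟨x, ⟨d1, ⟨b1, c1⟩, ⟨a1, e1⟩, f1⟩, ⟨d2, ⟨b2, c2⟩, ⟨a2, e2⟩, f2⟩⟩ h
        ⟨x', ⟨d1', ⟨b1', c1'⟩, ⟨a1', e1'⟩, f1'⟩, ⟨d2', ⟨b2', c2'⟩, ⟨a2', e2'⟩, f2'⟩⟩ h' e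
      simp only [Kset, Finset.coe_filter, Finset.mem_filter, Set.mem_ofPred_eq, Prod.mk.injEq,
        Sigma.mk.injEq, heq_eq_eq] at h h' e
      simp only [r2] at h h'
      obtain ⟨⟨rfl, rfl, rfl⟩, rfl, ⟨e3, e4, e5, rfl⟩, e6, rfl⟩ := e
      obtain rfl := sub_right_injective e3
      obtain rfl := sub_left_injective e4
      obtain rfl := sub_left_injective e5
      obtain rfl := add_right_cancel e6
      obtain ⟨⟨-, ⟨h1, h2⟩, h3, h4⟩, -⟩ := h
      obtain ⟨⟨-, ⟨h1', h2'⟩, h3', h4'⟩, -⟩ := h'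
      obtain rfl := add_left_cancel (ccl hl h2 h2')
      obtain rfl := add_right_cancel (ccr hl h1 h1')
      obtain rfl := add_left_cancel (ccl hl h3 h3')
      rfl
  refine this.trans (le_of_eq ?_)
  simp only [Finset.card_product, Tg, Finset.card_sigma]; ring

end

lemma gkey_det {F : Type*} [Field F] (mu : F) (x : F × F × F × F) :
    (gkey mu x).1 * (gkey mu x).2.2.2 - (gkey mu x).2.1 * (gkey mu x).2.2.1 = 1 := by
  simp only [gkey]; ring

lemma word_sum (p : ℕ) [Fact p.Prime] (hp3 : 3 ≤ p) (lam : ZMod p) (hl : lam ≠ 0) (A B : Finset (ZMod p))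
    (M N : ℕ) (hM : 1 ≤ M) (hN : 1 ≤ N) (hMp : M ≤ p) (hNp : N ≤ p) (hB : B.card = N) (hA : 1 ≤ A.card)
    (e : ZMod p) (m q : ℝ) (hm : 0 ≤ m) (hq : 0 ≤ q) (hmn : m ^ 6 = M * N) (hqn : q ^ 12 = M * N / p)
    (hL : 1 ≤ Real.log p) :
    ((∑ x ∈ Omg p M N B, (Tcnt A e (gkey lam⁻¹ x)).card : ℕ) : ℝ) ≤
      16 * m ^ 12 + 115 * Real.log p * m ^ 8 * (1 + q ^ 4) * A.card ^ 2 := by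
  classical
  have hp : p.Prime := Fact.out
  have hpr : (0:ℝ) < p := by have := hp.pos; positivity
  set L := Real.log p with hLdef
  have hn : (0:ℝ) < M * N := by
    have : (1:ℝ) ≤ M := by exact_mod_cast hM
    have : (1:ℝ) ≤ N := by exact_mod_cast hN
    positivity
  have hm6 : 0 < m ^ 6 := by rw [hmn]; exact hn
  have hA' : (1:ℝ) ≤ A.card := by exact_mod_cast hA
  have hE : ((Eset p M N).card : ℝ) ≤ 288 * L * (m ^ 6 + m ^ 6 * q ^ 12) := by
    have := Eset_bound p M N hp hp3 hMp hNp
    refine this.trans (le_of_eq ?_)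
    rw [hqn, hmn]; ring
  have key := main_sum (Omg p M N B) (gkey lam⁻¹) (fun k => (Tcnt A e k).card)
    (8 * m ^ 12) (580 * L * m ^ 12 * (1 + q ^ 12)) (2 * (A.card : ℝ) ^ 6) (by nlinarith) 
    (by have : 0 < m ^ 12 := by nlinarith
        positivity) (by positivity)
    (by
      have h : ((Omg p M N B).card : ℝ) ≤ 8 * (M * N) ^ 2 := by exact_mod_cast Omg_card p M N B hB
      rw [← hmn] at h
      linarith [h, (by ring : (m ^ 6) ^ 2 = m ^ 12)])
    (by
      have h := energy_bound p M N B hB lam⁻¹ (inv_ne_zero hl)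
      have h' : ((((Omg p M N B) ×ˢ (Omg p M N B)).filter fun q => gkey lam⁻¹ q.1 = gkey lam⁻¹ q.2).card : ℝ) ≤
        (Eset p M N).card * (2 * (M * N)) + 4 * (M * N) ^ 2 := by
        rw [mul_assoc] at h
        exact_mod_cast h
      rw [← hmn] at h'
      have e1 : ((Eset p M N).card : ℝ) * (2 * m ^ 6) ≤ 288 * L * (m ^ 6 + m ^ 6 * q ^ 12) * (2 * m ^ 6) := by
        gcongr
      have e2 : m ^ 12 ≤ L * m ^ 12 := le_mul_of_one_le_left (by positivity) hL
      have e3 : 0 ≤ L * m ^ 12 * q ^ 12 := by positivity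
      nlinarith)
    (by
      have h := cubic_bound ((Omg p M N B).image (gkey lam⁻¹)) (by
        intro k hk
        obtain ⟨x, _, rfl⟩ := Finset.mem_image.1 hk
        exact gkey_det _ _) ((A.image fun a => a + e) ×ˢ A)
      have h2 : ((A.image fun a => a + e) ×ˢ A).card ≤ A.card ^ 2 := by
        rw [Finset.card_product, sq]
        exact Nat.mul_le_mul_right _ Finset.card_image_le
      have h3 : ∑ k ∈ (Omg p M N B).image (gkey lam⁻¹), ((Tcnt A e k).card).choose 3 ≤ 2 * (A.card ^ 2) ^ 3 := by
        refine le_trans ?_ (h.trans (Nat.mul_le_mul_left _ (Nat.pow_le_pow_left h2 3)))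
        apply le_of_eq
        rfl
      have h4 : ((∑ k ∈ (Omg p M N B).image (gkey lam⁻¹), ((Tcnt A e k).card).choose 3 : ℕ) : ℝ) ≤
        2 * ((A.card : ℝ) ^ 2) ^ 3 := by exact_mod_cast h3
      rw [← pow_mul] at h4
      exact h4)
  refine key.trans ?_
  have hr : (8 * m ^ 12 * (580 * L * m ^ 12 * (1 + q ^ 12)) * (162 * (2 * (A.card : ℝ) ^ 6))) ^ ((1:ℝ)/3) ≤
      115 * L * m ^ 8 * (1 + q ^ 4) * A.card ^ 2 := by
    have h0 : 0 ≤ 115 * L * m ^ 8 * (1 + q ^ 4) * (A.card : ℝ) ^ 2 := by positivity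
    have h1 : 8 * m ^ 12 * (580 * L * m ^ 12 * (1 + q ^ 12)) * (162 * (2 * (A.card : ℝ) ^ 6)) ≤
        (115 * L * m ^ 8 * (1 + q ^ 4) * (A.card : ℝ) ^ 2) ^ (3:ℕ) := by
      have a1 : L ≤ L ^ 3 := le_self_pow₀ hL (by norm_num)
      have a2 : 1 + q ^ 12 ≤ (1 + q ^ 4) ^ 3 := by
        have : 0 ≤ q ^ 4 := by positivity
        nlinarith [sq_nonneg (q ^ 4)]
      calc _ = 1503360 * (m ^ 24 * (A.card : ℝ) ^ 6) * (L * (1 + q ^ 12)) := by ring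
        _ ≤ 1520875 * (m ^ 24 * (A.card : ℝ) ^ 6) * (L ^ 3 * (1 + q ^ 4) ^ 3) := by
          gcongr; norm_num
        _ = _ := by ring
    calc _ ≤ ((115 * L * m ^ 8 * (1 + q ^ 4) * (A.card : ℝ) ^ 2) ^ (3:ℕ)) ^ ((1:ℝ)/3) := by
          apply Real.rpow_le_rpow _ h1 (by norm_num)
          positivity
      _ = _ := by
        rw [← Real.rpow_natCast, ← Real.rpow_mul h0]; norm_num
  linarith

lemma Kset_bound (p : ℕ) [Fact p.Prime] (hp3 : 3 ≤ p) (lam : ZMod p) (hl : lam ≠ 0) (A D : Finset (ZMod p))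
    (u v : ZMod p)
    (M N : ℕ) (hM : 1 ≤ M) (hN : 1 ≤ N) (hMp : M ≤ p) (hNp : N ≤ p) (hA : 1 ≤ A.card)
    (m q : ℝ) (hm : 0 ≤ m) (hq : 0 ≤ q) (hmn : m ^ 6 = M * N) (hqn : q ^ 12 = M * N / p)
    (hL : 1 ≤ Real.log p) :
    ((Kset lam A (apF p u N) (apF p v M) D).card : ℝ) ≤
      117 * Real.log p * (m ^ 24 + m ^ 20 * (1 + q ^ 4) * A.card ^ 2) := by
  classical
  set K := Kset lam A (apF p u N) (apF p v M) D with hK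
  have hBc := apF_card p N u hNp
  have hCc := apF_card p M v hMp
  have h1 := Kset_t0 lam hl A (apF p u N) (apF p v M) D
  have h2 := Kset_w0 lam hl A (apF p u N) (apF p v M) D
  have h3 := Kset_main lam hl A D u v N M
  rw [hBc, hCc] at h1 h2 h3
  rw [← hK] at h1 h2 h3
  have hsplit : K.card ≤ (K.filter fun q => q.2.1.2.1.1 = q.2.2.2.1.1).card +
      (K.filter fun q => q.2.2.2.2.2 = q.2.2.2.1.2).card +
      (K.filter fun q => ¬ q.2.1.2.1.1 = q.2.2.2.1.1 ∧ ¬ q.2.2.2.2.2 = q.2.2.2.1.2).card := by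
    refine le_trans (Finset.card_le_card ?_) ((Finset.card_union_le _ _).trans
      (Nat.add_le_add_right (Finset.card_union_le _ _) _))
    intro x hx
    simp only [Finset.mem_union, Finset.mem_filter]
    tauto
  have h4 : ((∑ e ∈ apF p u N, ∑ x ∈ Omg p M N (apF p u N), (Tcnt A e (gkey lam⁻¹ x)).card : ℕ) : ℝ) ≤
      N * (16 * m ^ 12 + 115 * Real.log p * m ^ 8 * (1 + q ^ 4) * A.card ^ 2) := by
    rw [Nat.cast_sum]
    refine (Finset.sum_le_card_nsmul _ _ _ fun e _ =>
      word_sum p hp3 lam hl A (apF p u N) M N hM hN hMp hNp hBc hA e m q hm hq hmn hqn hL).trans ?_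
    rw [nsmul_eq_mul, hBc]
  set L := Real.log p with hLdef
  have hm1 : 1 ≤ m := by
    by_contra hlt
    push Not at hlt
    have h5 : m ^ 6 < 1 := pow_lt_one₀ hm hlt (by norm_num)
    have : (1:ℝ) ≤ M := by exact_mod_cast hM
    have : (1:ℝ) ≤ N := by exact_mod_cast hN
    nlinarith
  have c1 : ((K.filter fun q => q.2.1.2.1.1 = q.2.2.2.1.1).card : ℝ) ≤ m ^ 18 * A.card ^ 2 := by
    have : ((K.filter fun q => q.2.1.2.1.1 = q.2.2.2.1.1).card : ℝ) ≤ (N * M : ℝ) ^ 3 * A.card ^ 2 := by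
      exact_mod_cast h1
    rw [mul_comm (N:ℝ), ← hmn, ← pow_mul] at this
    exact this
  have c2 : ((K.filter fun q => q.2.2.2.2.2 = q.2.2.2.1.2).card : ℝ) ≤ m ^ 18 * A.card ^ 2 := by
    have : ((K.filter fun q => q.2.2.2.2.2 = q.2.2.2.1.2).card : ℝ) ≤ (N * M : ℝ) ^ 3 * A.card ^ 2 := by
      exact_mod_cast h2
    rw [mul_comm (N:ℝ), ← hmn, ← pow_mul] at this
    exact this
  have c3 : ((K.filter fun q => ¬ q.2.1.2.1.1 = q.2.2.2.1.1 ∧ ¬ q.2.2.2.2.2 = q.2.2.2.1.2).card : ℝ) ≤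
      m ^ 12 * (16 * m ^ 12 + 115 * L * m ^ 8 * (1 + q ^ 4) * A.card ^ 2) := by
    have : ((K.filter fun q => ¬ q.2.1.2.1.1 = q.2.2.2.1.1 ∧ ¬ q.2.2.2.2.2 = q.2.2.2.1.2).card : ℝ) ≤
      (N * M ^ 2 : ℝ) * ((∑ e ∈ apF p u N, ∑ x ∈ Omg p M N (apF p u N), (Tcnt A e (gkey lam⁻¹ x)).card : ℕ) : ℝ) := by
      exact_mod_cast h3
    refine this.trans ((mul_le_mul_of_nonneg_left h4 (by positivity)).trans (le_of_eq ?_))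
    have : m ^ 12 = (M * N : ℝ) ^ 2 := by rw [← hmn]; ring
    rw [this]; ring
  have c0 : (K.card : ℝ) ≤ (K.filter fun q => q.2.1.2.1.1 = q.2.2.2.1.1).card +
      (K.filter fun q => q.2.2.2.2.2 = q.2.2.2.1.2).card +
      (K.filter fun q => ¬ q.2.1.2.1.1 = q.2.2.2.1.1 ∧ ¬ q.2.2.2.2.2 = q.2.2.2.1.2).card := by
    exact_mod_cast hsplit
  have d1 : m ^ 18 * (A.card : ℝ) ^ 2 ≤ L * (m ^ 20 * (1 + q ^ 4) * A.card ^ 2) := by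
    have e1 : m ^ 18 ≤ m ^ 20 := pow_le_pow_right₀ hm1 (by norm_num)
    have e2 : (1:ℝ) ≤ 1 + q ^ 4 := by have : 0 ≤ q ^ 4 := by positivity
                                      linarith
    calc m ^ 18 * (A.card : ℝ) ^ 2 = 1 * (m ^ 18 * 1 * (A.card : ℝ) ^ 2) := by ring
      _ ≤ _ := by gcongr
  have d2 : m ^ 24 ≤ L * m ^ 24 := le_mul_of_one_le_left (by positivity) hL
  have d3 : 0 ≤ L * m ^ 24 := by positivity
  calc (K.card : ℝ) ≤ _ := c0
    _ ≤ m ^ 18 * A.card ^ 2 + m ^ 18 * A.card ^ 2 +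
      m ^ 12 * (16 * m ^ 12 + 115 * L * m ^ 8 * (1 + q ^ 4) * A.card ^ 2) := by gcongr
    _ = 2 * (m ^ 18 * A.card ^ 2) + 16 * m ^ 24 + 115 * (L * (m ^ 20 * (1 + q ^ 4) * A.card ^ 2)) := by ring
    _ ≤ _ := by nlinarith

theorem stmt5 :
    ∃ C c : ℝ, 1 ≤ C ∧ 1 ≤ c ∧
      ∀ (p : ℕ), p.Prime → Odd p →
        ∀ (lam : ZMod p), lam ≠ 0 →
          ∀ (N₁ N₂ : ℕ), 1 ≤ N₁ → N₁ ≤ p → 1 ≤ N₂ → N₂ ≤ p →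
            ∀ (u v : ZMod p), ∀ A D : Finset (ZMod p),
              (hypCount p lam A (apF p u N₁) (apF p v N₂) D : ℝ) -
                  (A.card : ℝ) * (apF p u N₁).card * (apF p v N₂).card * D.card / p ≤
                C * Real.log p ^ c *
                  ((A.card : ℝ) ^ ((1 : ℝ) / 4) * (apF p u N₁).card * (apF p v N₂).card *
                      (D.card : ℝ) ^ ((1 : ℝ) / 2) +
                    (A.card : ℝ) ^ ((3 : ℝ) / 4) * (D.card : ℝ) ^ ((1 : ℝ) / 2) *
                      (((apF p u N₁).card : ℝ) * (apF p v N₂).card) ^ ((5 : ℝ) / 6) *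
                      (1 + ((((apF p u N₁).card : ℝ) * (apF p v N₂).card) / p) ^
                        ((1 : ℝ) / 12))) := by
  refine ⟨4, 1, by norm_num, le_refl 1, ?_⟩
  intro p hp hodd lam hl N M hN hNp hM hMp u v A D
  haveI : Fact p.Prime := ⟨hp⟩
  have hp3 : 3 ≤ p := by
    have := hp.two_le
    rcases hodd with ⟨k, hk⟩
    omega
  have hL : 1 ≤ Real.log p := by
    rw [Real.le_log_iff_exp_le (by positivity)]
    have := Real.exp_one_lt_d9
    have : (3:ℝ) ≤ p := by exact_mod_cast hp3
    linarith
  rw [Real.rpow_one]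
  have hmain := hyp_fourth lam A (apF p u N) (apF p v M) D
  have hsub : (0:ℝ) ≤ (A.card : ℝ) * (apF p u N).card * (apF p v M).card * D.card / p := by positivity
  refine (sub_le_self _ hsub).trans ?_
  rcases Nat.eq_zero_or_pos A.card with hA0 | hA
  · rw [hA0, mul_zero, zero_mul] at hmain
    have : hypCount p lam A (apF p u N) (apF p v M) D = 0 := by
      apply pow_eq_zero_iff (n := 4) (by norm_num) |>.1
      omega
    rw [this, Nat.cast_zero]
    positivity
  have hpr : (0:ℝ) < p := by positivity
  have hroot : ∀ (x : ℝ) (n k : ℕ) (r : ℝ), 0 ≤ x → n ≠ 0 → r = (k:ℝ) / n → x ^ r = (x ^ ((1:ℝ)/n)) ^ k := by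
    intro x n k r hx hn hr
    rw [← Real.rpow_natCast, ← Real.rpow_mul hx, hr]
    congr 1; ring
  have hself : ∀ (x : ℝ) (n : ℕ), 0 ≤ x → n ≠ 0 → (x ^ ((1:ℝ)/n)) ^ n = x := by
    intro x n hx hn
    rw [one_div]; exact Real.rpow_inv_natCast_pow hx hn
  rw [apF_card p N u hNp, apF_card p M v hMp]
  set n : ℝ := (N:ℝ) * M with hn
  have hn0 : 0 ≤ n := by positivity
  obtain ⟨m, hmdef⟩ : ∃ m : ℝ, m = n ^ ((1:ℝ)/(6:ℕ)) := ⟨_, rfl⟩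
  obtain ⟨q, hqdef⟩ : ∃ q : ℝ, q = (n / p) ^ ((1:ℝ)/(12:ℕ)) := ⟨_, rfl⟩
  obtain ⟨a, hadef⟩ : ∃ a : ℝ, a = (A.card : ℝ) ^ ((1:ℝ)/(4:ℕ)) := ⟨_, rfl⟩
  obtain ⟨d, hddef⟩ : ∃ d : ℝ, d = (D.card : ℝ) ^ ((1:ℝ)/(2:ℕ)) := ⟨_, rfl⟩
  have hm0 : 0 ≤ m := by rw [hmdef]; positivity
  have hq0 : 0 ≤ q := by rw [hqdef]; positivity
  have ha0 : 0 ≤ a := by rw [hadef]; positivity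
  have hd0 : 0 ≤ d := by rw [hddef]; positivity
  have hm6 : m ^ 6 = n := by rw [hmdef]; exact hself n 6 hn0 (by norm_num)
  have hq12 : q ^ 12 = n / p := by rw [hqdef]; exact hself (n/p) 12 (by positivity) (by norm_num)
  have ha4 : a ^ 4 = A.card := by rw [hadef]; exact hself _ 4 (by positivity) (by norm_num)
  have hd2 : d ^ 2 = D.card := by rw [hddef]; exact hself _ 2 (by positivity) (by norm_num)
  have r1 : n ^ ((5:ℝ)/6) = m ^ 5 := by
    rw [hmdef]; exact hroot n 6 5 _ hn0 (by norm_num) (by norm_num)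
  have r2 : (A.card : ℝ) ^ ((3:ℝ)/4) = a ^ 3 := by
    rw [hadef]; exact hroot _ 4 3 _ (by positivity) (by norm_num) (by norm_num)
  have r3 : (A.card : ℝ) ^ ((1:ℝ)/4) = a := by rw [hadef]; norm_num
  have r4 : (D.card : ℝ) ^ ((1:ℝ)/2) = d := by rw [hddef]; norm_num
  have r5 : (n / p) ^ ((1:ℝ)/12) = q := by rw [hqdef]; norm_num
  have hKb := Kset_bound p hp3 lam hl A D u v M N hM hN hMp hNp hA m q hm0 hq0
    (by rw [hm6, hn]; ring) (by rw [hq12, hn]; ring) hL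
  rw [r1, r2, r3, r4, r5]
  set L := Real.log p with hLdef
  set I := hypCount p lam A (apF p u N) (apF p v M) D with hI
  have hI4 : (I : ℝ) ^ 4 ≤ (D.card : ℝ) ^ 2 * A.card * (Kset lam A (apF p u N) (apF p v M) D).card := by
    exact_mod_cast hmain
  have e1 : a * N * M * d = a * m ^ 6 * d := by rw [hm6, hn]; ring
  rw [e1]
  apply le_of_pow_le_pow_left₀ (n := 4) (by norm_num) (by positivity)
  calc (I : ℝ) ^ 4 ≤ _ := hI4
    _ ≤ (D.card : ℝ) ^ 2 * A.card * (117 * L * (m ^ 24 + m ^ 20 * (1 + q ^ 4) * A.card ^ 2)) := by gcongr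
    _ = 117 * L * ((a * m ^ 6 * d) ^ 4 + (a ^ 3 * d * m ^ 5) ^ 4 * (1 + q ^ 4)) := by
      rw [← ha4, ← hd2]; ring
    _ ≤ 256 * L ^ 4 * ((a * m ^ 6 * d) + (a ^ 3 * d * m ^ 5) * (1 + q)) ^ 4 := by
      have f1 : L ≤ L ^ 4 := le_self_pow₀ hL (by norm_num)
      have f2 : ∀ x y : ℝ, 0 ≤ x → 0 ≤ y → x ^ 4 + y ^ 4 ≤ (x + y) ^ 4 := by
        intro x y hx hy
        have : (x + y) ^ 4 = x ^ 4 + y ^ 4 + (4 * x ^ 3 * y + 6 * x ^ 2 * y ^ 2 + 4 * x * y ^ 3) := by ring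
        rw [this]
        have : 0 ≤ 4 * x ^ 3 * y + 6 * x ^ 2 * y ^ 2 + 4 * x * y ^ 3 := by positivity
        linarith
      have f3 : (a * m ^ 6 * d) ^ 4 + (a ^ 3 * d * m ^ 5) ^ 4 * (1 + q ^ 4) ≤
          ((a * m ^ 6 * d) + (a ^ 3 * d * m ^ 5) * (1 + q)) ^ 4 := by
        refine le_trans ?_ (f2 _ _ (by positivity) (by positivity))
        rw [mul_pow (a ^ 3 * d * m ^ 5) (1 + q)]
        have := f2 1 q (by norm_num) hq0
        rw [one_pow] at this
        gcongr
      gcongr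
      norm_num
    _ = _ := by ring
end
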